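/- arXiv:1712.08562 — 3 statements merged into one kernel-verified Lean document; each statement's English description precedes it below -/
import Mathlib

section
/- Let k be an algebraically closed field, let R_0 := k(t)[x,y]_{(x,y)} and let K = k(t)(x,y) be its quotient field. Then there exists a valuation ν of K dominating R_0 whose value group is (order-isomorphic to) a subgroup of ℚ (so ν has rank 1), with the following property: for every regular local ring A of K which dominates R_0 and is dominated by ν, there exist a prime number p̄ different from the characteristic of k and a root λ of X^{p̄} − (1+t) in an algebraic closure of K with [K(λ):K] = p̄, such that for every valuation ν̄ of L := K(λ) extending ν (i.e., with V_ν̄ ∩ K = V_ν), if C denotes the localization of A[λ] (the subring of L generated by A and λ) at the prime m_ν̄ ∩ A[λ], then C is a regular local ring, the extension A → C is unramified (m_A·C = m_C with finite separable residue field extension), and S^C(ν̄) ≠ S^A(ν), i.e., there exists a nonzero h ∈ C such that ν̄(h) ≠ ν̄(f) for every nonzero f ∈ A. -/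
set_option maxHeartbeats 4000000
set_option synthInstance.maxHeartbeats 1000000

noncomputable section

/-- `x` lies in (the image in `F` of) the set of nonunits of the subring `S`. -/
def Subring.inNonunits {F : Type*} [Field F] (S : Subring F) (x : F) : Prop :=
  x ∈ S ∧ ¬(x ≠ 0 ∧ x⁻¹ ∈ S)

/-- The local subring `B` dominates the local subring `S`: `S ⊆ B` and `m_B ∩ S = m_S`. -/
def SDominates {F : Type*} [Field F] (B S : Subring F) : Prop :=
  S ≤ B ∧ ∀ x ∈ S, (B.inNonunits x ↔ S.inNonunits x)

/-- `F` is the quotient field of `S`. -/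
def IsFractionSubring {F : Type*} [Field F] (S : Subring F) : Prop :=
  ∀ x : F, ∃ a ∈ S, ∃ b ∈ S, b ≠ 0 ∧ x * b = a

/-- A regular local ring: a Noetherian local ring whose maximal ideal (= the set of
nonunits) can be generated by `Krull dimension`-many elements. -/
def IsRegularLocal (R : Type*) [CommRing R] : Prop :=
  IsNoetherianRing R ∧ IsLocalRing R ∧
    ∃ s : Finset R, ((Ideal.span (s : Set R) : Ideal R) : Set R) = {x : R | ¬IsUnit x} ∧
      (s.card : WithBot (WithTop ℕ)) = ringKrullDim R

/-- `v` is (the additive form of) a `ℚ`-valued valuation on the field `K`;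
in particular its value group is a subgroup of `ℚ`, so it has rank 1. -/
def IsQValuation {K : Type*} [Field K] (v : K → ℚ) : Prop :=
  (∀ a b : K, a ≠ 0 → b ≠ 0 → v (a * b) = v a + v b) ∧
  (∀ a b : K, a ≠ 0 → b ≠ 0 → a + b ≠ 0 → min (v a) (v b) ≤ v (a + b))

/-- The (`ℚ`-valued, additively written) valuation `v` dominates the local subring `S`:
`S ⊆ V_v` and `m_v ∩ S = m_S`. -/
def QDominates {K : Type*} [Field K] (v : K → ℚ) (S : Subring K) : Prop :=
  (∀ x ∈ S, x ≠ 0 → 0 ≤ v x) ∧ ∀ x ∈ S, (S.inNonunits x ↔ (x = 0 ∨ 0 < v x))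

/-- The polynomial ring `k(t)[x,y]`. -/
abbrev RP2 (k : Type*) [Field k] := MvPolynomial (Fin 2) (RatFunc k)

/-- The rational function field `K = k(t)(x,y)`. -/
abbrev K2 (k : Type*) [Field k] := FractionRing (RP2 k)

/-- Polynomials in `k(t)[x,y]` not lying in the maximal ideal `(x,y)`. -/
def M2 (k : Type*) [Field k] : Submonoid (RP2 k) where
  carrier := {g | MvPolynomial.eval (0 : Fin 2 → RatFunc k) g ≠ 0}
  one_mem' := by simp
  mul_mem' := by
    intro a b ha hb
    simp only [Set.mem_setOf_eq, map_mul] at *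
    exact mul_ne_zero ha hb

/-- The local ring `R_0 = k(t)[x,y]_{(x,y)}`, realized as a subring of `K = k(t)(x,y)`. -/
def R0 (k : Type*) [Field k] : Subring (K2 k) :=
  (IsLocalization.lift (M := M2 k) (S := Localization (M2 k))
    (g := algebraMap (RP2 k) (K2 k))
    (fun y => isUnit_iff_ne_zero.mpr (by
      have h0 : (y : RP2 k) ≠ 0 := by
        intro h
        have hy := y.2
        rw [h] at hy
        exact hy (map_zero _)
      exact (map_ne_zero_iff _ (IsFractionRing.injective (RP2 k) (K2 k))).mpr h0))).range

/-- The element `1 + t` of `K = k(t)(x,y)`. -/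
def onePlusT (k : Type*) [Field k] : K2 k :=
  algebraMap (RP2 k) (K2 k) (MvPolynomial.C (1 + RatFunc.X))

/-- The extension field `L = K(λ)` inside an algebraic closure of `K`. -/
abbrev Lext (k : Type*) [Field k] (lam : AlgebraicClosure (K2 k)) :
    IntermediateField (K2 k) (AlgebraicClosure (K2 k)) :=
  IntermediateField.adjoin (K2 k) {lam}

/-- `λ` as an element of `L = K(λ)`. -/
def lamel (k : Type*) [Field k] (lam : AlgebraicClosure (K2 k)) : Lext k lam :=
  ⟨lam, IntermediateField.mem_adjoin_simple_self (K2 k) lam⟩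

/-- The subring `B = A[λ]` of `L` generated by (the image of) `A` together with `λ`. -/
def Bgen (k : Type*) [Field k] (A : Subring (K2 k)) (lam : AlgebraicClosure (K2 k)) :
    Subring (Lext k lam) :=
  Subring.closure
    ((A.map (algebraMap (K2 k) (Lext k lam)) : Set (Lext k lam)) ∪ {lamel k lam})

/-- The homogeneous form `∑ cᵢ uⁱ wⁿ⁻ⁱ` of degree `n`. -/
def binaryForm {R : Type*} [CommRing R] (u w : R) (n : ℕ) (c : ℕ → R) : R :=
  ∑ i ∈ Finset.range (n + 1), c i * u ^ i * w ^ (n - i)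

section BinaryForm

variable {R : Type*} [CommRing R]

lemma binaryForm_succ (u w : R) (n : ℕ) (c : ℕ → R) :
    binaryForm u w (n + 1) c = u * binaryForm u w n (fun i => c (i + 1)) + c 0 * w ^ (n + 1) := by
  unfold binaryForm
  rw [Finset.sum_range_succ', Finset.mul_sum]
  congr 1
  · apply Finset.sum_congr rfl
    intro i _
    rw [show n + 1 - (i + 1) = n - i by omega]
    ring
  · simp

lemma binaryForm_add (u w : R) (n : ℕ) (c d : ℕ → R) :
    binaryForm u w n (fun i => c i + d i) = binaryForm u w n c + binaryForm u w n d := by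
  simp only [binaryForm, add_mul, Finset.sum_add_distrib]

lemma binaryForm_sub (u w : R) (n : ℕ) (c d : ℕ → R) :
    binaryForm u w n (fun i => c i - d i) = binaryForm u w n c - binaryForm u w n d := by
  simp only [binaryForm, sub_mul, Finset.sum_sub_distrib]

lemma mul_binaryForm_right (u w : R) (n : ℕ) (c : ℕ → R) :
    w * binaryForm u w n c = binaryForm u w (n + 1) (fun i => if i ≤ n then c i else 0) := by
  unfold binaryForm
  rw [Finset.sum_range_succ _ (n + 1), Finset.mul_sum]
  simp only [show ¬ (n + 1 ≤ n) by omega, if_false, zero_mul, add_zero]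
  apply Finset.sum_congr rfl
  intro i hi
  have : i ≤ n := by simpa [Nat.lt_succ_iff] using hi
  rw [if_pos this, show n + 1 - i = (n - i) + 1 by omega]
  ring

lemma mul_binaryForm_left (u w : R) (n : ℕ) (c : ℕ → R) :
    u * binaryForm u w n c = binaryForm u w (n + 1) (fun i => if i = 0 then 0 else c (i - 1)) := by
  rw [binaryForm_succ]
  simp

lemma binaryForm_mem (u w : R) (n : ℕ) (c : ℕ → R) (J : Ideal R) (hc : ∀ i, i ≤ n → c i ∈ J) :
    binaryForm u w n c ∈ J * Ideal.span {u, w} ^ n := by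
  refine Ideal.sum_mem _ fun i hi => ?_
  have hi : i ≤ n := by simpa [Nat.lt_succ_iff] using hi
  rw [mul_assoc]
  refine Ideal.mul_mem_mul (hc i hi) ?_
  have : Ideal.span {u, w} ^ n = Ideal.span {u, w} ^ i * Ideal.span {u, w} ^ (n - i) := by
    rw [← pow_add]; congr 1; omega
  rw [this]
  exact Ideal.mul_mem_mul (Ideal.pow_mem_pow (Ideal.subset_span (by simp)) _)
    (Ideal.pow_mem_pow (Ideal.subset_span (by simp)) _)

lemma mem_mul_span_pair_pow (u w : R) (J : Ideal R) (n : ℕ) (z : R)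
    (hz : z ∈ J * Ideal.span {u, w} ^ n) :
    ∃ c : ℕ → R, (∀ i, c i ∈ J) ∧ z = binaryForm u w n c := by
  induction n generalizing z with
  | zero => exact ⟨fun _ => z, fun _ => by simpa using hz, by simp [binaryForm]⟩
  | succ n ih =>
    have hsp : J * Ideal.span {u, w} ^ n * Ideal.span {u, w} =
        J * Ideal.span {u, w} ^ n * Ideal.span {u} ⊔
          J * Ideal.span {u, w} ^ n * Ideal.span {w} := by
      rw [← Ideal.mul_sup, ← Ideal.span_insert]
    rw [pow_succ, ← mul_assoc, hsp] at hz
    obtain ⟨x, hx, y, hy, rfl⟩ := Submodule.mem_sup.1 hz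
    obtain ⟨a, ha, rfl⟩ := Ideal.mem_mul_span_singleton.1 hx
    obtain ⟨b, hb, rfl⟩ := Ideal.mem_mul_span_singleton.1 hy
    obtain ⟨c, hc, rfl⟩ := ih a ha
    obtain ⟨d, hd, rfl⟩ := ih b hb
    refine ⟨fun i => (if i = 0 then 0 else c (i - 1)) + (if i ≤ n then d i else 0),
      fun i => J.add_mem ?_ ?_, ?_⟩
    · split_ifs
      · exact J.zero_mem
      · exact hc _
    · split_ifs
      · exact hd _
      · exact J.zero_mem
    · rw [binaryForm_add, ← mul_binaryForm_left, ← mul_binaryForm_right, mul_comm u, mul_comm w]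

/-- A form in a regular sequence `a, b` that vanishes has all its coefficients in `(a, b)`. -/
lemma coeff_mem_of_binaryForm_eq_zero [IsDomain R] {a b : R} (ha : a ≠ 0)
    (hab : ∀ z, a ∣ b * z → a ∣ z) (n : ℕ) (c : ℕ → R) (h : binaryForm a b n c = 0) :
    ∀ i, i ≤ n → c i ∈ Ideal.span {a, b} := by
  have hpow : ∀ (n : ℕ) z, a ∣ b ^ n * z → a ∣ z := by
    intro n
    induction n with
    | zero => simp
    | succ n ih => intro z hz; exact ih z (hab _ (by rwa [← mul_assoc, ← pow_succ']))
  have hamem : a ∈ Ideal.span {a, b} := Ideal.subset_span (by simp)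
  have hbmem : b ∈ Ideal.span {a, b} := Ideal.subset_span (by simp)
  induction n generalizing c with
  | zero =>
    intro i hi
    obtain rfl : i = 0 := by omega
    have : c 0 = 0 := by simpa [binaryForm] using h
    rw [this]; exact Ideal.zero_mem _
  | succ n ih =>
    rw [binaryForm_succ] at h
    have h0 : a ∣ c 0 := hpow (n + 1) _ ⟨- binaryForm a b n (fun i => c (i + 1)), by
      linear_combination h⟩
    obtain ⟨d, hd⟩ := h0
    have key : binaryForm a b n (fun i => c (i + 1) + if i = 0 then d * b else 0) = 0 := by
      apply mul_left_cancel₀ ha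
      rw [binaryForm_add, mul_zero]
      have : binaryForm a b n (fun i => if i = 0 then d * b else 0) = d * b ^ (n + 1) := by
        unfold binaryForm
        rw [Finset.sum_eq_single 0]
        · simp [pow_succ']; ring
        · intro i _ hi; simp [hi]
        · simp
      rw [this]
      rw [hd] at h
      linear_combination h
    have := ih _ key
    intro i hi
    rcases i with _ | i
    · rw [hd]; exact Ideal.mul_mem_right _ _ hamem
    · have h1 := this i (by omega)
      split_ifs at h1 with h2
      · exact (Ideal.add_mem_iff_left _ (Ideal.mul_mem_left _ _ hbmem)).1 h1
      · simpa using h1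

lemma coeff_mem_of_binaryForm_mem [IsDomain R] {a b : R} (ha : a ≠ 0)
    (hab : ∀ z, a ∣ b * z → a ∣ z) (J : Ideal R) (hJa : a ∈ J) (hJb : b ∈ J) (n : ℕ) (c : ℕ → R)
    (h : binaryForm a b n c ∈ J * Ideal.span {a, b} ^ n) :
    ∀ i, i ≤ n → c i ∈ J := by
  obtain ⟨d, hd, h⟩ := mem_mul_span_pair_pow a b J n _ h
  intro i hi
  have h1 := coeff_mem_of_binaryForm_eq_zero ha hab n (fun i => c i - d i)
    (by rw [binaryForm_sub, h, sub_self]) i hi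
  have h2 : Ideal.span {a, b} ≤ J := by
    rw [Ideal.span_le]
    rintro x (rfl | rfl) <;> assumption
  simpa using J.add_mem (h2 h1) (hd i)

lemma map_binaryForm {S : Type*} [CommRing S] (f : R →+* S) (u w : R) (n : ℕ) (c : ℕ → R) :
    f (binaryForm u w n c) = binaryForm (f u) (f w) n (fun i => f (c i)) := by
  simp [binaryForm, map_sum]

lemma binaryForm_smul (d u w : R) (n : ℕ) (c : ℕ → R) :
    binaryForm (d * u) (d * w) n c = d ^ n * binaryForm u w n c := by
  unfold binaryForm
  rw [Finset.mul_sum]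
  apply Finset.sum_congr rfl
  intro i hi
  have hi : i ≤ n := by simpa [Nat.lt_succ_iff] using hi
  rw [mul_pow, mul_pow, show d ^ n = d ^ i * d ^ (n - i) by rw [← pow_add]; congr 1; omega]
  ring

end BinaryForm

/-- `R` is a two-dimensional regular local domain with regular parameters `u, w`. -/
structure IsReg2 (R : Type*) [CommRing R] (u w : R) : Prop where
  noeth : IsNoetherianRing R
  isLocal : IsLocalRing R
  mem_iff : ∀ z : R, ¬ IsUnit z ↔ z ∈ Ideal.span {u, w}
  prime : Prime u
  not_dvd : ¬ u ∣ w

section Local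

variable {R : Type*} [CommRing R]

lemma maximalIdeal_eq_of_mem_iff [IsLocalRing R] {I : Ideal R} (h : ∀ z : R, ¬ IsUnit z ↔ z ∈ I) :
    IsLocalRing.maximalIdeal R = I := by
  ext z
  rw [IsLocalRing.mem_maximalIdeal, mem_nonunits_iff, h]

/-- In a Noetherian local ring with maximal ideal `(u, w)`, every element outside `(u)` is a unit
times a power of `w` modulo `u`. -/
lemma exists_unit_mul_pow_add [IsNoetherianRing R] [IsLocalRing R] {u w : R}
    (hm : IsLocalRing.maximalIdeal R = Ideal.span {u, w}) {z : R} (hz : ¬ u ∣ z) :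
    ∃ (e : R) (r : ℕ) (b : R), IsUnit e ∧ z = e * w ^ r + u * b := by
  by_cases hu : IsUnit u
  · exact absurd hu.dvd hz
  have hle : Ideal.span {u} ≠ ⊤ := by rwa [Ne, Ideal.span_singleton_eq_top]
  have : Nontrivial (R ⧸ Ideal.span {u}) := Ideal.Quotient.nontrivial_iff.2 hle
  have : IsLocalRing (R ⧸ Ideal.span {u}) :=
    IsLocalRing.of_surjective' (Ideal.Quotient.mk _) Ideal.Quotient.mk_surjective
  have hwm : w ∈ IsLocalRing.maximalIdeal R := by rw [hm]; exact Ideal.subset_span (by simp)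
  have hum : u ∈ IsLocalRing.maximalIdeal R := by rw [hm]; exact Ideal.subset_span (by simp)
  have hkr := Ideal.iInf_pow_eq_bot_of_isLocalRing
    (I := Ideal.map (Ideal.Quotient.mk (Ideal.span {u})) (IsLocalRing.maximalIdeal R)) (by
      intro h
      have h2 := congrArg (Ideal.comap (Ideal.Quotient.mk (Ideal.span {u}))) h
      rw [Ideal.comap_map_of_surjective _ Ideal.Quotient.mk_surjective, Ideal.comap_top,
        ← RingHom.ker_eq_comap_bot, Ideal.mk_ker, sup_eq_left.2] at h2
      · exact (IsLocalRing.maximalIdeal.isMaximal R).ne_top h2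
      · rw [Ideal.span_le]; simpa using hum)
  have hmem : ∃ r : ℕ, ¬ ∃ a b : R, z = a * w ^ r + u * b := by
    by_contra hcon
    push Not at hcon
    apply hz
    rw [← Ideal.mem_span_singleton, ← Ideal.Quotient.eq_zero_iff_mem, ← Ideal.mem_bot, ← hkr]
    rw [Ideal.mem_iInf]
    intro r
    obtain ⟨a, b, h⟩ := hcon r
    rw [← Ideal.map_pow]
    have : Ideal.Quotient.mk (Ideal.span {u}) z =
        Ideal.Quotient.mk (Ideal.span {u}) (a * w ^ r) := by
      rw [Ideal.Quotient.eq, h, Ideal.mem_span_singleton]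
      exact ⟨b, by ring⟩
    rw [this]
    exact Ideal.mem_map_of_mem _ (Ideal.mul_mem_left _ _ (Ideal.pow_mem_pow hwm _))
  classical
  obtain ⟨r, hr⟩ : ∃ r, r + 1 = Nat.find hmem := by
    refine ⟨Nat.find hmem - 1, Nat.sub_add_cancel ?_⟩
    by_contra h0
    have h0 : Nat.find hmem = 0 := by omega
    exact (Nat.find_eq_zero hmem).1 h0 ⟨z, 0, by simp⟩
  have h1 := Nat.find_min hmem (m := r) (by omega)
  have h2 := Nat.find_spec hmem
  rw [← hr] at h2
  push Not at h1
  obtain ⟨a, b, h⟩ := h1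
  refine ⟨a, r, b, ?_, h⟩
  by_contra ha
  have ha : a ∈ IsLocalRing.maximalIdeal R := ha
  rw [hm, Ideal.mem_span_pair] at ha
  obtain ⟨a1, a2, rfl⟩ := ha
  exact h2 ⟨a2, b + a1 * w ^ r, by rw [h]; ring⟩

lemma isPrincipal_of_notMem [IsNoetherianRing R] [IsLocalRing R] {u w : R}
    (hm : IsLocalRing.maximalIdeal R = Ideal.span {u, w}) (q : Ideal R) [hq : q.IsPrime]
    (huq : u ∉ q) : ∃ g, q = Ideal.span {g} := by
  classical
  have hum : u ∈ IsLocalRing.maximalIdeal R := by rw [hm]; exact Ideal.subset_span (by simp)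
  have hjac : Ideal.span {u} ≤ Ideal.jacobson ⊥ := by
    rw [IsLocalRing.jacobson_eq_maximalIdeal _ bot_ne_top, Ideal.span_le]
    simpa using hum
  by_cases hall : ∀ z ∈ q, u ∣ z
  · refine ⟨0, ?_⟩
    have : q ≤ ⊥ := by
      refine Submodule.le_of_le_smul_of_le_jacobson_bot (IsNoetherian.noetherian q) hjac ?_
      intro z hz
      obtain ⟨b, rfl⟩ := hall z hz
      refine Submodule.mem_sup_right ?_
      have hb : b ∈ q := (hq.mem_or_mem hz).resolve_left huq
      exact Submodule.smul_mem_smul (Ideal.mem_span_singleton_self u) hb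
    simpa using this
  · push Not at hall
    have hex : ∃ r : ℕ, ∃ e b : R, IsUnit e ∧ e * w ^ r + u * b ∈ q := by
      obtain ⟨z, hz, hzu⟩ := hall
      obtain ⟨e, r, b, he, rfl⟩ := exists_unit_mul_pow_add hm hzu
      exact ⟨r, e, b, he, hz⟩
    obtain ⟨e, b, he, hg⟩ := Nat.find_spec hex
    set r := Nat.find hex with hr
    refine ⟨e * w ^ r + u * b, le_antisymm ?_ ((Ideal.span_singleton_le_iff_mem _).2 hg)⟩
    refine Submodule.le_of_le_smul_of_le_jacobson_bot (IsNoetherian.noetherian q) hjac ?_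
    intro z hz
    have key : ∃ c, u ∣ z - c * (e * w ^ r + u * b) := by
      by_cases hzu : u ∣ z
      · exact ⟨0, by simpa using hzu⟩
      · obtain ⟨e', r', b', he', rfl⟩ := exists_unit_mul_pow_add hm hzu
        have hle : r ≤ r' := Nat.find_min' hex ⟨e', b', he', hz⟩
        obtain ⟨e, rfl⟩ := he
        refine ⟨e' * ↑e⁻¹ * w ^ (r' - r), b' - e' * ↑e⁻¹ * w ^ (r' - r) * b, ?_⟩
        have h1 : w ^ r' = w ^ (r' - r) * w ^ r := by rw [← pow_add]; congr 1; omega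
        have h2 : (↑e⁻¹ : R) * e = 1 := by simp
        rw [h1]
        linear_combination (-(e' * w ^ (r' - r) * w ^ r)) * h2
    obtain ⟨c, b', hb'⟩ := key
    have hb'q : b' ∈ q := by
      have : u * b' ∈ q := by
        rw [← hb']; exact q.sub_mem hz (q.mul_mem_left _ hg)
      exact (hq.mem_or_mem this).resolve_left huq
    have : z = c * (e * w ^ r + u * b) + u * b' := by rw [← hb']; ring
    rw [this]
    exact Submodule.add_mem_sup (Ideal.mul_mem_left _ _ (Ideal.mem_span_singleton_self _))
      (Submodule.smul_mem_smul (Ideal.mem_span_singleton_self u) hb'q)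

lemma isPrincipal_of_isPrime_of_ne [IsNoetherianRing R] [IsLocalRing R] {u w : R}
    (hm : IsLocalRing.maximalIdeal R = Ideal.span {u, w}) (q : Ideal R) [hq : q.IsPrime]
    (hne : q ≠ IsLocalRing.maximalIdeal R) : ∃ g, q = Ideal.span {g} := by
  by_cases hu : u ∈ q
  · by_cases hw : w ∈ q
    · refine absurd (le_antisymm (IsLocalRing.le_maximalIdeal hq.ne_top) ?_) hne
      rw [hm, Ideal.span_le]
      rintro x (rfl | rfl) <;> assumption
    · exact isPrincipal_of_notMem (by rw [hm, Set.pair_comm]) q hw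
  · exact isPrincipal_of_notMem hm q hu

lemma IsReg2.maximalIdeal_eq {u w : R} (h : IsReg2 R u w) [IsLocalRing R] :
    IsLocalRing.maximalIdeal R = Ideal.span {u, w} :=
  maximalIdeal_eq_of_mem_iff h.mem_iff

lemma IsReg2.ufm [IsDomain R] {u w : R} (h : IsReg2 R u w) : UniqueFactorizationMonoid R := by
  have := h.noeth
  have := h.isLocal
  refine UniqueFactorizationMonoid.iff_exists_prime_mem_of_isPrime.2 fun I hI hp => ?_
  by_cases hm : I = IsLocalRing.maximalIdeal R
  · refine ⟨u, ?_, h.prime⟩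
    rw [hm, h.maximalIdeal_eq]
    exact Ideal.subset_span (by simp)
  · obtain ⟨g, rfl⟩ := isPrincipal_of_isPrime_of_ne h.maximalIdeal_eq I hm
    refine ⟨g, Ideal.mem_span_singleton_self g, (Ideal.span_singleton_prime ?_).1 hp⟩
    rintro rfl
    simp at hI

lemma IsReg2.pow_notMem {u w : R} (h : IsReg2 R u w) (n : ℕ) : ¬ u ∣ w ^ n :=
  fun hd => h.not_dvd (h.prime.dvd_of_dvd_pow hd)

lemma isReg2_of_ringKrullDim [IsDomain R] [IsNoetherianRing R] [IsLocalRing R] {u w : R}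
    (hm : ∀ z : R, ¬ IsUnit z ↔ z ∈ Ideal.span {u, w}) (hdim : ringKrullDim R = 2) :
    IsReg2 R u w := by
  have hmax := maximalIdeal_eq_of_mem_iff hm
  have hh : (IsLocalRing.maximalIdeal R).height = 2 := by
    have := IsLocalRing.maximalIdeal_height_eq_ringKrullDim (R := R)
    rw [hdim] at this
    exact WithBot.coe_injective this
  have key : ∀ a ∈ IsLocalRing.maximalIdeal R,
      ¬ IsLocalRing.maximalIdeal R ≤ (Ideal.span {a}).radical := by
    intro a hane ha
    have hmin : IsLocalRing.maximalIdeal R ∈ (Ideal.span {a}).minimalPrimes := by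
      refine ⟨⟨inferInstance, (Ideal.span_singleton_le_iff_mem _).2 hane⟩, fun q hq _ => ?_⟩
      exact ha.trans ((Ideal.radical_mono hq.2).trans hq.1.radical.le)
    have h1 := Ideal.height_le_one_of_isPrincipal_of_mem_minimalPrimes _ _ hmin
    rw [hh] at h1
    exact absurd h1 (by norm_num)
  have hpow : ∀ n : ℕ, ¬ u ∣ w ^ n := by
    intro n hn
    apply key u (by rw [hmax]; exact Ideal.subset_span (by simp))
    rw [hmax, Ideal.span_le]
    rintro x (rfl | rfl)
    · exact Ideal.le_radical (Ideal.mem_span_singleton_self _)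
    · exact ⟨n, Ideal.mem_span_singleton.2 hn⟩
  refine ⟨inferInstance, inferInstance, hm, ⟨?_, ?_, ?_⟩, by simpa using hpow 1⟩
  · rintro rfl
    apply key w (by rw [hmax]; exact Ideal.subset_span (by simp))
    have : Ideal.span {0, w} = Ideal.span {w} := by simp
    rw [hmax, this]
    exact Ideal.le_radical
  · rw [← not_not (a := IsUnit u), not_not, hm]
    exact Ideal.subset_span (by simp)
  · intro a b hab
    by_contra hcon
    push Not at hcon
    obtain ⟨e, r, c, he, rfl⟩ := exists_unit_mul_pow_add hmax hcon.1
    obtain ⟨e', r', c', he', rfl⟩ := exists_unit_mul_pow_add hmax hcon.2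
    apply hpow (r + r')
    rw [← (he.mul he').dvd_mul_left]
    have : u ∣ (e * w ^ r + u * c) * (e' * w ^ r' + u * c') -
        u * (c * (e' * w ^ r' + u * c') + e * w ^ r * c') := dvd_sub hab (Dvd.intro _ rfl)
    convert this using 1
    ring

lemma ringKrullDim_eq_two [IsDomain R] [IsNoetherianRing R] [IsLocalRing R] {u w : R}
    (hm : ∀ z : R, ¬ IsUnit z ↔ z ∈ Ideal.span {u, w}) (hu : u ≠ 0) (hw : ∀ n : ℕ, ¬ u ∣ w ^ n) :
    ringKrullDim R = 2 := by
  have hmax := maximalIdeal_eq_of_mem_iff hm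
  apply le_antisymm
  · refine (ringKrullDim_le_spanFinrank_maximalIdeal R).trans ?_
    rw [hmax]
    have h1 : (Ideal.span {u, w}).spanFinrank ≤ 2 :=
      (Submodule.spanFinrank_span_le_ncard_of_finite (Set.toFinite {u, w})).trans
        ((Set.ncard_insert_le u {w}).trans (by simp))
    exact_mod_cast h1
  · rw [← IsLocalRing.maximalIdeal_height_eq_ringKrullDim]
    have hrad : w ∉ (Ideal.span {u}).radical := by
      rintro ⟨n, hn⟩
      exact hw n (Ideal.mem_span_singleton.1 hn)
    rw [Ideal.radical_eq_sInf, Submodule.mem_sInf] at hrad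
    push Not at hrad
    obtain ⟨p, ⟨hup, hp⟩, hwp⟩ := hrad
    have hup : u ∈ p := hup (Ideal.mem_span_singleton_self u)
    have hlt : p < IsLocalRing.maximalIdeal R := by
      refine lt_of_le_of_ne (IsLocalRing.le_maximalIdeal hp.ne_top) ?_
      rintro rfl
      exact hwp (by rw [hmax]; exact Ideal.subset_span (by simp))
    have hlt0 : (⊥ : Ideal R) < p := by
      rw [bot_lt_iff_ne_bot]
      rintro rfl
      exact hu (by simpa using hup)
    have h1 := Ideal.height_add_one_le_of_lt_of_isPrime hlt
    have h2 := Ideal.height_add_one_le_of_lt_of_isPrime hlt0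
    have h3 : (2 : ℕ∞) ≤ (IsLocalRing.maximalIdeal R).height := by
      refine le_trans ?_ ((add_le_add_left (le_trans (le_add_self) h2) 1).trans h1)
      norm_num
    exact WithBot.coe_le_coe.2 h3

end Local

section Graph

open Polynomial

variable {K F : Type*} [Field K] [Field F]

/-- A subring of `K × F` which is the graph of the residue map (with values in `F`) of a local
subring of `K`. -/
structure IsResGraph (Γ : Subring (K × F)) : Prop where
  single : ∀ b, ((0 : K), b) ∈ Γ → b = 0
  inv : ∀ a b, (a, b) ∈ Γ → b ≠ 0 → (a⁻¹, b⁻¹) ∈ Γ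

namespace IsResGraph

variable {Γ : Subring (K × F)}

/-- The first projection of a graph. -/
def fstHom (Γ : Subring (K × F)) : Γ →+* K := (RingHom.fst K F).comp Γ.subtype

/-- The second projection of a graph. -/
def sndHom (Γ : Subring (K × F)) : Γ →+* F := (RingHom.snd K F).comp Γ.subtype

@[simp] lemma fstHom_apply (z : Γ) : fstHom Γ z = z.1.1 := rfl
@[simp] lemma sndHom_apply (z : Γ) : sndHom Γ z = z.1.2 := rfl

lemma fstHom_injective (h : IsResGraph Γ) : Function.Injective (fstHom Γ) := by
  rw [injective_iff_map_eq_zero]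
  rintro ⟨⟨a, b⟩, hz⟩ ha
  have ha : a = 0 := ha
  subst ha
  obtain rfl := h.single _ hz
  rfl

lemma ext_fst (h : IsResGraph Γ) {z z' : Γ} (hz : z.1.1 = z'.1.1) : z = z' :=
  h.fstHom_injective hz

lemma snd_unique (h : IsResGraph Γ) {a : K} {b b' : F} (h1 : (a, b) ∈ Γ) (h2 : (a, b') ∈ Γ) :
    b = b' := by
  have := h.ext_fst (z := ⟨_, h1⟩) (z' := ⟨_, h2⟩) rfl
  exact congrArg (fun z => z.1.2) this

lemma isDomain (h : IsResGraph Γ) : IsDomain Γ := h.fstHom_injective.isDomain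

lemma isUnit_iff (h : IsResGraph Γ) (z : Γ) : IsUnit z ↔ z.1.2 ≠ 0 := by
  constructor
  · intro hz
    exact (hz.map (sndHom Γ)).ne_zero
  · intro hz
    have hz1 : z.1.1 ≠ 0 := by
      intro h1
      apply hz
      refine h.single _ ?_
      rw [← h1]
      exact z.2
    refine IsUnit.of_mul_eq_one ⟨(z.1.1⁻¹, z.1.2⁻¹), h.inv _ _ z.2 hz⟩ (h.ext_fst ?_)
    exact mul_inv_cancel₀ hz1

lemma isLocalRing (h : IsResGraph Γ) : IsLocalRing Γ := by
  refine IsLocalRing.of_nonunits_add fun a b ha hb => ?_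
  rw [mem_nonunits_iff, h.isUnit_iff, not_not] at *
  simp [ha, hb]

/-- The residue field of a graph, as a subfield of `F`. -/
def kap (h : IsResGraph Γ) : Subfield F where
  toSubring := (sndHom Γ).range
  inv_mem' := by
    rintro _ ⟨z, rfl⟩
    by_cases hz : z.1.2 = 0
    · exact ⟨0, by simp [hz]⟩
    · exact ⟨⟨(z.1.1⁻¹, z.1.2⁻¹), h.inv _ _ z.2 hz⟩, rfl⟩

/-- The residue map of a graph. -/
def res (h : IsResGraph Γ) : Γ →+* h.kap := (sndHom Γ).rangeRestrict

@[simp] lemma coe_res (h : IsResGraph Γ) (z : Γ) : (h.res z : F) = z.1.2 := rfl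

lemma res_surjective (h : IsResGraph Γ) : Function.Surjective h.res :=
  (sndHom Γ).rangeRestrict_surjective

lemma res_eq_zero_iff (h : IsResGraph Γ) (z : Γ) : h.res z = 0 ↔ z.1.2 = 0 := by
  rw [← Subtype.coe_inj]; rfl

end IsResGraph

lemma isNoetherianRing_of_fractions {P S : Type*} [CommRing P] [CommRing S] [IsNoetherianRing P]
    (φ : P →+* S) (h : ∀ z : S, ∃ G H, IsUnit (φ H) ∧ z * φ H = φ G) : IsNoetherianRing S := by
  rw [isNoetherianRing_iff_ideal_fg]
  intro I
  have hI : I = (I.comap φ).map φ := by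
    refine le_antisymm (fun z hz => ?_) Ideal.map_comap_le
    obtain ⟨G, H, hH, hz'⟩ := h z
    have : φ G ∈ (I.comap φ).map φ := by
      apply Ideal.mem_map_of_mem
      rw [Ideal.mem_comap, ← hz']
      exact I.mul_mem_right _ hz
    rw [← hz'] at this
    exact (Ideal.mul_unit_mem_iff_mem _ hH).1 this
  rw [hI]
  exact Ideal.FG.map (IsNoetherian.noetherian (I.comap φ)) φ

section Loc

variable {P : Type*} [CommRing P] (ψ : P →+* K) (ρ : P →+* F)

/-- The graph of the residue map of the localization of `ψ(P)` at the complement of `ker ρ`. -/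
def locGraph : Subring (K × F) where
  carrier := {z | ∃ G H, ρ H ≠ 0 ∧ z.1 * ψ H = ψ G ∧ z.2 * ρ H = ρ G}
  one_mem' := ⟨1, 1, by simp⟩
  zero_mem' := ⟨0, 1, by simp⟩
  mul_mem' := by
    rintro z z' ⟨G, H, h0, h1, h2⟩ ⟨G', H', h0', h1', h2'⟩
    refine ⟨G * G', H * H', ?_, ?_, ?_⟩
    · rw [map_mul]; exact mul_ne_zero h0 h0'
    · rw [map_mul, map_mul, ← h1, ← h1', Prod.fst_mul]; ring
    · rw [map_mul, map_mul, ← h2, ← h2', Prod.snd_mul]; ring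
  add_mem' := by
    rintro z z' ⟨G, H, h0, h1, h2⟩ ⟨G', H', h0', h1', h2'⟩
    refine ⟨G * H' + G' * H, H * H', ?_, ?_, ?_⟩
    · rw [map_mul]; exact mul_ne_zero h0 h0'
    · rw [map_mul, map_add, map_mul, map_mul, ← h1, ← h1', Prod.fst_add]; ring
    · rw [map_mul, map_add, map_mul, map_mul, ← h2, ← h2', Prod.snd_add]; ring
  neg_mem' := by
    rintro z ⟨G, H, h0, h1, h2⟩
    refine ⟨-G, H, h0, ?_, ?_⟩
    · rw [map_neg, ← h1, Prod.fst_neg]; ring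
    · rw [map_neg, ← h2, Prod.snd_neg]; ring

lemma mk_mem_locGraph (G : P) : (ψ G, ρ G) ∈ locGraph ψ ρ := ⟨G, 1, by simp⟩

/-- The canonical map to a localization. -/
def toLoc : P →+* locGraph ψ ρ := (ψ.prod ρ).codRestrict _ (mk_mem_locGraph ψ ρ)

@[simp] lemma coe_toLoc (G : P) : (toLoc ψ ρ G : K × F) = (ψ G, ρ G) := rfl

variable {ψ ρ}

lemma isResGraph_locGraph (h0 : ∀ H, ψ H = 0 → ρ H = 0) : IsResGraph (locGraph ψ ρ) where
  single := by
    rintro b ⟨G, H, hH, h1, h2⟩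
    have : ρ G = 0 := h0 G (by simpa using h1.symm)
    rw [this] at h2
    exact (mul_eq_zero.1 h2).resolve_right hH
  inv := by
    rintro a b ⟨G, H, hH, h1, h2⟩ hb
    simp only at h1 h2
    have hG : ρ G ≠ 0 := by rw [← h2]; exact mul_ne_zero hb hH
    have hG' : ψ G ≠ 0 := fun h => hG (h0 _ h)
    refine ⟨H, G, hG, ?_, ?_⟩
    · have : a ≠ 0 := by rintro rfl; exact hG' (by simpa using h1.symm)
      simp only; rw [← h1]; field_simp
    · simp only; rw [← h2]; field_simp

lemma exists_mul_toLoc (h0 : ∀ H, ψ H = 0 → ρ H = 0) (z : locGraph ψ ρ) :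
    ∃ G H, IsUnit (toLoc ψ ρ H) ∧ z * toLoc ψ ρ H = toLoc ψ ρ G := by
  obtain ⟨G, H, hH, h1, h2⟩ := z.2
  refine ⟨G, H, ((isResGraph_locGraph h0).isUnit_iff _).2 hH, Subtype.ext (Prod.ext ?_ ?_)⟩
  · exact h1
  · exact h2

lemma isNoetherianRing_locGraph [IsNoetherianRing P] (h0 : ∀ H, ψ H = 0 → ρ H = 0) :
    IsNoetherianRing (locGraph ψ ρ) :=
  isNoetherianRing_of_fractions (toLoc ψ ρ) (exists_mul_toLoc h0)

lemma not_isUnit_locGraph_iff (h0 : ∀ H, ψ H = 0 → ρ H = 0) {a b : P} (ha : ρ a = 0)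
    (hb : ρ b = 0) (hab : ∀ G, ρ G = 0 → ∃ c d, ψ G = ψ (c * a + d * b)) (z : locGraph ψ ρ) :
    ¬ IsUnit z ↔ z ∈ Ideal.span {toLoc ψ ρ a, toLoc ψ ρ b} := by
  have hg := isResGraph_locGraph h0
  constructor
  · intro hz
    rw [hg.isUnit_iff, not_not] at hz
    obtain ⟨G, H, hH, hz'⟩ := exists_mul_toLoc h0 z
    have hG : ρ G = 0 := by
      have := congrArg (fun z => z.1.2) hz'
      simpa [hz] using this.symm
    obtain ⟨c, d, hcd⟩ := hab G hG
    rw [← Ideal.mul_unit_mem_iff_mem _ hH, hz']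
    have : toLoc ψ ρ G = toLoc ψ ρ c * toLoc ψ ρ a + toLoc ψ ρ d * toLoc ψ ρ b := by
      rw [← map_mul, ← map_mul, ← map_add]
      exact hg.ext_fst hcd
    rw [this]
    exact Ideal.add_mem _ (Ideal.mul_mem_left _ _ (Ideal.subset_span (by simp)))
      (Ideal.mul_mem_left _ _ (Ideal.subset_span (by simp)))
  · intro hz
    rw [hg.isUnit_iff, not_not]
    obtain ⟨c, d, rfl⟩ := Ideal.mem_span_pair.1 hz
    simp [ha, hb]

lemma isReg2_locGraph [IsNoetherianRing P] (h0 : ∀ H, ψ H = 0 → ρ H = 0) {a b : P} (ha : ρ a = 0)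
    (hb : ρ b = 0) (hab : ∀ G, ρ G = 0 → ∃ c d, ψ G = ψ (c * a + d * b)) (ha0 : ψ a ≠ 0)
    (q : Ideal P) (hq : q.IsPrime) (hqρ : ∀ G ∈ q, ρ G = 0) (hqψ : ∀ G, ψ G = 0 → G ∈ q)
    (haq : a ∈ q) (hqa : ∀ G ∈ q, ∃ c, ψ G = ψ (a * c)) (hbq : b ∉ q) :
    IsReg2 (locGraph ψ ρ) (toLoc ψ ρ a) (toLoc ψ ρ b) := by
  have hg := isResGraph_locGraph h0
  have key : ∀ (z : locGraph ψ ρ) (G H : P), IsUnit (toLoc ψ ρ H) →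
      z * toLoc ψ ρ H = toLoc ψ ρ G → (toLoc ψ ρ a ∣ z ↔ G ∈ q) := by
    intro z G H hH hz
    rw [← hH.dvd_mul_right, hz]
    constructor
    · rintro ⟨z', hz'⟩
      obtain ⟨G', H', hH', hz''⟩ := exists_mul_toLoc h0 z'
      have h1 : ψ (G * H' - a * G') = 0 := by
        have : toLoc ψ ρ (G * H' - a * G') = 0 := by
          rw [map_sub, map_mul, map_mul, hz', ← hz'']; ring
        exact congrArg (fun z => z.1.1) this
      have h2 := q.add_mem (hqψ _ h1) (q.mul_mem_right G' haq)
      rw [sub_add_cancel] at h2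
      exact (hq.mem_or_mem h2).resolve_right fun h => ((hg.isUnit_iff _).1 hH') (hqρ _ h)
    · intro hG
      obtain ⟨c, hc⟩ := hqa G hG
      exact ⟨toLoc ψ ρ c, by rw [← map_mul]; exact hg.ext_fst hc⟩
  refine ⟨isNoetherianRing_locGraph h0, hg.isLocalRing, not_isUnit_locGraph_iff h0 ha hb hab,
    ⟨?_, ?_, ?_⟩, ?_⟩
  · intro h
    exact ha0 (congrArg (fun z => z.1.1) h)
  · rw [hg.isUnit_iff, not_not]; exact ha
  · intro z z' hzz
    obtain ⟨G, H, hH, hz⟩ := exists_mul_toLoc h0 z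
    obtain ⟨G', H', hH', hz'⟩ := exists_mul_toLoc h0 z'
    rw [key z G H hH hz, key z' G' H' hH' hz']
    refine hq.mem_or_mem ((key (z * z') _ (H * H') ?_ ?_).1 hzz)
    · rw [map_mul]; exact hH.mul hH'
    · rw [map_mul, map_mul, ← hz, ← hz']; ring
  · rw [key _ b 1 (by simp) (by simp)]; exact hbq

end Loc

end Graph

section Stage

open Polynomial

variable {K F : Type*} [Field K] [Field F]

open IsResGraph

/-- `Γ` is the graph of the residue map of a two-dimensional regular local ring with regular
parameters `u, w`. -/
structure IsStage (Γ : Subring (K × F)) (u w : K) : Prop where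
  graph : IsResGraph Γ
  u_mem : (u, (0 : F)) ∈ Γ
  w_mem : (w, (0 : F)) ∈ Γ
  reg : IsReg2 Γ ⟨(u, 0), u_mem⟩ ⟨(w, 0), w_mem⟩

/-- Evaluation at `s` of polynomials over a graph, in the first projection. -/
def evFst (Γ : Subring (K × F)) {L : Type*} [Field L] [Algebra K L] (s : L) : Γ[X] →+* L :=
  eval₂RingHom ((algebraMap K L).comp (fstHom Γ)) s

/-- Evaluation at `l` of polynomials over a graph, in the second projection. -/
def evSnd (Γ : Subring (K × F)) (l : F) : Γ[X] →+* F := eval₂RingHom (sndHom Γ) l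

section

variable {Γ : Subring (K × F)} {L : Type*} [Field L] [Algebra K L] (s : L) (l : F)

@[simp] lemma evFst_C (z : Γ) : evFst Γ s (C z) = algebraMap K L z.1.1 := by simp [evFst]
@[simp] lemma evFst_X : evFst Γ s X = s := by simp [evFst]
@[simp] lemma evSnd_C (z : Γ) : evSnd Γ l (C z) = z.1.2 := by simp [evSnd]
@[simp] lemma evSnd_X : evSnd Γ l X = l := by simp [evSnd]

lemma IsResGraph.evSnd_eq (h : IsResGraph Γ) (G : Γ[X]) :
    evSnd Γ l G = aeval l (G.map h.res) := by
  rw [aeval_def, eval₂_map]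
  rfl

lemma IsResGraph.exists_eq_mul_add (h : IsResGraph Γ) {Fp : Γ[X]} (hF : Fp.Monic)
    (hirr : Irreducible (Fp.map h.res)) (hl : evSnd Γ l Fp = 0) (G : Γ[X])
    (hG : evSnd Γ l G = 0) : ∃ Q r, G = Fp * Q + r ∧ r.map h.res = 0 := by
  refine ⟨G /ₘ Fp, G %ₘ Fp, ?_, ?_⟩
  · rw [add_comm]; exact (modByMonic_add_div G Fp).symm
  · have h1 : aeval l ((G %ₘ Fp).map h.res) = 0 := by
      rw [← h.evSnd_eq]
      have := congrArg (evSnd Γ l) (modByMonic_add_div G Fp)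
      simpa [hl, hG] using this
    have h2 : Fp.map h.res ∣ (G %ₘ Fp).map h.res := by
      rw [← minpoly.dvd_iff] at h1
      rw [h.evSnd_eq, ← minpoly.dvd_iff] at hl
      have hmin : ¬ IsUnit (minpoly h.kap l) := minpoly.not_isUnit _ _
      exact ((hirr.dvd_iff.1 hl).resolve_left hmin).dvd.trans h1
    rw [map_modByMonic _ hF] at h2 ⊢
    by_contra hne
    exact absurd (degree_le_of_dvd h2 hne) (not_le.2 (degree_modByMonic_lt _ (hF.map _)))

end

namespace IsStage

variable {Γ : Subring (K × F)} {u w : K} (h : IsStage Γ u w)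

include h

lemma dvd_of_dvd_mul (z : Γ) (hz : (⟨(u, 0), h.u_mem⟩ : Γ) ∣ ⟨(w, 0), h.w_mem⟩ * z) :
    (⟨(u, 0), h.u_mem⟩ : Γ) ∣ z :=
  (h.reg.prime.dvd_or_dvd hz).resolve_left h.reg.not_dvd

lemma u_ne_zero : u ≠ 0 := by
  rintro rfl
  exact h.reg.prime.ne_zero rfl

lemma w_ne_zero : w ≠ 0 := by
  rintro rfl
  exact h.reg.not_dvd (dvd_zero _)

lemma mem_span_iff (z : Γ) :
    z ∈ Ideal.span {(⟨(u, 0), h.u_mem⟩ : Γ), ⟨(w, 0), h.w_mem⟩} ↔ z.1.2 = 0 := by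
  rw [← h.reg.mem_iff, h.graph.isUnit_iff, not_not]

lemma fst_binaryForm (G : Γ[X]) (n : ℕ) (hn : G.natDegree ≤ n) :
    (binaryForm (⟨(u, 0), h.u_mem⟩ : Γ) ⟨(w, 0), h.w_mem⟩ n G.coeff).1.1 =
      w ^ n * evFst Γ (u / w) G := by
  have hw := h.w_ne_zero
  have h1 := map_binaryForm (fstHom Γ) (⟨(u, 0), h.u_mem⟩ : Γ) ⟨(w, 0), h.w_mem⟩ n G.coeff
  refine h1.trans ?_
  rw [evFst, coe_eval₂RingHom, eval₂_eq_sum_range' _ (Nat.lt_succ_of_le hn), binaryForm,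
    Finset.mul_sum]
  refine Finset.sum_congr rfl fun i hi => ?_
  have hi : i ≤ n := by simpa [Nat.lt_succ_iff] using hi
  have : w ^ n = w ^ i * w ^ (n - i) := by rw [← pow_add]; congr 1; omega
  simp [div_pow, this]
  field_simp

lemma map_res_eq_zero_of_evFst (G : Γ[X]) (hG : evFst Γ (u / w) G = 0) :
    G.map h.graph.res = 0 := by
  have := h.graph.isDomain
  have h1 := h.fst_binaryForm G _ le_rfl
  rw [hG, mul_zero] at h1
  have h2 : binaryForm (⟨(u, 0), h.u_mem⟩ : Γ) ⟨(w, 0), h.w_mem⟩ G.natDegree G.coeff = 0 :=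
    h.graph.ext_fst h1
  have h3 := coeff_mem_of_binaryForm_eq_zero h.reg.prime.ne_zero h.dvd_of_dvd_mul _ _ h2
  ext i
  rw [coeff_map, coeff_zero]
  congr 1
  by_cases hi : i ≤ G.natDegree
  · rw [h.graph.res_eq_zero_iff, ← h.mem_span_iff]; exact h3 i hi
  · rw [coeff_eq_zero_of_natDegree_lt (by omega), map_zero]

lemma exists_eq_of_map_res_eq_zero (G : Γ[X]) (hG : G.map h.graph.res = 0) :
    ∃ a b, G = a * C ⟨(u, 0), h.u_mem⟩ + b * C ⟨(w, 0), h.w_mem⟩ := by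
  have h1 : G ∈ Ideal.map C (Ideal.span {(⟨(u, 0), h.u_mem⟩ : Γ), ⟨(w, 0), h.w_mem⟩}) := by
    rw [Ideal.mem_map_C_iff]
    intro i
    rw [h.mem_span_iff, ← h.graph.res_eq_zero_iff, ← coeff_map, hG, coeff_zero]
  rw [Ideal.map_span, Set.image_pair, Ideal.mem_span_pair] at h1
  obtain ⟨a, b, hab⟩ := h1
  exact ⟨a, b, hab.symm⟩

lemma evFst_eq_of_map_res_eq_zero (G : Γ[X]) (hG : G.map h.graph.res = 0) :
    ∃ c, evFst Γ (u / w) G = evFst Γ (u / w) (C ⟨(w, 0), h.w_mem⟩ * c) := by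
  obtain ⟨a, b, rfl⟩ := h.exists_eq_of_map_res_eq_zero G hG
  refine ⟨a * X + b, ?_⟩
  have hw := h.w_ne_zero
  simp
  field_simp

lemma evSnd_eq_zero (l : F) (G : Γ[X]) (hG : evFst Γ (u / w) G = 0) : evSnd Γ l G = 0 := by
  rw [h.graph.evSnd_eq, h.map_res_eq_zero_of_evFst G hG, map_zero]

lemma step {l : F} {Fp : Γ[X]} (hF : Fp.Monic) (hirr : Irreducible (Fp.map h.graph.res))
    (hl : evSnd Γ l Fp = 0) :
    IsStage (locGraph (evFst Γ (u / w)) (evSnd Γ l)) w (evFst Γ (u / w) Fp) := by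
  have := h.reg.noeth
  have h0 : ∀ G, evFst Γ (u / w) G = 0 → evSnd Γ l G = 0 := h.evSnd_eq_zero l
  have hmem1 : (w, (0 : F)) ∈ locGraph (evFst Γ (u / w)) (evSnd Γ l) := by
    simpa using mk_mem_locGraph (evFst Γ (u / w)) (evSnd Γ l) (C ⟨(w, 0), h.w_mem⟩)
  have hmem2 : (evFst Γ (u / w) Fp, (0 : F)) ∈ locGraph (evFst Γ (u / w)) (evSnd Γ l) := by
    simpa [hl] using mk_mem_locGraph (evFst Γ (u / w)) (evSnd Γ l) Fp
  have hg := isResGraph_locGraph h0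
  refine ⟨hg, hmem1, hmem2, ?_⟩
  have key := isReg2_locGraph h0 (a := C ⟨(w, 0), h.w_mem⟩) (b := Fp) (by simp) hl ?_ ?_
    (RingHom.ker (mapRingHom h.graph.res)) (RingHom.ker_isPrime _) ?_ ?_ ?_ ?_ ?_
  · convert key using 1
    · exact hg.ext_fst (by simp)
    · exact hg.ext_fst (by simp)
  · intro G hG
    obtain ⟨Q, r, rfl, hr⟩ := h.graph.exists_eq_mul_add l hF hirr hl G hG
    obtain ⟨c, hc⟩ := h.evFst_eq_of_map_res_eq_zero r hr
    refine ⟨c, Q, ?_⟩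
    rw [map_add, hc, ← map_add]
    congr 1
    ring
  · simpa using h.w_ne_zero
  · intro G hG
    rw [h.graph.evSnd_eq, show G.map h.graph.res = 0 from hG, map_zero]
  · exact h.map_res_eq_zero_of_evFst
  · rw [RingHom.mem_ker, coe_mapRingHom, map_C]
    have : h.graph.res ⟨(w, 0), h.w_mem⟩ = 0 := by rw [h.graph.res_eq_zero_iff]
    rw [this, C_0]
  · exact h.evFst_eq_of_map_res_eq_zero
  · exact hirr.ne_zero

end IsStage

end Stage

/-- Every nonzero element of a two-dimensional regular local domain is a form in the parameters
with some unit coefficient. -/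
lemma IsReg2.exists_binaryForm {R : Type*} [CommRing R] [IsDomain R] {u w : R} (h : IsReg2 R u w)
    {z : R} (hz : z ≠ 0) :
    ∃ (n : ℕ) (c : ℕ → R), (∃ i, i ≤ n ∧ IsUnit (c i)) ∧ z = binaryForm u w n c := by
  classical
  have := h.noeth
  have := h.isLocal
  have hmax := h.maximalIdeal_eq
  have hne : Ideal.span {u, w} ≠ ⊤ := by
    rw [← hmax]; exact (IsLocalRing.maximalIdeal.isMaximal R).ne_top
  have hkr := Ideal.iInf_pow_eq_bot_of_isDomain _ hne
  have hex : ∃ n, z ∉ Ideal.span {u, w} ^ n := by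
    by_contra hcon
    push Not at hcon
    apply hz
    rw [← Ideal.mem_bot, ← hkr, Ideal.mem_iInf]
    exact hcon
  obtain ⟨n, hn⟩ : ∃ r, r + 1 = Nat.find hex := by
    refine ⟨Nat.find hex - 1, Nat.sub_add_cancel ?_⟩
    by_contra h0
    have h0 : Nat.find hex = 0 := by omega
    exact (Nat.find_eq_zero hex).1 h0 (by simp)
  have h1 := Nat.find_min hex (m := n) (by omega)
  have h2 := Nat.find_spec hex
  rw [← hn] at h2
  rw [not_not] at h1
  obtain ⟨c, -, hc⟩ := mem_mul_span_pair_pow u w ⊤ n z (by simpa using h1)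
  refine ⟨n, c, ?_, hc⟩
  by_contra hcon
  push Not at hcon
  apply h2
  rw [pow_succ', hc]
  exact binaryForm_mem _ _ _ _ _ fun i hi => (h.mem_iff _).1 (hcon i hi)

section Order

open Polynomial IsResGraph

variable {K F : Type*} [Field K] [Field F]

namespace IsStage

variable {Γ : Subring (K × F)} {u w : K} (h : IsStage Γ u w)

/-- `f` is a form of degree `n` in the parameters of a stage, with some unit coefficient. -/
def HasOrd (_ : IsStage Γ u w) (n : ℕ) (f : K) : Prop :=
  ∃ G : Γ[X], G.natDegree ≤ n ∧ (∃ i, (G.coeff i).1.2 ≠ 0) ∧ f = w ^ n * evFst Γ (u / w) G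

lemma exists_hasOrd {z : Γ} (hz : z ≠ 0) : ∃ n, h.HasOrd n z.1.1 := by
  have := h.graph.isDomain
  obtain ⟨n, c, ⟨i, hi, hci⟩, rfl⟩ := h.reg.exists_binaryForm hz
  have hcoeff : ∀ j, j ≤ n → (∑ i ∈ Finset.range (n + 1), monomial i (c i)).coeff j = c j := by
    intro j hj
    rw [finsetSum_coeff, Finset.sum_eq_single j]
    · simp
    · intro b _ hb; rw [coeff_monomial, if_neg hb]
    · intro hj'; exact absurd (Finset.mem_range.2 (Nat.lt_succ_of_le hj)) hj'
  have hdeg : (∑ i ∈ Finset.range (n + 1), monomial i (c i)).natDegree ≤ n := by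
    refine natDegree_sum_le_of_forall_le _ _ fun i hi => (natDegree_monomial_le _).trans ?_
    simpa [Nat.lt_succ_iff] using hi
  refine ⟨n, ∑ i ∈ Finset.range (n + 1), monomial i (c i), hdeg, ⟨i, ?_⟩, ?_⟩
  · rw [hcoeff i hi, ← h.graph.isUnit_iff]; exact hci
  · rw [← h.fst_binaryForm _ n hdeg]
    congr 2
    refine Finset.sum_congr rfl fun i hi => ?_
    rw [hcoeff i (by simpa [Nat.lt_succ_iff] using hi)]

lemma exists_of_hasOrd_zero {f : K} (hf : h.HasOrd 0 f) : ∃ b, b ≠ 0 ∧ (f, b) ∈ Γ := by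
  obtain ⟨G, hG, ⟨i, hi⟩, rfl⟩ := hf
  have hG0 : G = C (G.coeff 0) := eq_C_of_natDegree_le_zero hG
  have hi0 : i = 0 := by
    by_contra hne
    apply hi
    rw [coeff_eq_zero_of_natDegree_lt (by omega)]
    rfl
  subst hi0
  refine ⟨_, hi, ?_⟩
  rw [hG0]
  simp

lemma mul_natDegree_le {l : F} {Fp : Γ[X]} (hF : Fp.Monic)
    (hirr : Irreducible (Fp.map h.graph.res)) (hl : evSnd Γ l Fp = 0) {G : Γ[X]} {n k : ℕ}
    (hGn : G.natDegree ≤ n) (hG : ∃ i, (G.coeff i).1.2 ≠ 0)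
    (hk : (h.step hF hirr hl).HasOrd k (evFst Γ (u / w) G)) : k * Fp.natDegree ≤ n := by
  classical
  set h' := h.step hF hirr hl with hh'
  obtain ⟨G', hG'k, -, hG'⟩ := hk
  set φ := mapRingHom h.graph.res with hφ
  have key : ∃ G1 H : Γ[X], evSnd Γ l H ≠ 0 ∧ φ Fp ^ k ∣ φ G1 ∧
      evFst Γ (u / w) G * evFst Γ (u / w) H = evFst Γ (u / w) G1 := by
    rw [hG', ← h'.fst_binaryForm _ _ hG'k]
    refine Finset.sum_induction _ (fun z : locGraph (evFst Γ (u / w)) (evSnd Γ l) =>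
      ∃ G1 H : Γ[X], evSnd Γ l H ≠ 0 ∧ φ Fp ^ k ∣ φ G1 ∧
      z.1.1 * evFst Γ (u / w) H = evFst Γ (u / w) G1) ?_ ?_ ?_
    · rintro a b ⟨G1, H1, h1, h2, h3⟩ ⟨G2, H2, h4, h5, h6⟩
      refine ⟨G1 * H2 + G2 * H1, H1 * H2, by simp [h1, h4], ?_, ?_⟩
      · rw [map_add, map_mul, map_mul]
        exact dvd_add (h2.mul_right _) (h5.mul_right _)
      · simp only [map_add, map_mul, ← h3, ← h6]
        have : ((a + b).1).1 = a.1.1 + b.1.1 := rfl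
        rw [this]
        ring
    · exact ⟨0, 1, by simp⟩
    · intro i hi
      obtain ⟨G1, H, hH, h1, -⟩ := (G'.coeff i).2
      refine ⟨G1 * C ⟨(w, 0), h.w_mem⟩ ^ i * Fp ^ (k - i), H, hH, ?_, ?_⟩
      · rcases Nat.eq_zero_or_pos i with rfl | hi
        · simp
        · have : φ (C ⟨(w, 0), h.w_mem⟩) = 0 := by
            rw [hφ, coe_mapRingHom, map_C]
            have : h.graph.res ⟨(w, 0), h.w_mem⟩ = 0 := by rw [h.graph.res_eq_zero_iff]
            rw [this, C_0]
          rw [map_mul, map_mul, map_pow, this, zero_pow hi.ne']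
          simp
      · simp only [map_mul, map_pow, ← h1, evFst_C]
        simp
        ring
  obtain ⟨G1, H, hH, hdvd, heq⟩ := key
  have h1 : φ (G * H - G1) = 0 := h.map_res_eq_zero_of_evFst _ (by
    rw [map_sub, map_mul, heq, sub_self])
  rw [map_sub, map_mul, sub_eq_zero] at h1
  rw [← h1] at hdvd
  have hHd : ¬ φ Fp ∣ φ H := by
    rintro ⟨q, hq⟩
    apply hH
    rw [h.graph.evSnd_eq, show H.map h.graph.res = φ H from rfl, hq, map_mul]
    rw [h.graph.evSnd_eq] at hl
    rw [show φ Fp = Fp.map h.graph.res from rfl, hl, zero_mul]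
  have h2 := (hirr.prime).pow_dvd_of_dvd_mul_right k hHd hdvd
  have hne : φ G ≠ 0 := by
    obtain ⟨i, hi⟩ := hG
    intro h0
    apply hi
    rw [← h.graph.res_eq_zero_iff, ← coeff_map, show G.map h.graph.res = φ G from rfl, h0,
      coeff_zero]
  have h3 := natDegree_le_of_dvd h2 hne
  rw [natDegree_pow, hF.natDegree_map] at h3
  exact h3.trans (natDegree_map_le.trans hGn)

end IsStage

end Order

section

open Polynomial IsResGraph

/-- The data from which an infinite sequence of two-dimensional regular local rings is built. -/
structure Tower (K F : Type*) [Field K] [Field F] where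
  cK : K
  cF : F
  p : ℕ → ℕ
  lam : ℕ → F
  E : ℕ → Subfield F
  base : Subring (K × F)
  x : K
  y : K
  c_mem : (cK, cF) ∈ base
  p_prime : ∀ m, (p m).Prime
  lam_pow : ∀ m, lam m ^ p m = cF
  E_le : ∀ m, E m ≤ E (m + 1)
  lam_mem : ∀ m, lam m ∈ E (m + 1)
  not_pow : ∀ m, ∀ b ∈ E m, b ^ p m ≠ cF
  snd_mem : ∀ z ∈ base, z.2 ∈ E 0
  stage_base : IsStage base x y
  frac : ∀ f : K, ∃ a b : base, b.1.1 ≠ 0 ∧ f * b.1.1 = a.1.1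

namespace Tower

variable {K F : Type*} [Field K] [Field F] (T : Tower K F)

/-- The sequence of parameters. -/
def z : ℕ → K
  | 0 => T.x
  | 1 => T.y
  | n + 2 => if Even n then z n / z (n + 1) else (z n / z (n + 1)) ^ T.p (n / 2) - T.cK

/-- The residue of `z n / z (n + 1)`. -/
def r (n : ℕ) : F := if Even n then 0 else T.lam (n / 2)

/-- The graph of the residue map of the `n`-th ring. -/
def G : ℕ → Subring (K × F)
  | 0 => T.base
  | n + 1 => locGraph (evFst (G n) (T.z n / T.z (n + 1))) (evSnd (G n) (T.r n))

lemma G_succ (n : ℕ) : T.G (n + 1) =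
    locGraph (evFst (T.G n) (T.z n / T.z (n + 1))) (evSnd (T.G n) (T.r n)) := rfl

lemma z_even {n : ℕ} (h : Even n) : T.z (n + 2) = T.z n / T.z (n + 1) := by
  rw [z, if_pos h]

lemma z_odd {n : ℕ} (h : ¬ Even n) :
    T.z (n + 2) = (T.z n / T.z (n + 1)) ^ T.p (n / 2) - T.cK := by
  rw [z, if_neg h]

lemma G_le_succ (n : ℕ) : T.G n ≤ T.G (n + 1) := by
  intro z hz
  simpa [G_succ] using
    mk_mem_locGraph (evFst (T.G n) (T.z n / T.z (n + 1))) (evSnd (T.G n) (T.r n)) (C ⟨z, hz⟩)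

lemma G_mono : Monotone T.G := monotone_nat_of_le_succ T.G_le_succ

lemma E_mono : Monotone T.E := monotone_nat_of_le_succ T.E_le

lemma c_mem_G (n : ℕ) : (T.cK, T.cF) ∈ T.G n := T.G_mono (Nat.zero_le n) T.c_mem

lemma quot_mem (n : ℕ) : (T.z n / T.z (n + 1), T.r n) ∈ T.G (n + 1) := by
  simpa [G_succ] using
    mk_mem_locGraph (evFst (T.G n) (T.z n / T.z (n + 1))) (evSnd (T.G n) (T.r n)) X

lemma lam_ne_zero (m : ℕ) : T.lam m ≠ 0 := by
  intro h
  have := T.lam_pow m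
  rw [h, zero_pow (T.p_prime m).ne_zero] at this
  exact T.not_pow m 0 (zero_mem _) (by rw [zero_pow (T.p_prime m).ne_zero, this])

lemma lam_notMem (m : ℕ) : T.lam m ∉ T.E m := fun h => T.not_pow m _ h (T.lam_pow m)

/-- The polynomial whose value at `z n / z (n + 1)` is the next parameter. -/
def poly (n : ℕ) : (T.G n)[X] :=
  if Even n then X else X ^ T.p (n / 2) - C ⟨(T.cK, T.cF), T.c_mem_G n⟩

lemma poly_monic (n : ℕ) : (T.poly n).Monic := by
  unfold poly
  split_ifs
  · exact monic_X
  · exact monic_X_pow_sub_C _ (T.p_prime _).ne_zero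

lemma evSnd_poly (n : ℕ) : evSnd (T.G n) (T.r n) (T.poly n) = 0 := by
  unfold poly r
  split_ifs
  · simp
  · simp [T.lam_pow]

lemma evFst_poly (n : ℕ) : evFst (T.G n) (T.z n / T.z (n + 1)) (T.poly n) = T.z (n + 2) := by
  unfold poly
  split_ifs with h
  · simp [T.z_even h]
  · simp [T.z_odd h]

lemma irreducible_X_pow_sub_C {n m : ℕ} (h : IsResGraph (T.G n)) (hE : ∀ z ∈ T.G n, z.2 ∈ T.E m) :
    Irreducible ((X ^ T.p m - C ⟨(T.cK, T.cF), T.c_mem_G n⟩ : (T.G n)[X]).map h.res) := by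
  rw [Polynomial.map_sub, Polynomial.map_pow, map_X, map_C,
    X_pow_sub_C_irreducible_iff_of_prime (T.p_prime m)]
  intro b hb
  obtain ⟨z, rfl⟩ := h.res_surjective b
  exact T.not_pow m _ (hE z.1 z.2) (congrArg Subtype.val hb)

lemma snd_mem_G (n : ℕ) : ∀ z ∈ T.G n, z.2 ∈ T.E (n / 2) := by
  induction n with
  | zero => exact T.snd_mem
  | succ n ih =>
    have hr : T.r n ∈ T.E ((n + 1) / 2) := by
      unfold r
      split_ifs with h
      · exact zero_mem _
      · rw [Nat.not_even_iff] at h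
        have := T.lam_mem (n / 2)
        rwa [show n / 2 + 1 = (n + 1) / 2 by omega] at this
    have hev : ∀ P : (T.G n)[X], evSnd (T.G n) (T.r n) P ∈ T.E ((n + 1) / 2) := by
      intro P
      rw [evSnd, coe_eval₂RingHom, eval₂_eq_sum, Polynomial.sum]
      refine sum_mem fun i _ => mul_mem ?_ (pow_mem hr _)
      exact T.E_mono (by omega) (ih _ (P.coeff i).2)
    rintro ⟨a, b⟩ ⟨P, Q, hQ, -, h2⟩
    have : b = evSnd (T.G n) (T.r n) P / evSnd (T.G n) (T.r n) Q := by
      rw [← h2]; field_simp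
    rw [show ((a, b) : K × F).2 = b from rfl, this]
    exact div_mem (hev _) (hev _)

lemma poly_irreducible {n : ℕ} (h : IsResGraph (T.G n)) :
    Irreducible ((T.poly n).map h.res) := by
  unfold poly
  split_ifs
  · rw [map_X]; exact irreducible_X
  · exact T.irreducible_X_pow_sub_C h (T.snd_mem_G n)

lemma stage (n : ℕ) : IsStage (T.G n) (T.z n) (T.z (n + 1)) := by
  induction n with
  | zero => exact T.stage_base
  | succ n ih =>
    have := ih.step (T.poly_monic n) (T.poly_irreducible _) (T.evSnd_poly n)
    rwa [evFst_poly] at this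

lemma graph (n : ℕ) : IsResGraph (T.G n) := (T.stage n).graph

lemma z_ne_zero (n : ℕ) : T.z n ≠ 0 := (T.stage n).u_ne_zero

lemma z_mem (n : ℕ) : (T.z n, (0 : F)) ∈ T.G n := (T.stage n).u_mem

lemma z_succ_mem (n : ℕ) : (T.z (n + 1), (0 : F)) ∈ T.G n := (T.stage n).w_mem

/-- Units of the union of the rings. -/
def IsU (f : K) : Prop := ∃ n b, b ≠ 0 ∧ (f, b) ∈ T.G n

/-- Nonunits of the union of the rings. -/
def IsM (f : K) : Prop := ∃ n, (f, (0 : F)) ∈ T.G n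

variable {T}

lemma snd_eq {f : K} {b b' : F} {n n' : ℕ} (h : (f, b) ∈ T.G n) (h' : (f, b') ∈ T.G n') :
    b = b' :=
  (T.graph (max n n')).snd_unique (T.G_mono (le_max_left _ _) h) (T.G_mono (le_max_right _ _) h')

lemma IsU.ne_zero {f : K} (h : T.IsU f) : f ≠ 0 := by
  rintro rfl
  obtain ⟨n, b, hb, h⟩ := h
  exact hb ((T.graph n).single _ h)

lemma IsU.mul {f g : K} (hf : T.IsU f) (hg : T.IsU g) : T.IsU (f * g) := by
  obtain ⟨n, b, hb, h⟩ := hf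
  obtain ⟨n', b', hb', h'⟩ := hg
  exact ⟨max n n', b * b', mul_ne_zero hb hb',
    mul_mem (T.G_mono (le_max_left _ _) h) (T.G_mono (le_max_right _ _) h')⟩

lemma IsU.inv {f : K} (hf : T.IsU f) : T.IsU f⁻¹ := by
  obtain ⟨n, b, hb, h⟩ := hf
  exact ⟨n, b⁻¹, inv_ne_zero hb, (T.graph n).inv _ _ h hb⟩

lemma IsU.pow {f : K} (hf : T.IsU f) (n : ℕ) : T.IsU (f ^ n) := by
  obtain ⟨m, b, hb, h⟩ := hf
  exact ⟨m, b ^ n, pow_ne_zero _ hb, pow_mem h n⟩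

lemma IsU.zpow {f : K} (hf : T.IsU f) (n : ℤ) : T.IsU (f ^ n) := by
  obtain ⟨m, rfl | rfl⟩ := n.eq_nat_or_neg
  · rw [zpow_natCast]; exact hf.pow m
  · rw [zpow_neg, zpow_natCast]; exact (hf.pow m).inv

variable (T)

lemma isU_one : T.IsU 1 := ⟨0, 1, one_ne_zero, one_mem _⟩

variable {T}

lemma IsM.mul {f g : K} (hf : T.IsM f) (hg : T.IsU g) : T.IsM (f * g) := by
  obtain ⟨n, h⟩ := hf
  obtain ⟨n', b', hb', h'⟩ := hg
  refine ⟨max n n', ?_⟩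
  simpa using mul_mem (T.G_mono (le_max_left _ _) h) (T.G_mono (le_max_right _ _) h')

lemma IsM.not_isU {f : K} (hf : T.IsM f) (hg : T.IsU f) : False := by
  obtain ⟨n, h⟩ := hf
  obtain ⟨n', b', hb', h'⟩ := hg
  exact hb' (snd_eq h' h)

variable (T)

/-- `w m` is the odd-indexed parameter `z (2 m + 1)`. -/
lemma exists_z_odd_eq (m : ℕ) :
    ∃ e, T.IsU e ∧ T.z (2 * m + 1) = T.z (2 * m + 2) * e := by
  refine ⟨T.z (2 * m + 1) / T.z (2 * m + 2), ⟨2 * m + 2, T.lam m, T.lam_ne_zero m, ?_⟩, ?_⟩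
  · have := T.quot_mem (2 * m + 1)
    rwa [r, if_neg (by rw [Nat.not_even_iff]; omega), show (2 * m + 1) / 2 = m by omega] at this
  · rw [mul_div_cancel₀ _ (T.z_ne_zero _)]

lemma z_even_eq (m : ℕ) : T.z (2 * m) = T.z (2 * m + 1) * T.z (2 * m + 2) := by
  rw [T.z_even (even_two_mul m), mul_div_cancel₀ _ (T.z_ne_zero _)]

lemma exists_z_odd_eq_sq (m : ℕ) :
    ∃ e, T.IsU e ∧ T.z (2 * m + 1) = T.z (2 * (m + 1) + 1) ^ 2 * e := by
  obtain ⟨e, he, h1⟩ := T.exists_z_odd_eq m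
  obtain ⟨e', he', h2⟩ := T.exists_z_odd_eq (m + 1)
  have h3 := T.z_even_eq (m + 1)
  refine ⟨e * e'⁻¹, he.mul he'.inv, ?_⟩
  rw [h1, show 2 * m + 2 = 2 * (m + 1) by ring, h3, pow_two]
  nth_rw 3 [h2]
  field_simp [he'.ne_zero]

lemma exists_z_odd_eq_pow (m d : ℕ) :
    ∃ e, T.IsU e ∧ T.z (2 * m + 1) = T.z (2 * (m + d) + 1) ^ (2 ^ d) * e := by
  induction d with
  | zero => exact ⟨1, T.isU_one, by simp⟩
  | succ d ih =>
    obtain ⟨e, he, h1⟩ := ih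
    obtain ⟨e', he', h2⟩ := T.exists_z_odd_eq_sq (m + d)
    refine ⟨e' ^ 2 ^ d * e, (he'.pow _).mul he, ?_⟩
    rw [h1, h2, mul_pow, ← pow_mul, show m + (d + 1) = m + d + 1 by ring,
      show 2 * 2 ^ d = 2 ^ (d + 1) by ring]
    ring

/-- `f` has value `q`. -/
def HasVal (f : K) (q : ℚ) : Prop :=
  ∃ (m : ℕ) (a : ℤ) (e : K), T.IsU e ∧ f = T.z (2 * m + 1) ^ a * e ∧ q = a / 2 ^ m

variable {T}

lemma HasVal.ne_zero {f : K} {q : ℚ} (h : T.HasVal f q) : f ≠ 0 := by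
  obtain ⟨m, a, e, he, rfl, -⟩ := h
  exact mul_ne_zero (zpow_ne_zero _ (T.z_ne_zero _)) he.ne_zero

lemma HasVal.raise {f : K} {m : ℕ} {a : ℤ} {e : K} (he : T.IsU e)
    (hf : f = T.z (2 * m + 1) ^ a * e) (d : ℕ) :
    ∃ e', T.IsU e' ∧ f = T.z (2 * (m + d) + 1) ^ (2 ^ d * a) * e' := by
  obtain ⟨e', he', h⟩ := T.exists_z_odd_eq_pow m d
  refine ⟨e' ^ a * e, (he'.zpow a).mul he, ?_⟩
  rw [hf, h, mul_zpow, ← zpow_natCast, ← zpow_mul]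
  push_cast
  ring

lemma HasVal.mul {f g : K} {q q' : ℚ} (hf : T.HasVal f q) (hg : T.HasVal g q') :
    T.HasVal (f * g) (q + q') := by
  obtain ⟨m, a, e, he, h1, rfl⟩ := hf
  obtain ⟨n, b, e', he', h2, rfl⟩ := hg
  obtain ⟨e1, he1, h1⟩ := HasVal.raise he h1 n
  obtain ⟨e2, he2, h2⟩ := HasVal.raise he' h2 m
  refine ⟨m + n, 2 ^ n * a + 2 ^ m * b, e1 * e2, he1.mul he2, ?_, ?_⟩
  · rw [h1, h2, zpow_add₀ (T.z_ne_zero _), add_comm n m]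
    ring
  · push_cast
    field_simp
    ring

lemma HasVal.inv {f : K} {q : ℚ} (hf : T.HasVal f q) : T.HasVal f⁻¹ (-q) := by
  obtain ⟨m, a, e, he, rfl, rfl⟩ := hf
  refine ⟨m, -a, e⁻¹, he.inv, ?_, ?_⟩
  · rw [mul_inv, zpow_neg]
  · push_cast; ring

lemma IsU.hasVal {f : K} (hf : T.IsU f) : T.HasVal f 0 := ⟨0, 0, f, hf, by simp, by simp⟩

lemma HasVal.pow {f : K} {q : ℚ} (hf : T.HasVal f q) (n : ℕ) : T.HasVal (f ^ n) (n * q) := by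
  induction n with
  | zero => simpa using T.isU_one.hasVal
  | succ n ih =>
    rw [pow_succ]
    convert ih.mul hf using 1
    push_cast; ring

lemma HasVal.isM {f : K} {q : ℚ} (hf : T.HasVal f q) (hq : 0 < q) : T.IsM f := by
  obtain ⟨m, a, e, he, rfl, rfl⟩ := hf
  have ha : 0 < a := by
    by_contra hcon
    push Not at hcon
    have : (a : ℚ) ≤ 0 := by exact_mod_cast hcon
    exact absurd hq (not_lt.2 (div_nonpos_of_nonpos_of_nonneg this (by positivity)))
  obtain ⟨n, rfl⟩ := Int.eq_succ_of_zero_lt ha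
  refine IsM.mul ⟨2 * m + 1, ?_⟩ he
  have h1 := pow_mem (T.z_mem (2 * m + 1)) (n + 1)
  rw [Prod.pow_mk, zero_pow n.succ_ne_zero, ← zpow_natCast] at h1
  exact h1

lemma HasVal.isU {f : K} (hf : T.HasVal f 0) : T.IsU f := by
  obtain ⟨m, a, e, he, rfl, h0⟩ := hf
  have ha : a = 0 := by
    rw [eq_comm, div_eq_zero_iff] at h0
    rcases h0 with h0 | h0
    · exact_mod_cast h0
    · exact absurd h0 (by positivity)
  rw [ha]
  simpa using he

lemma IsM.pos_of_hasVal {f : K} {q : ℚ} (h : T.IsM f) (hf : T.HasVal f q) : 0 < q := by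
  rcases lt_trichotomy q 0 with hq | rfl | hq
  · exfalso
    obtain ⟨n, h1⟩ := h
    obtain ⟨n', h2⟩ := hf.inv.isM (by linarith)
    have h3 := mul_mem (T.G_mono (le_max_left n n') h1) (T.G_mono (le_max_right n n') h2)
    rw [Prod.mk_mul_mk, mul_inv_cancel₀ hf.ne_zero, zero_mul] at h3
    exact zero_ne_one (snd_eq h3 (one_mem (T.G 0)))
  · exact (h.not_isU hf.isU).elim
  · exact hq

lemma HasVal.unique {f : K} {q q' : ℚ} (h : T.HasVal f q) (h' : T.HasVal f q') : q = q' := by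
  have key : ∀ {q q' : ℚ}, T.HasVal f q → T.HasVal f q' → ¬ q < q' := by
    intro q q' h h' hlt
    have h1 := h'.mul h.inv
    rw [mul_inv_cancel₀ h.ne_zero] at h1
    exact (h1.isM (by linarith)).not_isU T.isU_one
  exact le_antisymm (not_lt.1 (key h' h)) (not_lt.1 (key h h'))

variable (T)

lemma hasVal_z_odd (m : ℕ) : T.HasVal (T.z (2 * m + 1)) (1 / 2 ^ m) :=
  ⟨m, 1, 1, T.isU_one, by simp, by simp⟩

lemma hasVal_z_even (m : ℕ) : T.HasVal (T.z (2 * m)) (2 / 2 ^ m) := by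
  rw [T.z_even_eq]
  obtain ⟨e, he, h⟩ := T.exists_z_odd_eq m
  have h1 : T.z (2 * m + 2) = T.z (2 * m + 1) * e⁻¹ := by
    rw [h]; field_simp [he.ne_zero]
  rw [h1]
  convert (T.hasVal_z_odd m).mul ((T.hasVal_z_odd m).mul he.inv.hasVal) using 1
  ring

lemma exists_hasVal_z (n : ℕ) : ∃ q, T.HasVal (T.z n) q := by
  obtain ⟨m, rfl | rfl⟩ := n.even_or_odd'
  · exact ⟨_, T.hasVal_z_even m⟩
  · exact ⟨_, T.hasVal_z_odd m⟩

lemma exists_hasVal_of_hasOrd (N : ℕ) : ∀ (n : ℕ) (f : K), (T.stage n).HasOrd N f →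
    ∃ q, T.HasVal f q := by
  have hstep : ∀ (N n : ℕ) (f : K), (T.stage n).HasOrd N f → f ≠ 0 ∧ ∃ k f1,
      (T.stage (n + 1)).HasOrd k f1 ∧ k * (T.poly n).natDegree ≤ N ∧ f = T.z (n + 1) ^ N * f1 := by
    rintro N n f ⟨P, hP, ⟨i, hi⟩, rfl⟩
    have hne : evFst (T.G n) (T.z n / T.z (n + 1)) P ≠ 0 := by
      intro h0
      apply hi
      rw [← (T.graph n).res_eq_zero_iff, ← coeff_map,
        (T.stage n).map_res_eq_zero_of_evFst P h0, coeff_zero]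
    have hmem := mk_mem_locGraph (evFst (T.G n) (T.z n / T.z (n + 1))) (evSnd (T.G n) (T.r n)) P
    obtain ⟨k, hk⟩ := (T.stage (n + 1)).exists_hasOrd (z := ⟨_, hmem⟩) (by
      intro h0
      exact hne (congrArg (fun z => z.1.1) h0))
    refine ⟨mul_ne_zero (pow_ne_zero _ (T.z_ne_zero _)) hne, k, _, hk, ?_, rfl⟩
    refine (T.stage n).mul_natDegree_le (T.poly_monic n) (T.poly_irreducible _) (T.evSnd_poly n)
      hP ⟨i, hi⟩ ?_
    obtain ⟨P', h1, h2, h3⟩ := hk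
    have he := T.evFst_poly n
    refine ⟨P', h1, h2, ?_⟩
    rw [he]
    exact h3
  induction N using Nat.strong_induction_on with
  | _ N ih =>
    have hodd : ∀ (n : ℕ) (f : K), ¬ Even n → (T.stage n).HasOrd N f → ∃ q, T.HasVal f q := by
      intro n f hn hf
      rcases Nat.eq_zero_or_pos N with rfl | hN
      · obtain ⟨b, hb, hmem⟩ := (T.stage n).exists_of_hasOrd_zero hf
        exact ⟨0, IsU.hasVal ⟨n, b, hb, hmem⟩⟩
      · obtain ⟨hf0, k, f1, hk, hle, rfl⟩ := hstep N n f hf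
        have hdeg : (T.poly n).natDegree = T.p (n / 2) := by
          rw [poly, if_neg hn, natDegree_X_pow_sub_C]
        rw [hdeg] at hle
        have h2 := (T.p_prime (n / 2)).two_le
        have hkN : k < N := by nlinarith
        obtain ⟨q, hq⟩ := ih k hkN _ _ hk
        obtain ⟨q', hq'⟩ := T.exists_hasVal_z (n + 1)
        exact ⟨_, (hq'.pow N).mul hq⟩
    intro n f hf
    by_cases hn : Even n
    · obtain ⟨hf0, k, f1, hk, hle, rfl⟩ := hstep N n f hf
      have hdeg : (T.poly n).natDegree = 1 := by rw [poly, if_pos hn, natDegree_X]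
      rw [hdeg, mul_one] at hle
      have hex : ∃ q, T.HasVal f1 q := by
        rcases hle.lt_or_eq with hlt | rfl
        · exact ih k hlt _ _ hk
        · exact hodd (n + 1) f1 (by rw [Nat.not_even_iff_odd]; exact hn.add_one) hk
      obtain ⟨q, hq⟩ := hex
      obtain ⟨q', hq'⟩ := T.exists_hasVal_z (n + 1)
      exact ⟨_, (hq'.pow N).mul hq⟩
    · exact hodd n f hn hf

lemma exists_hasVal {f : K} (hf : f ≠ 0) : ∃ q, T.HasVal f q := by
  obtain ⟨a, b, hb, hab⟩ := T.frac f
  have key : ∀ a : T.base, a.1.1 ≠ 0 → ∃ q, T.HasVal a.1.1 q := by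
    intro a ha
    obtain ⟨n, hn⟩ := T.stage_base.exists_hasOrd (z := a) (by rintro rfl; exact ha rfl)
    exact T.exists_hasVal_of_hasOrd n 0 _ hn
  obtain ⟨q, hq⟩ := key b hb
  obtain ⟨q', hq'⟩ := key a (by rw [← hab]; exact mul_ne_zero hf hb)
  refine ⟨q' + -q, ?_⟩
  convert hq'.mul hq.inv using 1
  rw [← hab]; field_simp

open Classical in
/-- The valuation of the union of the sequence of rings. -/
def val (f : K) : ℚ := if hf : f ≠ 0 then (T.exists_hasVal hf).choose else 0

lemma hasVal_val {f : K} (hf : f ≠ 0) : T.HasVal f (T.val f) := by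
  rw [val, dif_pos hf]
  exact (T.exists_hasVal hf).choose_spec

variable {T}

lemma HasVal.val_eq {f : K} {q : ℚ} (h : T.HasVal f q) : T.val f = q :=
  (T.hasVal_val h.ne_zero).unique h

variable (T)

lemma val_mul {f g : K} (hf : f ≠ 0) (hg : g ≠ 0) : T.val (f * g) = T.val f + T.val g :=
  ((T.hasVal_val hf).mul (T.hasVal_val hg)).val_eq

lemma val_pos_of_mem {f : K} {n : ℕ} (hf : f ≠ 0) (h : (f, (0 : F)) ∈ T.G n) : 0 < T.val f :=
  IsM.pos_of_hasVal ⟨n, h⟩ (T.hasVal_val hf)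

lemma val_eq_zero_of_mem {f : K} {b : F} {n : ℕ} (hb : b ≠ 0) (h : (f, b) ∈ T.G n) :
    T.val f = 0 :=
  (IsU.hasVal ⟨n, b, hb, h⟩).val_eq

lemma val_nonneg_of_mem {f : K} {b : F} {n : ℕ} (hf : f ≠ 0) (h : (f, b) ∈ T.G n) :
    0 ≤ T.val f := by
  by_cases hb : b = 0
  · subst hb; exact (T.val_pos_of_mem hf h).le
  · rw [T.val_eq_zero_of_mem hb h]

lemma exists_mem_of_val_nonneg {f : K} (hf : f ≠ 0) (h : 0 ≤ T.val f) : ∃ n b, (f, b) ∈ T.G n := by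
  rcases h.lt_or_eq with h | h
  · obtain ⟨n, hn⟩ := (T.hasVal_val hf).isM h
    exact ⟨n, 0, hn⟩
  · have h1 := T.hasVal_val hf
    rw [← h] at h1
    obtain ⟨n, b, -, hb⟩ := h1.isU
    exact ⟨n, b, hb⟩

lemma snd_eq_zero_iff {f : K} {b : F} {n : ℕ} (h : (f, b) ∈ T.G n) :
    b = 0 ↔ f = 0 ∨ 0 < T.val f := by
  constructor
  · rintro rfl
    by_cases hf : f = 0
    · exact Or.inl hf
    · exact Or.inr (T.val_pos_of_mem hf h)
  · rintro (rfl | hf)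
    · exact (T.graph n).single _ h
    · by_contra hb
      rw [T.val_eq_zero_of_mem hb h] at hf
      exact lt_irrefl _ hf

lemma val_inv {f : K} (hf : f ≠ 0) : T.val f⁻¹ = - T.val f := (T.hasVal_val hf).inv.val_eq

lemma val_add {f g : K} (hf : f ≠ 0) (hg : g ≠ 0) (hfg : f + g ≠ 0) :
    min (T.val f) (T.val g) ≤ T.val (f + g) := by
  have key : ∀ {f g : K}, f ≠ 0 → g ≠ 0 → f + g ≠ 0 → T.val f ≤ T.val g →
      T.val f ≤ T.val (f + g) := by
    intro f g hf hg hfg hle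
    have h1 : f + g = f * (1 + g * f⁻¹) := by field_simp
    have h2 : 1 + g * f⁻¹ ≠ 0 := by
      intro h; rw [h1, h, mul_zero] at hfg; exact hfg rfl
    obtain ⟨n, b, hb⟩ := T.exists_mem_of_val_nonneg (mul_ne_zero hg (inv_ne_zero hf)) (by
      rw [T.val_mul hg (inv_ne_zero hf), T.val_inv hf]; linarith)
    rw [h1, T.val_mul hf h2]
    have := T.val_nonneg_of_mem h2 (add_mem (one_mem (T.G n)) hb)
    linarith
  rcases le_total (T.val f) (T.val g) with h | h
  · rw [min_eq_left h]; exact key hf hg hfg h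
  · rw [min_eq_right h, add_comm]; exact key hg hf (by rwa [add_comm]) h

end Tower

end

section Dichotomy

variable {R S : Type*} [CommRing R] [IsDomain R] [CommRing S] [IsDomain S]

/-- If the images of the parameters of `R` are relatively prime in `S`, birationality forces
`R = S`. -/
lemma surjective_of_isRelPrime {u w : R} (hR : IsReg2 R u w) [UniqueFactorizationMonoid S]
    (i : R →+* S) (hloc : ∀ r, IsUnit (i r) → IsUnit r)
    (hi : Function.Injective i) (hbir : ∀ s : S, ∃ r r', r' ≠ 0 ∧ s * i r' = i r)
    (hrel : IsRelPrime (i u) (i w)) : Function.Surjective i := by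
  have := hR.ufm
  have := hR.noeth
  have := hR.isLocal
  intro s
  obtain ⟨g0, f0, hf0, h0⟩ := hbir s
  obtain ⟨f, g, c, hfg, rfl, rfl⟩ := UniqueFactorizationMonoid.exists_reduced_factors f0 hf0 g0
  have hc : c ≠ 0 := left_ne_zero_of_mul hf0
  have hf : f ≠ 0 := right_ne_zero_of_mul hf0
  have hs : s * i f = i g := by
    have : i c ≠ 0 := by rwa [map_ne_zero_iff i hi]
    apply mul_left_cancel₀ this
    rw [← map_mul, ← h0, map_mul]; ring
  by_cases hfu : IsUnit f
  · obtain ⟨f, rfl⟩ := hfu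
    refine ⟨g * ↑f⁻¹, ?_⟩
    rw [map_mul, ← hs, mul_assoc, ← map_mul]
    simp
  · exfalso
    obtain ⟨q, hq, hqf⟩ := WfDvdMonoid.exists_irreducible_factor hfu hf
    have hqp := hq.prime
    have hqg : ¬ q ∣ g := fun h => hq.not_isUnit (hfg hqf h)
    have hqu : ¬ IsUnit (i q) := fun h => hq.not_isUnit (hloc _ h)
    set J : Ideal R := (Ideal.span {i q}).comap i with hJ
    have hqJ : q ∈ J := by
      rw [hJ, Ideal.mem_comap]; exact Ideal.mem_span_singleton_self _
    have hgJ : g ∈ J := by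
      rw [hJ, Ideal.mem_comap, Ideal.mem_span_singleton, ← hs]
      exact (map_dvd i hqf).mul_left s
    have hrad : IsLocalRing.maximalIdeal R ≤ J.radical := by
      rw [Ideal.radical_eq_sInf]
      refine le_sInf ?_
      rintro p ⟨hJp, hp⟩
      by_cases hpm : p = IsLocalRing.maximalIdeal R
      · exact hpm.ge
      · exfalso
        obtain ⟨a, rfl⟩ := isPrincipal_of_isPrime_of_ne hR.maximalIdeal_eq p hpm
        have h1 := Ideal.mem_span_singleton.1 (hJp hqJ)
        have h2 := Ideal.mem_span_singleton.1 (hJp hgJ)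
        have hau : ¬ IsUnit a := by
          rw [← Ideal.span_singleton_eq_top]; exact hp.ne_top
        exact hqg (((hq.dvd_iff.1 h1).resolve_left hau).dvd.trans h2)
    have hmem : ∀ a ∈ ({u, w} : Set R), ∃ n, i q ∣ i a ^ n := by
      intro a ha
      have ham : a ∈ IsLocalRing.maximalIdeal R := by
        rw [hR.maximalIdeal_eq]; exact Ideal.subset_span ha
      obtain ⟨n, hn⟩ := hrad ham
      rw [hJ, Ideal.mem_comap, Ideal.mem_span_singleton, map_pow] at hn
      exact ⟨n, hn⟩
    obtain ⟨n, hn⟩ := hmem u (by simp)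
    obtain ⟨m, hm⟩ := hmem w (by simp)
    exact hqu (hrel.pow hn hm)

/-- A two-dimensional local domain birationally dominating a two-dimensional regular local ring
properly contains the quotient of the parameters in some order. -/
lemma surjective_or_dvd_or_dvd {u w : R} (hR : IsReg2 R u w) [UniqueFactorizationMonoid S]
    [IsLocalRing S] (i : R →+* S) (hloc : ∀ r, IsUnit (i r) → IsUnit r)
    (hi : Function.Injective i) (hbir : ∀ s : S, ∃ r r', r' ≠ 0 ∧ s * i r' = i r) :
    Function.Surjective i ∨ i u ∣ i w ∨ i w ∣ i u := by
  have hu : i u ≠ 0 := by rw [map_ne_zero_iff i hi]; exact hR.prime.ne_zero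
  obtain ⟨X, Y, d, hXY, hdX, hdY⟩ := UniqueFactorizationMonoid.exists_reduced_factors (i u) hu (i w)
  by_cases hX : IsUnit X
  · right; left
    rw [← hdX, ← hdY]
    exact mul_dvd_mul_left d hX.dvd
  by_cases hY : IsUnit Y
  · right; right
    rw [← hdX, ← hdY]
    exact mul_dvd_mul_left d hY.dvd
  by_cases hd : IsUnit d
  · left
    refine surjective_of_isRelPrime hR i hloc hi hbir ?_
    rw [← hdX, ← hdY]
    exact (isRelPrime_mul_unit_left_left hd).2 ((isRelPrime_mul_unit_left_right hd).2 hXY)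
  exfalso
  set M := IsLocalRing.maximalIdeal S
  have hX0 : X ≠ 0 := by rintro rfl; exact hu (by rw [← hdX, mul_zero])
  have hd0 : d ≠ 0 := by rintro rfl; exact hu (by rw [← hdX, zero_mul])
  have hreg : ∀ z, X ∣ Y * z → X ∣ z := fun z hz => hXY.dvd_of_dvd_mul_left hz
  have hXM : X ∈ M := hX
  have hYM : Y ∈ M := hY
  have hdM : d ∈ M := hd
  have hIM : Ideal.span {X, Y} ≤ M := by
    rw [Ideal.span_le]; rintro a (rfl | rfl) <;> assumption
  obtain ⟨g, h, hh, hgh⟩ := hbir d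
  have hg : g ≠ 0 := by
    rintro rfl
    rw [map_zero, mul_eq_zero, map_eq_zero_iff i hi] at hgh
    exact hgh.elim hd0 hh
  obtain ⟨n, cH, ⟨a, ha, hau⟩, rfl⟩ := hR.exists_binaryForm hh
  obtain ⟨m, cG, ⟨b, hb, hbu⟩, rfl⟩ := hR.exists_binaryForm hg
  rw [map_binaryForm, map_binaryForm, ← hdX, ← hdY, binaryForm_smul, binaryForm_smul] at hgh
  set P := binaryForm X Y n (fun j => i (cH j)) with hP
  set Q := binaryForm X Y m (fun j => i (cG j)) with hQ
  have hPmem : P ∈ Ideal.span {X, Y} ^ n := by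
    simpa using binaryForm_mem X Y n (fun j => i (cH j)) ⊤ (by simp)
  have hQmem : Q ∈ Ideal.span {X, Y} ^ m := by
    simpa using binaryForm_mem X Y m (fun j => i (cG j)) ⊤ (by simp)
  rcases le_or_gt m n with hmn | hmn
  · have h1 : Q = d * (d ^ (n - m) * P) := by
      apply mul_left_cancel₀ (pow_ne_zero m hd0)
      rw [← hgh]
      have : d ^ n = d ^ m * d ^ (n - m) := by rw [← pow_add]; congr 1; omega
      rw [this]; ring
    have h2 : Q ∈ M * Ideal.span {X, Y} ^ m := by
      rw [h1]
      exact Ideal.mul_mem_mul hdM (Ideal.mul_mem_left _ _ (Ideal.pow_le_pow_right hmn hPmem))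
    have h3 := coeff_mem_of_binaryForm_mem hX0 hreg M hXM hYM m _ h2 b hb
    exact h3 (hbu.map i)
  · have h1 : P = d ^ (m - n - 1) * Q := by
      apply mul_left_cancel₀ (pow_ne_zero (n + 1) hd0)
      have : d ^ m = d ^ (n + 1) * d ^ (m - n - 1) := by rw [← pow_add]; congr 1; omega
      rw [this] at hgh
      rw [pow_succ', mul_assoc, hgh, pow_succ']; ring
    have h2 : P ∈ M * Ideal.span {X, Y} ^ n := by
      rw [h1]
      refine Ideal.mul_mem_left _ _ ?_
      have h4 : Ideal.span {X, Y} ^ m ≤ M * Ideal.span {X, Y} ^ n := by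
        refine (Ideal.pow_le_pow_right hmn).trans ?_
        rw [Nat.succ_eq_add_one, pow_succ']
        exact Ideal.mul_mono_left hIM
      exact h4 hQmem
    have h3 := coeff_mem_of_binaryForm_mem hX0 hreg M hXM hYM n _ h2 a ha
    exact h3 (hau.map i)

end Dichotomy

namespace Tower

open Polynomial IsResGraph

variable {K F : Type*} [Field K] [Field F] (T : Tower K F)

lemma val_z_odd (m : ℕ) : T.val (T.z (2 * m + 1)) = 1 / 2 ^ m := (T.hasVal_z_odd m).val_eq

lemma val_z_even (m : ℕ) : T.val (T.z (2 * m)) = 2 / 2 ^ m := (T.hasVal_z_even m).val_eq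

lemma val_z_succ_le (n : ℕ) : T.val (T.z (n + 1)) ≤ T.val (T.z n) := by
  obtain ⟨m, rfl | rfl⟩ := n.even_or_odd'
  · rw [T.val_z_odd, T.val_z_even]
    gcongr
    norm_num
  · rw [T.val_z_odd, show 2 * m + 1 + 1 = 2 * (m + 1) by ring, T.val_z_even, pow_succ]
    apply le_of_eq
    field_simp

section

variable {A : Subring K} (hA : ∀ a ∈ A, a ≠ 0 → 0 ≤ T.val a)
  (hAu : ∀ a ∈ A, a ≠ 0 → T.val a = 0 → a⁻¹ ∈ A)

include hA hAu

lemma isUnit_iff_val (a : A) : IsUnit a ↔ a.1 ≠ 0 ∧ T.val a.1 = 0 := by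
  constructor
  · intro h
    obtain ⟨b, hb⟩ := h.exists_right_inv
    have hb : a.1 * b.1 = 1 := congrArg Subtype.val hb
    have ha0 : a.1 ≠ 0 := left_ne_zero_of_mul_eq_one hb
    have hb0 : b.1 ≠ 0 := right_ne_zero_of_mul_eq_one hb
    refine ⟨ha0, ?_⟩
    have h1 := T.val_mul ha0 hb0
    rw [hb, T.isU_one.hasVal.val_eq] at h1
    have h2 := hA _ a.2 ha0
    have h3 := hA _ b.2 hb0
    linarith
  · rintro ⟨h0, h1⟩
    exact IsUnit.of_mul_eq_one ⟨_, hAu _ a.2 h0 h1⟩ (Subtype.ext (mul_inv_cancel₀ h0))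

lemma isLocalRing_of_val : IsLocalRing A := by
  refine IsLocalRing.of_nonunits_add fun a b ha hb => ?_
  rw [mem_nonunits_iff, T.isUnit_iff_val hA hAu] at *
  rintro ⟨h0, h1⟩
  by_cases ha0 : a.1 = 0
  · apply hb
    have : (a + b).1 = b.1 := by simp [ha0]
    rw [this] at h0 h1
    exact ⟨h0, h1⟩
  by_cases hb0 : b.1 = 0
  · apply ha
    have : (a + b).1 = a.1 := by simp [hb0]
    rw [this] at h0 h1
    exact ⟨h0, h1⟩
  have h2 := T.val_add ha0 hb0 h0
  have h3 := hA _ a.2 ha0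
  have h4 := hA _ b.2 hb0
  have h5 : T.val a.1 ≠ 0 := fun h => ha ⟨ha0, h⟩
  have h6 : T.val b.1 ≠ 0 := fun h => hb ⟨hb0, h⟩
  have h7 : 0 < min (T.val a.1) (T.val b.1) :=
    lt_min (lt_of_le_of_ne h3 h5.symm) (lt_of_le_of_ne h4 h6.symm)
  have h8 : T.val (a.1 + b.1) = 0 := h1
  linarith

/-- A factorial local ring dominated by the valuation and containing the `n`-th ring is that ring,
or contains the next one. -/
lemma eq_or_le [UniqueFactorizationMonoid A] {n : ℕ} (hn : ∀ z ∈ T.G n, z.1 ∈ A) :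
    (∀ a ∈ A, ∃ b, (a, b) ∈ T.G n) ∨ ∀ z ∈ T.G (n + 1), z.1 ∈ A := by
  have := T.isLocalRing_of_val hA hAu
  have hst := T.stage n
  have := hst.graph.isDomain
  let i : T.G n →+* A := (fstHom (T.G n)).codRestrict A (fun z => hn z.1 z.2)
  have hi1 : ∀ z, (i z).1 = z.1.1 := fun z => rfl
  have hinj : Function.Injective i := fun a b hab => hst.graph.ext_fst (congrArg Subtype.val hab)
  have hdich := surjective_or_dvd_or_dvd hst.reg i (by
      intro r hr
      rw [T.isUnit_iff_val hA hAu] at hr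
      rw [hst.graph.isUnit_iff]
      intro h0
      rw [T.snd_eq_zero_iff r.2] at h0
      rcases h0 with h0 | h0
      · exact hr.1 h0
      · rw [hi1] at hr
        exact h0.ne' hr.2) hinj (by
      intro s
      obtain ⟨a, b, hb, hab⟩ := T.frac s.1
      refine ⟨⟨a.1, T.G_mono (Nat.zero_le n) a.2⟩, ⟨b.1, T.G_mono (Nat.zero_le n) b.2⟩, ?_,
        Subtype.ext hab⟩
      intro h
      exact hb (congrArg (fun z => z.1.1) h))
  have hzn := T.z_ne_zero n
  have hzn' := T.z_ne_zero (n + 1)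
  have hquot : T.z n / T.z (n + 1) ∈ A → ∀ z ∈ T.G (n + 1), z.1 ∈ A := by
    intro hq
    have hev : ∀ P : (T.G n)[X], evFst (T.G n) (T.z n / T.z (n + 1)) P ∈ A := by
      intro P
      rw [evFst, coe_eval₂RingHom, eval₂_eq_sum, Polynomial.sum]
      exact sum_mem fun i _ => mul_mem (hn _ (P.coeff i).2) (pow_mem hq _)
    rintro ⟨a, b⟩ ⟨P, Q, hQ, h1, -⟩
    have hQm := mk_mem_locGraph (evFst (T.G n) (T.z n / T.z (n + 1))) (evSnd (T.G n) (T.r n)) Q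
    rw [← G_succ] at hQm
    have h2 := T.val_eq_zero_of_mem hQ hQm
    have h0 : evFst (T.G n) (T.z n / T.z (n + 1)) Q ≠ 0 := IsU.ne_zero ⟨_, _, hQ, hQm⟩
    have h3 := hAu _ (hev Q) h0 h2
    have : a = evFst (T.G n) (T.z n / T.z (n + 1)) P *
        (evFst (T.G n) (T.z n / T.z (n + 1)) Q)⁻¹ := by
      rw [← h1]; field_simp
    rw [show ((a, b) : K × F).1 = a from rfl, this]
    exact mul_mem (hev P) h3
  rcases hdich with h | h | h
  · left
    intro a ha
    obtain ⟨z, hz⟩ := h ⟨a, ha⟩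
    have hz1 : z.1.1 = a := congrArg Subtype.val hz
    refine ⟨z.1.2, ?_⟩
    rw [← hz1]
    exact z.2
  · right
    apply hquot
    obtain ⟨c, hc⟩ := h
    have hc : T.z (n + 1) = T.z n * c.1 := congrArg Subtype.val hc
    have hc0 : c.1 ≠ 0 := by
      intro h0; rw [h0, mul_zero] at hc; exact hzn' hc
    have h1 := T.val_mul hzn hc0
    rw [← hc] at h1
    have h2 := T.val_z_succ_le n
    have h3 := hA _ c.2 hc0
    have h4 := hAu _ c.2 hc0 (by linarith)
    rw [hc, div_mul_cancel_left₀ hzn]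
    exact h4
  · right
    apply hquot
    obtain ⟨c, hc⟩ := h
    have hc : T.z n = T.z (n + 1) * c.1 := congrArg Subtype.val hc
    rw [hc, mul_div_cancel_left₀ _ hzn']
    exact c.2

lemma exists_eq_G [UniqueFactorizationMonoid A] [IsNoetherianRing A]
    (h0 : ∀ z ∈ T.base, z.1 ∈ A) : ∃ n, ∀ a, a ∈ A ↔ ∃ b, (a, b) ∈ T.G n := by
  by_contra hcon
  push Not at hcon
  have hall : ∀ n, ∀ z ∈ T.G n, z.1 ∈ A := by
    intro n
    induction n with
    | zero => exact h0
    | succ n ih =>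
      refine (T.eq_or_le hA hAu ih).resolve_left fun hle => ?_
      obtain ⟨a, ha⟩ := hcon n
      rcases ha with ⟨h1, h2⟩ | ⟨h1, b, h2⟩
      · obtain ⟨b, hb⟩ := hle a h1
        exact h2 b hb
      · exact h1 (ih _ h2)
  let z' : ℕ → A := fun m => ⟨T.z (2 * m + 1), hall _ _ (T.z_mem _)⟩
  have hz' : ∀ m, (z' m).1 = T.z (2 * m + 1) := fun _ => rfl
  have hmono : Monotone fun m => Ideal.span {z' m} := by
    refine monotone_nat_of_le_succ fun m => ?_
    rw [Ideal.span_singleton_le_span_singleton]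
    obtain ⟨e, ⟨n, b, hb, he⟩, h⟩ := T.exists_z_odd_eq_sq m
    refine ⟨z' (m + 1) * ⟨e, hall _ _ he⟩, Subtype.ext ?_⟩
    rw [Subring.coe_mul, Subring.coe_mul, hz', hz', h]
    ring
  obtain ⟨n, hn⟩ := monotone_stabilizes_iff_noetherian.2 (inferInstance : IsNoetherianRing A)
    ⟨_, hmono⟩
  have h1 : Ideal.span {z' n} = Ideal.span {z' (n + 1)} := hn (n + 1) (by omega)
  have h2 := h1.ge (Ideal.mem_span_singleton_self _)
  obtain ⟨c, hc⟩ := Ideal.mem_span_singleton.1 h2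
  have hc : T.z (2 * (n + 1) + 1) = T.z (2 * n + 1) * c.1 := congrArg Subtype.val hc
  have hc0 : c.1 ≠ 0 := by
    intro h0; rw [h0, mul_zero] at hc; exact T.z_ne_zero _ hc
  have h3 := T.val_mul (T.z_ne_zero (2 * n + 1)) hc0
  rw [← hc, T.val_z_odd, T.val_z_odd] at h3
  have h4 := hA _ c.2 hc0
  have h5 : (1 : ℚ) / 2 ^ (n + 1) < 1 / 2 ^ n := by
    apply one_div_lt_one_div_of_lt (by positivity)
    exact pow_lt_pow_right₀ (by norm_num) (by omega)
  linarith

/-- The maximal ideal of a ring dominated by the valuation is not principal. -/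
lemma not_span_singleton (h0 : ∀ z ∈ T.base, z.1 ∈ A) [IsNoetherianRing A] (g : A)
    (hg : ∀ a : A, ¬ IsUnit a ↔ a ∈ Ideal.span {g}) : False := by
  have hval : ∀ a : A, a.1 ≠ 0 → ∃ n : ℤ, T.val a.1 = n * T.val g.1 := by
    have := T.isLocalRing_of_val hA hAu
    have hgu : ¬ IsUnit g := (hg g).2 (Ideal.mem_span_singleton_self _)
    intro a ha
    have hkr := Ideal.iInf_pow_eq_bot_of_isDomain (Ideal.span {g})
      (by rwa [Ne, Ideal.span_singleton_eq_top])
    have hex : ∃ n, ¬ g ^ n ∣ a := by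
      by_contra hcon
      push Not at hcon
      apply ha
      have : a ∈ ⨅ i, Ideal.span {g} ^ i := by
        rw [Ideal.mem_iInf]
        intro i
        rw [Ideal.span_singleton_pow, Ideal.mem_span_singleton]
        exact hcon i
      rw [hkr, Ideal.mem_bot] at this
      rw [this]; rfl
    classical
    obtain ⟨n, hn⟩ : ∃ r, r + 1 = Nat.find hex := by
      refine ⟨Nat.find hex - 1, Nat.sub_add_cancel ?_⟩
      by_contra h0
      have h0 : Nat.find hex = 0 := by omega
      exact (Nat.find_eq_zero hex).1 h0 (by simp)
    have h1 := Nat.find_min hex (m := n) (by omega)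
    have h2 := Nat.find_spec hex
    rw [← hn] at h2
    rw [not_not] at h1
    obtain ⟨c, rfl⟩ := h1
    have hcu : IsUnit c := by
      by_contra hcu
      rw [hg, Ideal.mem_span_singleton] at hcu
      apply h2
      rw [pow_succ]
      exact mul_dvd_mul_left _ hcu
    rw [T.isUnit_iff_val hA hAu] at hcu
    have hg0 : g.1 ^ n ≠ 0 := fun h => ha (by simp [h])
    refine ⟨n, ?_⟩
    have h3 : ((g ^ n * c : A) : K) = g.1 ^ n * c.1 := rfl
    rw [h3, T.val_mul hg0 hcu.1, hcu.2, add_zero]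
    rcases Nat.eq_zero_or_pos n with rfl | hn0
    · simp [T.isU_one.hasVal.val_eq]
    · have hg1 : g.1 ≠ 0 := fun h => hg0 (by rw [h, zero_pow hn0.ne'])
      rw [((T.hasVal_val hg1).pow n).val_eq]
      push_cast; rfl
  have hvalK : ∀ f : K, f ≠ 0 → ∃ n : ℤ, T.val f = n * T.val g.1 := by
    intro f hf
    obtain ⟨a, b, hb, hab⟩ := T.frac f
    have ha : a.1.1 ≠ 0 := by rw [← hab]; exact mul_ne_zero hf hb
    obtain ⟨n, hn⟩ := hval ⟨_, h0 _ a.2⟩ ha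
    obtain ⟨m, hm⟩ := hval ⟨_, h0 _ b.2⟩ hb
    have h1 := T.val_mul hf hb
    rw [hab] at h1
    simp only at hn hm
    refine ⟨n - m, ?_⟩
    push_cast
    linarith
  obtain ⟨q, hq⟩ : ∃ q, q = T.val g.1 := ⟨_, rfl⟩
  rw [← hq] at hvalK
  obtain ⟨n0, hn0⟩ := hvalK _ (T.z_ne_zero 1)
  have h1 := T.val_z_odd 0
  simp only [mul_zero, zero_add, pow_zero, div_one] at h1
  rw [h1] at hn0
  have hn0' : n0 ≠ 0 := by rintro rfl; simp at hn0
  obtain ⟨m, hm⟩ : ∃ m : ℕ, n0.natAbs < 2 ^ m := ⟨n0.natAbs, Nat.lt_two_pow_self⟩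
  obtain ⟨a, ha⟩ := hvalK _ (T.z_ne_zero (2 * m + 1))
  rw [T.val_z_odd] at ha
  have hqe : q = 1 / n0 := by
    have : (n0 : ℚ) ≠ 0 := by exact_mod_cast hn0'
    field_simp
    linarith
  have h2 : (n0 : ℚ) = a * 2 ^ m := by
    have : (n0 : ℚ) ≠ 0 := by exact_mod_cast hn0'
    rw [hqe] at ha
    field_simp at ha
    linarith
  have h3 : n0 = a * 2 ^ m := by exact_mod_cast h2
  have ha0 : a ≠ 0 := by rintro rfl; simp at h3; exact hn0' h3
  have h4 : n0.natAbs = a.natAbs * 2 ^ m := by rw [h3, Int.natAbs_mul, Int.natAbs_pow]; rfl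
  have h5 : 1 ≤ a.natAbs := Nat.one_le_iff_ne_zero.2 (by simpa using ha0)
  have h6 := Nat.mul_le_mul_right (2 ^ m) h5
  omega

end

end Tower

section Dimension

lemma algebraicIndependent_option {k R S ι : Type*} [Field k] [CommRing R] [IsDomain R]
    [CommRing S] [Algebra k R] [Algebra k S] (f : R →ₐ[k] S) {x : ι → R}
    (hx : AlgebraicIndependent k (fun i => f (x i))) {a : R} (ha : a ≠ 0) (hfa : f a = 0) :
    AlgebraicIndependent k (fun o : Option ι => o.elim a x) := by
  have hx' : AlgebraicIndependent k x := hx.of_comp f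
  rw [hx'.option_iff_transcendental]
  rintro ⟨P, hP0, hP⟩
  obtain ⟨Q, hQ, hdvd⟩ := P.exists_eq_pow_rootMultiplicity_mul_and_not_dvd hP0 0
  rw [map_zero, sub_zero] at hdvd hQ
  rw [hQ, map_mul, map_pow, Polynomial.aeval_X, mul_eq_zero] at hP
  have hQa := hP.resolve_left (pow_ne_zero _ ha)
  apply hdvd
  rw [Polynomial.X_dvd_iff]
  obtain ⟨Q', hQ'⟩ : ∃ Q', Q = Polynomial.X * Q' + Polynomial.C (Q.coeff 0) :=
    ⟨Q.divX, (Polynomial.X_mul_divX_add Q).symm⟩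
  rw [hQ', map_add, map_mul, Polynomial.aeval_X, Polynomial.aeval_C] at hQa
  have h1 := congrArg f hQa
  rw [map_add, map_mul, hfa, zero_mul, zero_add, map_zero] at h1
  obtain ⟨⟨q, hq⟩, hqe⟩ : ∃ q, q = Q.coeff 0 := ⟨_, rfl⟩
  rw [← hqe] at h1 ⊢
  have hq2 := hq
  rw [Algebra.adjoin_range_eq_range_aeval] at hq2
  obtain ⟨p, hp⟩ := hq2
  have h2 : f q = 0 := h1
  have hp' : MvPolynomial.aeval x p = q := hp
  rw [← hp', ← AlgHom.comp_apply, MvPolynomial.comp_aeval] at h2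
  have h3 : p = 0 := (algebraicIndependent_iff.1 hx) p h2
  refine Subtype.ext ?_
  change q = 0
  rw [← hp', h3, map_zero]

lemma exists_algebraicIndependent {k R : Type*} [Field k] [CommRing R] [Algebra k R] (n : ℕ) :
    ∀ s : LTSeries (PrimeSpectrum R), s.length = n →
    ∃ (ι : Type) (_ : Fintype ι) (x : ι → R), Fintype.card ι = n ∧
      AlgebraicIndependent k (fun i => Ideal.Quotient.mkₐ k s.head.asIdeal (x i)) := by
  induction n with
  | zero =>
    intro s hs
    refine ⟨Empty, inferInstance, Empty.elim, rfl, ?_⟩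
    have := s.head.2
    rw [algebraicIndependent_empty_type_iff]
    exact (algebraMap k (R ⧸ s.head.asIdeal)).injective
  | succ n ih =>
    intro s hs
    have hs0 : s.length ≠ 0 := by omega
    obtain ⟨ι, _, x, hc, hx⟩ := ih (s.tail hs0) (by simp [hs])
    have hlt : s.head < (s.tail hs0).head := by
      rw [RelSeries.head_tail]
      have := s.strictMono (a := 0) (b := 1) (by
        rw [Fin.lt_def]; simp [hs])
      exact this
    obtain ⟨a, ha, ha'⟩ := SetLike.exists_of_lt
      (show s.head.asIdeal < (s.tail hs0).head.asIdeal from hlt)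
    have := s.head.2
    refine ⟨Option ι, inferInstance, fun o => o.elim a x, by simp [hc], ?_⟩
    have h := algebraicIndependent_option
      (Ideal.Quotient.factorₐ k (le_of_lt
        (show s.head.asIdeal < (s.tail hs0).head.asIdeal from hlt)))
      (x := fun i => Ideal.Quotient.mkₐ k s.head.asIdeal (x i)) (by simpa using hx)
      (a := Ideal.Quotient.mkₐ k s.head.asIdeal a)
      (by simpa [Ideal.Quotient.eq_zero_iff_mem] using ha')
      (by simpa [Ideal.Quotient.eq_zero_iff_mem] using ha)
    have he : (fun o : Option ι => Ideal.Quotient.mkₐ k s.head.asIdeal (o.elim a x)) =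
        fun o => o.elim (Ideal.Quotient.mkₐ k s.head.asIdeal a)
          fun i => Ideal.Quotient.mkₐ k s.head.asIdeal (x i) := by
      funext o
      cases o <;> rfl
    rw [he]
    exact h

lemma ringKrullDim_le_of_trdeg {k R : Type*} [Field k] [CommRing R] [Algebra k R] {n : ℕ}
    (h : Algebra.trdeg k R ≤ n) : ringKrullDim R ≤ n := by
  refine iSup_le fun s => ?_
  obtain ⟨ι, _, x, hc, hx⟩ := exists_algebraicIndependent (k := k) _ s rfl
  have h1 := (AlgebraicIndependent.of_comp _ hx).lift_cardinalMk_le_trdeg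
  rw [Cardinal.mk_fintype, hc] at h1
  have h2 : ((s.length : ℕ) : Cardinal.{0}) ≤ n := by
    have := h1.trans (Cardinal.lift_le.2 h)
    simpa using this
  have h3 : s.length ≤ n := by exact_mod_cast h2
  exact_mod_cast h3

end Dimension

namespace Tower

variable {K F : Type*} [Field K] [Field F] (T : Tower K F)

/-- A regular local ring dominating the base and dominated by the valuation occurs in the
tower. -/
lemma exists_eq_G_of_regular {k : Type*} [Field k] [Algebra k K] (htr : Algebra.trdeg k K ≤ 2)
    {A : Subring K} (hA : ∀ a ∈ A, a ≠ 0 → 0 ≤ T.val a)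
    (hAu : ∀ a ∈ A, a ≠ 0 → T.val a = 0 → a⁻¹ ∈ A) (hk : ∀ c : k, algebraMap k K c ∈ A)
    (h0 : ∀ z ∈ T.base, z.1 ∈ A) [IsNoetherianRing A] (s : Finset A)
    (hs : ∀ z : A, ¬ IsUnit z ↔ z ∈ Ideal.span (s : Set A))
    (hcard : (s.card : WithBot (WithTop ℕ)) = ringKrullDim A) :
    ∃ n, ∀ a, a ∈ A ↔ ∃ b, (a, b) ∈ T.G n := by
  have := T.isLocalRing_of_val hA hAu
  have hdim : ringKrullDim A ≤ (2 : ℕ) := by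
    let A' : Subalgebra k K := { A with algebraMap_mem' := hk }
    have h1 : Algebra.trdeg k A' ≤ (2 : ℕ) :=
      (trdeg_le_of_injective A'.val Subtype.val_injective).trans (by exact_mod_cast htr)
    exact ringKrullDim_le_of_trdeg (R := A') h1
  rw [← hcard] at hdim
  have hle : s.card ≤ 2 := by
    have h : ((s.card : ℕ) : WithBot ℕ∞) ≤ (2 : ℕ) := hdim
    exact_mod_cast h
  have h2 : s.card = 2 := by
    interval_cases h : s.card
    · exfalso
      rw [Finset.card_eq_zero] at h
      subst h
      exact T.not_span_singleton hA hAu h0 0 (fun a => by rw [hs]; simp)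
    · exfalso
      obtain ⟨g, rfl⟩ := Finset.card_eq_one.1 h
      exact T.not_span_singleton hA hAu h0 g (fun a => by rw [hs]; simp)
    · rfl
  rw [h2] at hcard
  classical
  obtain ⟨u, w, -, rfl⟩ := Finset.card_eq_two.1 h2
  have hreg : IsReg2 A u w := isReg2_of_ringKrullDim (fun z => by rw [hs]; simp) hcard.symm
  have := hreg.ufm
  exact T.exists_eq_G hA hAu h0

end Tower

section Radicals

variable {k F : Type*} [Field k] [Field F] [Algebra (RatFunc k) F]

lemma intDegree_one_add_X : (1 + RatFunc.X : RatFunc k).intDegree = 1 := by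
  have : (1 + RatFunc.X : RatFunc k) =
      algebraMap (Polynomial k) (RatFunc k) (Polynomial.X + Polynomial.C 1) := by
    simp [add_comm]
  rw [this, RatFunc.intDegree_polynomial, Polynomial.natDegree_X_add_C]
  rfl

lemma one_add_X_ne_zero : (1 + RatFunc.X : RatFunc k) ≠ 0 := by
  intro h
  have := intDegree_one_add_X (k := k)
  rw [h, RatFunc.intDegree_zero] at this
  omega

lemma intDegree_pow {f : RatFunc k} (hf : f ≠ 0) (n : ℕ) :
    (f ^ n).intDegree = n * f.intDegree := by
  induction n with
  | zero => simp
  | succ n ih => rw [pow_succ, RatFunc.intDegree_mul (pow_ne_zero _ hf) hf, ih]; push_cast; ring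

lemma pow_ne_of_finrank_lt (E : IntermediateField (RatFunc k) F) [FiniteDimensional (RatFunc k) E]
    {p : ℕ} (hp : Module.finrank (RatFunc k) E < p) {b : F} (hb : b ∈ E) :
    b ^ p ≠ algebraMap (RatFunc k) F (1 + RatFunc.X) := by
  intro h
  have h1 : (⟨b, hb⟩ : E) ^ p = algebraMap (RatFunc k) E (1 + RatFunc.X) := Subtype.ext h
  have h2 := congrArg (Algebra.norm (RatFunc k)) h1
  rw [map_pow, Algebra.norm_algebraMap] at h2
  set N := Algebra.norm (RatFunc k) (⟨b, hb⟩ : E)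
  have hN : N ≠ 0 := by
    intro h0
    rw [h0, zero_pow (by omega)] at h2
    exact pow_ne_zero _ one_add_X_ne_zero h2.symm
  have h3 := congrArg RatFunc.intDegree h2
  rw [intDegree_pow hN, intDegree_pow one_add_X_ne_zero, intDegree_one_add_X, mul_one] at h3
  have h4 : p ∣ Module.finrank (RatFunc k) E := by
    rw [← Int.natCast_dvd_natCast]
    exact ⟨_, h3.symm⟩
  have h5 := Nat.le_of_dvd Module.finrank_pos h4
  omega

variable (k F)

/-- Successive choices of a prime, of a root of `1 + t` of that order, and of the field they
generate. -/
lemma exists_radicals [IsAlgClosed F] : ∃ (p : ℕ → ℕ) (lam : ℕ → F)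
    (E : ℕ → IntermediateField (RatFunc k) F), E 0 = ⊥ ∧
    ∀ m, (p m).Prime ∧ ringChar k ≠ p m ∧ lam m ^ p m = algebraMap (RatFunc k) F (1 + RatFunc.X) ∧
      E m ≤ E (m + 1) ∧ lam m ∈ E (m + 1) ∧
      ∀ b ∈ E m, b ^ p m ≠ algebraMap (RatFunc k) F (1 + RatFunc.X) := by
  have hp : ∀ n : ℕ, ∃ p, n < p ∧ p.Prime := fun n =>
    let ⟨p, h1, h2⟩ := Nat.exists_infinite_primes (n + 1)
    ⟨p, h1, h2⟩
  choose P hP1 hP2 using hp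
  have hl : ∀ n : ℕ, ∃ l : F, l ^ P n = algebraMap (RatFunc k) F (1 + RatFunc.X) := fun n =>
    IsAlgClosed.exists_pow_nat_eq _ (hP2 n).pos
  choose lam hlam using hl
  let B : ℕ → ℕ := fun n => Nat.rec (motive := fun _ => ℕ) (ringChar k + 1) (fun _ b => b * P b) n
  let E : ℕ → IntermediateField (RatFunc k) F := fun n =>
    Nat.rec (motive := fun _ => IntermediateField (RatFunc k) F) ⊥ (fun i e =>
      e ⊔ IntermediateField.adjoin (RatFunc k) {lam (B i)}) n
  have hB : ∀ n, ringChar k < B n := by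
    intro n
    induction n with
    | zero => exact Nat.lt_succ_self _
    | succ n ih => exact ih.trans_le (Nat.le_mul_of_pos_right _ (hP2 _).pos)
  have h_int : ∀ n, IsIntegral (RatFunc k) (lam n) := fun n =>
    ⟨Polynomial.X ^ P n - Polynomial.C (1 + RatFunc.X),
      Polynomial.monic_X_pow_sub_C _ (hP2 n).ne_zero, by
        rw [← Polynomial.aeval_def, map_sub, map_pow, Polynomial.aeval_X, Polynomial.aeval_C, hlam,
          sub_self]⟩
  have hdeg : ∀ n,
      Module.finrank (RatFunc k) (IntermediateField.adjoin (RatFunc k) {lam n}) ≤ P n := by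
    intro n
    rw [IntermediateField.adjoin.finrank (h_int n)]
    have h1 := minpoly.min (RatFunc k) (lam n)
      (Polynomial.monic_X_pow_sub_C (1 + RatFunc.X) (hP2 n).ne_zero) (by
        rw [map_sub, map_pow, Polynomial.aeval_X, Polynomial.aeval_C, hlam, sub_self])
    have h2 := Polynomial.natDegree_le_natDegree h1
    rwa [Polynomial.natDegree_X_pow_sub_C] at h2
  have hfd : ∀ n : ℕ,
      FiniteDimensional (RatFunc k) ↥(E n) ∧ Module.finrank (RatFunc k) ↥(E n) ≤ B n := by
    intro n
    induction n with
    | zero =>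
      constructor
      · exact inferInstanceAs (FiniteDimensional (RatFunc k) (⊥ : IntermediateField (RatFunc k) F))
      · change Module.finrank (RatFunc k) (⊥ : IntermediateField (RatFunc k) F) ≤ ringChar k + 1
        rw [IntermediateField.finrank_bot]; omega
    | succ n ih =>
      have := ih.1
      have := IntermediateField.adjoin.finiteDimensional (h_int (B n))
      constructor
      · exact IntermediateField.finiteDimensional_sup (E n) _
      · exact (IntermediateField.finrank_sup_le (E n) _).trans (Nat.mul_le_mul ih.2 (hdeg _))
  refine ⟨fun n => P (B n), fun n => lam (B n), E, rfl, fun m => ⟨hP2 _, ?_, hlam _, ?_, ?_, ?_⟩⟩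
  · exact ((hB m).trans (hP1 _)).ne
  · exact le_sup_left (a := E m)
  · exact (le_sup_right (a := E m)) (IntermediateField.mem_adjoin_simple_self _ _)
  · have := (hfd m).1
    exact fun b hb => pow_ne_of_finrank_lt (E m) ((hfd m).2.trans_lt (hP1 _)) hb

end Radicals

section Base

variable (k : Type*) [Field k]

lemma exists_eq_mul_X_add_mul_X {κ : Type*} [Field κ] {G : MvPolynomial (Fin 2) κ}
    (h : MvPolynomial.eval 0 G = 0) :
    ∃ c d, G = c * MvPolynomial.X 0 + d * MvPolynomial.X 1 := by
  have : G ∈ Ideal.span (MvPolynomial.X '' ({0, 1} : Set (Fin 2))) := by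
    rw [MvPolynomial.mem_ideal_span_X_image]
    intro m hm
    by_contra hcon
    push Not at hcon
    have hm0 : m = 0 := by
      ext i
      fin_cases i
      · exact hcon 0 (by simp)
      · exact hcon 1 (by simp)
    rw [hm0, MvPolynomial.mem_support_iff, ← MvPolynomial.constantCoeff_eq] at hm
    apply hm
    rwa [MvPolynomial.eval_zero] at h
  rw [Set.image_pair, Ideal.mem_span_pair] at this
  obtain ⟨c, d, h⟩ := this
  exact ⟨c, d, h.symm⟩

variable (F : Type*) [Field F] [Algebra (RatFunc k) F]

/-- Evaluation at the origin. -/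
def evZero : RP2 k →+* F := (algebraMap (RatFunc k) F).comp (MvPolynomial.eval 0)

/-- The graph of the residue map of the local ring of the origin. -/
def baseGraph : Subring (K2 k × F) := locGraph (algebraMap (RP2 k) (K2 k)) (evZero k F)

variable {k F}

lemma evZero_eq_zero {G : RP2 k} : evZero k F G = 0 ↔ MvPolynomial.eval 0 G = 0 := by
  rw [evZero, RingHom.comp_apply, map_eq_zero_iff _ (algebraMap (RatFunc k) F).injective]

lemma algebraMap_K2_injective : Function.Injective (algebraMap (RP2 k) (K2 k)) :=
  IsFractionRing.injective _ _

lemma evZero_eq_zero_of_algebraMap (H : RP2 k) (h : algebraMap (RP2 k) (K2 k) H = 0) :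
    evZero k F H = 0 := by
  rw [(map_eq_zero_iff _ algebraMap_K2_injective).1 h, map_zero]

lemma isStage_baseGraph : IsStage (baseGraph k F) (algebraMap (RP2 k) (K2 k) (MvPolynomial.X 0))
    (algebraMap (RP2 k) (K2 k) (MvPolynomial.X 1)) := by
  have e0 : evZero k F (MvPolynomial.X 0) = 0 := by simp [evZero_eq_zero]
  have e1 : evZero k F (MvPolynomial.X 1) = 0 := by simp [evZero_eq_zero]
  refine ⟨isResGraph_locGraph evZero_eq_zero_of_algebraMap, ?_, ?_, ?_⟩
  · have := mk_mem_locGraph (algebraMap (RP2 k) (K2 k)) (evZero k F) (MvPolynomial.X 0)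
    rwa [e0] at this
  · have := mk_mem_locGraph (algebraMap (RP2 k) (K2 k)) (evZero k F) (MvPolynomial.X 1)
    rwa [e1] at this
  have key := isReg2_locGraph (ψ := algebraMap (RP2 k) (K2 k)) (ρ := evZero k F)
    evZero_eq_zero_of_algebraMap e0 e1 (fun G hG => by
      obtain ⟨c, d, h⟩ := exists_eq_mul_X_add_mul_X (evZero_eq_zero.1 hG)
      exact ⟨c, d, congrArg _ h⟩)
    (by rw [Ne, map_eq_zero_iff _ algebraMap_K2_injective]; exact MvPolynomial.X_ne_zero 0)
    (Ideal.span {MvPolynomial.X 0})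
    ((Ideal.span_singleton_prime (MvPolynomial.X_ne_zero 0)).2 MvPolynomial.X_prime)
    (fun G hG => by
      obtain ⟨c, rfl⟩ := Ideal.mem_span_singleton.1 hG
      rw [map_mul, e0, zero_mul])
    (fun G hG => by
      rw [(map_eq_zero_iff _ algebraMap_K2_injective).1 hG]; exact zero_mem _)
    (Ideal.mem_span_singleton_self _)
    (fun G hG => by
      obtain ⟨c, rfl⟩ := Ideal.mem_span_singleton.1 hG
      exact ⟨c, rfl⟩)
    (by rw [Ideal.mem_span_singleton, MvPolynomial.X_dvd_X]; simp)
  have h0 : (toLoc _ _ (MvPolynomial.X 0) : locGraph (algebraMap (RP2 k) (K2 k)) (evZero k F)) =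
      ⟨_, mk_mem_locGraph _ _ (MvPolynomial.X 0)⟩ := rfl
  have h1 : (toLoc _ _ (MvPolynomial.X 1) : locGraph (algebraMap (RP2 k) (K2 k)) (evZero k F)) =
      ⟨_, mk_mem_locGraph _ _ (MvPolynomial.X 1)⟩ := rfl
  rw [h0, h1] at key
  simp only [e0, e1] at key
  exact key

lemma mem_R0_iff {f : K2 k} : f ∈ R0 k ↔ ∃ b, (f, b) ∈ baseGraph k F := by
  constructor
  · rintro ⟨a, rfl⟩
    obtain ⟨G, H, rfl⟩ := IsLocalization.exists_mk'_eq (M2 k) a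
    have hH : evZero k F H ≠ 0 := fun h => H.2 (evZero_eq_zero.1 h)
    refine ⟨evZero k F G / evZero k F H, G, H, hH, ?_, ?_⟩
    · rw [mul_comm]
      exact (IsLocalization.lift_mk'_spec _ _ _ _).1 rfl |>.symm
    · exact div_mul_cancel₀ _ hH
  · rintro ⟨b, G, H, hH, h, -⟩
    refine ⟨IsLocalization.mk' _ G (⟨H, fun h => hH (evZero_eq_zero.2 h)⟩ : M2 k), ?_⟩
    rw [IsLocalization.lift_mk'_spec, ← h, mul_comm]

lemma algebraMap_mem_R0 (c : RatFunc k) : algebraMap (RP2 k) (K2 k) (MvPolynomial.C c) ∈ R0 k :=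
  ⟨algebraMap _ _ (MvPolynomial.C c), IsLocalization.lift_eq _ _⟩

lemma snd_mem_of_mem_baseGraph (z) (hz : z ∈ baseGraph k F) :
    z.2 ∈ (⊥ : IntermediateField (RatFunc k) F) := by
  obtain ⟨G, H, hH, -, h⟩ := hz
  rw [← eq_div_iff hH] at h
  rw [h]
  exact div_mem (IntermediateField.algebraMap_mem _ _) (IntermediateField.algebraMap_mem _ _)

variable (k F)

lemma exists_tower [IsAlgClosed F] : ∃ T : Tower (K2 k) F,
    T.cK = onePlusT k ∧ T.base = baseGraph k F ∧ ∀ m, ringChar k ≠ T.p m := by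
  obtain ⟨p, lam, E, hE, h⟩ := exists_radicals k F
  refine ⟨⟨onePlusT k, algebraMap _ F (1 + RatFunc.X), p, lam, fun n => (E n).toSubfield,
    baseGraph k F, _, _, ?_, fun m => (h m).1, fun m => (h m).2.2.1, fun m => (h m).2.2.2.1,
    fun m => (h m).2.2.2.2.1, fun m => (h m).2.2.2.2.2, ?_, isStage_baseGraph, ?_⟩, rfl, rfl,
    fun m => (h m).2.1⟩
  · have := mk_mem_locGraph (algebraMap (RP2 k) (K2 k)) (evZero k F)
      (MvPolynomial.C (1 + RatFunc.X))
    have he : evZero k F (MvPolynomial.C (1 + RatFunc.X)) =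
        algebraMap (RatFunc k) F (1 + RatFunc.X) := by
      rw [evZero, RingHom.comp_apply, MvPolynomial.eval_C]
    rwa [he] at this
  · intro z hz
    have := snd_mem_of_mem_baseGraph z hz
    rwa [← hE] at this
  · intro f
    obtain ⟨G, H, hH, rfl⟩ := IsFractionRing.div_surjective (A := RP2 k) f
    have hH0 : algebraMap (RP2 k) (K2 k) H ≠ 0 := by
      rw [Ne, map_eq_zero_iff _ algebraMap_K2_injective]
      exact nonZeroDivisors.ne_zero hH
    exact ⟨⟨_, mk_mem_locGraph _ _ G⟩, ⟨_, mk_mem_locGraph _ _ H⟩, hH0, div_mul_cancel₀ _ hH0⟩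

lemma trdeg_K2 : Algebra.trdeg (RatFunc k) (K2 k) ≤ 2 := by
  have h1 := trdeg_add_eq (RatFunc k) (RP2 k) (A := K2 k)
  have : Algebra.IsAlgebraic (RP2 k) (K2 k) := by
    exact IsLocalization.isAlgebraic _ (nonZeroDivisors (RP2 k))
  rw [trdeg_eq_zero (R := RP2 k), add_zero, MvPolynomial.trdeg_of_isDomain] at h1
  rw [← h1]
  simp

end Base

section Dominated

variable {k : Type*} [Field k] {F : Type*} [Field F] [Algebra (RatFunc k) F] (T : Tower (K2 k) F)

lemma isQValuation_val {K F : Type*} [Field K] [Field F] (T : Tower K F) : IsQValuation T.val :=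
  ⟨fun _ _ ha hb => T.val_mul ha hb, fun _ _ ha hb hab => T.val_add ha hb hab⟩

lemma inv_mem_of_qDominates {K : Type*} [Field K] {v : K → ℚ} {S : Subring K}
    (h : QDominates v S) {a : K} (ha : a ∈ S) (ha0 : a ≠ 0) (hv : v a = 0) : a⁻¹ ∈ S := by
  by_contra hcon
  have := ((h.2 a ha).1 ⟨ha, fun h => hcon h.2⟩).resolve_left ha0
  exact this.ne' hv

lemma qDominates_R0 (hT : T.base = baseGraph k F) : QDominates T.val (R0 k) := by
  have hmem : ∀ {f}, f ∈ R0 k ↔ ∃ b, (f, b) ∈ T.G 0 := by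
    intro f
    rw [mem_R0_iff (F := F), ← hT]
    rfl
  refine ⟨fun f hf hf0 => ?_, fun f hf => ?_⟩
  · obtain ⟨b, hb⟩ := hmem.1 hf
    exact T.val_nonneg_of_mem hf0 hb
  · obtain ⟨b, hb⟩ := hmem.1 hf
    rw [← T.snd_eq_zero_iff hb]
    constructor
    · rintro ⟨-, h⟩
      by_contra hb0
      refine h ⟨Tower.IsU.ne_zero ⟨_, _, hb0, hb⟩, hmem.2 ⟨_, (T.graph 0).inv _ _ hb hb0⟩⟩
    · rintro rfl
      refine ⟨hf, ?_⟩
      rintro ⟨h0, h1⟩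
      obtain ⟨b', hb'⟩ := hmem.1 h1
      have h2 := T.val_pos_of_mem h0 hb
      have h3 := T.val_nonneg_of_mem (inv_ne_zero h0) hb'
      rw [T.val_inv h0] at h3
      linarith

lemma exists_eq_G_of_isRegularLocal (hT : T.base = baseGraph k F) {A : Subring (K2 k)}
    (hA : IsRegularLocal A) (hA0 : R0 k ≤ A) (hAv : QDominates T.val A) :
    ∃ n, ∀ a, a ∈ A ↔ ∃ b, (a, b) ∈ T.G n := by
  obtain ⟨hN, -, s, hs, hcard⟩ := hA
  refine T.exists_eq_G_of_regular (trdeg_K2 k) hAv.1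
    (fun a ha ha0 hv => inv_mem_of_qDominates hAv ha ha0 hv) (fun c => hA0 ?_)
    (fun z hz => hA0 ?_) s (fun z => (Set.ext_iff.1 hs z).symm) hcard
  · exact algebraMap_mem_R0 c
  · rw [hT] at hz
    exact mem_R0_iff.2 ⟨_, hz⟩

end Dominated

section

open Polynomial

section Unramified

variable {K F : Type*} [Field K] [Field F]

open IsResGraph

/-- The extension of the graph of a two-dimensional regular local ring generated by roots `s`, `l`
of a monic polynomial that stays irreducible and separable over the residue field. -/
structure IsUnramExt (Γ : Subring (K × F)) (u w : K) {L : Type*} [Field L] [Algebra K L]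
    (s : L) (l : F) (Fp : Γ[X]) : Prop where
  stage : IsStage Γ u w
  monic : Fp.Monic
  irr : Irreducible (Fp.map stage.graph.res)
  sep : (Fp.map stage.graph.res).Separable
  evFst : evFst Γ s Fp = 0
  evSnd : evSnd Γ l Fp = 0
  free : ∀ r : Γ[X], r.degree < Fp.degree → _root_.evFst Γ s r = 0 → r = 0

namespace IsUnramExt

variable {Γ : Subring (K × F)} {u w : K} {L : Type*} [Field L] [Algebra K L] {s : L} {l : F}
  {Fp : Γ[X]} (h : IsUnramExt Γ u w s l Fp)

include h

lemma evSnd_eq_zero (H : Γ[X]) (hH : _root_.evFst Γ s H = 0) : _root_.evSnd Γ l H = 0 := by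
  have := h.stage.graph.isDomain
  have h1 : H %ₘ Fp + Fp * (H /ₘ Fp) = H := modByMonic_add_div H Fp
  have h2 : H %ₘ Fp = 0 := by
    apply h.free _ (degree_modByMonic_lt H h.monic)
    rw [← h1, map_add, map_mul, h.evFst, zero_mul, add_zero] at hH
    exact hH
  rw [h2, zero_add] at h1
  rw [← h1, map_mul, h.evSnd, zero_mul]

lemma exists_evFst_eq (G : Γ[X]) (hG : _root_.evSnd Γ l G = 0) :
    ∃ c d, _root_.evFst Γ s G =
      _root_.evFst Γ s (c * C ⟨(u, 0), h.stage.u_mem⟩ + d * C ⟨(w, 0), h.stage.w_mem⟩) := by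
  obtain ⟨Q, r, rfl, hr⟩ := h.stage.graph.exists_eq_mul_add l h.monic h.irr h.evSnd G hG
  obtain ⟨c, d, rfl⟩ := h.stage.exists_eq_of_map_res_eq_zero r hr
  exact ⟨c, d, by rw [map_add, map_mul, h.evFst, zero_mul, zero_add]⟩

lemma aeval_map_res : aeval l (Fp.map h.stage.graph.res) = 0 := by
  rw [← h.stage.graph.evSnd_eq, h.evSnd]

lemma exists_inv (H : Γ[X]) (hH : _root_.evSnd Γ l H ≠ 0) :
    ∃ Q, _root_.evSnd Γ l (Q * H - 1) = 0 := by
  have h1 : ¬ Fp.map h.stage.graph.res ∣ H.map h.stage.graph.res := by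
    rintro ⟨Q, hQ⟩
    apply hH
    rw [h.stage.graph.evSnd_eq, hQ, map_mul, h.aeval_map_res, zero_mul]
  obtain ⟨a, b, hab⟩ := h.irr.coprime_iff_not_dvd.2 h1
  obtain ⟨Q, rfl⟩ := map_surjective _ h.stage.graph.res_surjective b
  refine ⟨Q, ?_⟩
  have h2 := congrArg (aeval l) hab
  rw [map_add, map_mul, h.aeval_map_res, mul_zero, zero_add, ← Polynomial.map_mul,
    ← h.stage.graph.evSnd_eq, map_one] at h2
  rw [map_sub, h2, map_one, sub_self]

lemma isResGraph : IsResGraph (locGraph (_root_.evFst Γ s) (_root_.evSnd Γ l)) :=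
  isResGraph_locGraph h.evSnd_eq_zero

lemma isNoetherianRing : IsNoetherianRing (locGraph (_root_.evFst Γ s) (_root_.evSnd Γ l)) := by
  have := h.stage.reg.noeth
  exact isNoetherianRing_locGraph h.evSnd_eq_zero

lemma not_isUnit_iff (z : locGraph (_root_.evFst Γ s) (_root_.evSnd Γ l)) :
    ¬ IsUnit z ↔ z ∈ Ideal.span
      {toLoc (_root_.evFst Γ s) (_root_.evSnd Γ l) (C ⟨(u, 0), h.stage.u_mem⟩),
        toLoc (_root_.evFst Γ s) (_root_.evSnd Γ l) (C ⟨(w, 0), h.stage.w_mem⟩)} :=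
  not_isUnit_locGraph_iff h.evSnd_eq_zero (by simp) (by simp) h.exists_evFst_eq z

omit h in
lemma degree_C_mul_le' (a : Γ) (P : Γ[X]) : (C a * P).degree ≤ P.degree := by
  rw [← smul_eq_C_mul]; exact degree_smul_le _ _

lemma not_dvd_pow (n : ℕ) :
    ¬ toLoc (_root_.evFst Γ s) (_root_.evSnd Γ l) (C ⟨(u, 0), h.stage.u_mem⟩) ∣
      toLoc (_root_.evFst Γ s) (_root_.evSnd Γ l) (C ⟨(w, 0), h.stage.w_mem⟩) ^ n := by
  rintro ⟨z, hz⟩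
  have := h.stage.graph.isDomain
  obtain ⟨G, H, hH, h1, -⟩ := z.2
  have h2 : algebraMap K L w ^ n = algebraMap K L u * z.1.1 := by
    have : (_root_.evFst Γ s (C ⟨(w, 0), h.stage.w_mem⟩)) ^ n =
      _root_.evFst Γ s (C ⟨(u, 0), h.stage.u_mem⟩) * z.1.1 := congrArg (fun z => z.1.1) hz
    rwa [evFst_C, evFst_C] at this
  have hdec : ∀ P : Γ[X], ∃ r : Γ[X], r.degree < Fp.degree ∧
      _root_.evFst Γ s P = _root_.evFst Γ s r ∧ _root_.evSnd Γ l P = _root_.evSnd Γ l r := by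
    intro P
    refine ⟨P %ₘ Fp, degree_modByMonic_lt P h.monic, ?_, ?_⟩
    · conv_lhs => rw [← modByMonic_add_div P Fp, map_add, map_mul, h.evFst, zero_mul, add_zero]
    · conv_lhs => rw [← modByMonic_add_div P Fp, map_add, map_mul, h.evSnd, zero_mul, add_zero]
  obtain ⟨g, hg, hg1, -⟩ := hdec G
  obtain ⟨r, hr, hr1, hr2⟩ := hdec H
  rw [hr2] at hH
  rw [hr1, hg1] at h1
  set U : Γ := ⟨(u, 0), h.stage.u_mem⟩ with hU
  set W : Γ := ⟨(w, 0), h.stage.w_mem⟩ with hW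
  have h3 : C (W ^ n) * r - C U * g = 0 := by
    apply h.free
    · refine (degree_sub_le _ _).trans_lt (max_lt ?_ ?_)
      · exact (degree_C_mul_le' _ _).trans_lt hr
      · exact (degree_C_mul_le' _ _).trans_lt hg
    · rw [map_sub, map_mul, map_mul, ← h1, evFst_C, evFst_C]
      have : (W ^ n).1.1 = w ^ n := rfl
      rw [this, map_pow, h2]
      ring
  obtain ⟨i, hi⟩ : ∃ i, (r.coeff i).1.2 ≠ 0 := by
    by_contra hcon
    push Not at hcon
    apply hH
    rw [h.stage.graph.evSnd_eq]
    have : r.map h.stage.graph.res = 0 := by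
      ext i
      rw [coeff_map, coe_res, hcon i]
      simp
    rw [this, map_zero]
  have h4 := congrArg (fun P => P.coeff i) h3
  simp only [coeff_sub, coeff_C_mul, coeff_zero] at h4
  have h5 : U ∣ W ^ n * r.coeff i := ⟨g.coeff i, sub_eq_zero.1 h4⟩
  rw [((h.stage.graph.isUnit_iff _).2 hi).dvd_mul_right] at h5
  exact h.stage.reg.pow_notMem n h5

lemma ringKrullDim_eq : ringKrullDim (locGraph (_root_.evFst Γ s) (_root_.evSnd Γ l)) = 2 := by
  have := h.isNoetherianRing
  have := h.isResGraph.isDomain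
  have := h.isResGraph.isLocalRing
  refine ringKrullDim_eq_two h.not_isUnit_iff ?_ h.not_dvd_pow
  intro h0
  have h1 : _root_.evFst Γ s (C ⟨(u, 0), h.stage.u_mem⟩) = 0 := congrArg (fun z => z.1.1) h0
  rw [evFst_C, map_eq_zero] at h1
  exact h.stage.u_ne_zero h1

lemma isIntegral : IsIntegral h.stage.graph.kap l :=
  ⟨Fp.map h.stage.graph.res, h.monic.map _, by rw [← aeval_def]; exact h.aeval_map_res⟩

lemma snd_mem_adjoin (z : locGraph (_root_.evFst Γ s) (_root_.evSnd Γ l)) :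
    z.1.2 ∈ IntermediateField.adjoin h.stage.graph.kap {l} := by
  have key : ∀ P : Γ[X], _root_.evSnd Γ l P ∈ IntermediateField.adjoin h.stage.graph.kap {l} := by
    intro P
    rw [h.stage.graph.evSnd_eq]
    exact IntermediateField.algebra_adjoin_le_adjoin _ _ (aeval_mem_adjoin_singleton _ _)
  obtain ⟨G, H, hH, -, h1⟩ := z.2
  rw [eq_div_of_mul_eq hH h1]
  exact div_mem (key G) (key H)

lemma exists_sum_snd_eq_zero : ∃ n : ℕ,
    ∀ z : Fin (n + 1) → locGraph (_root_.evFst Γ s) (_root_.evSnd Γ l),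
    ∃ a : Fin (n + 1) → Γ, (∃ i, (a i).1.2 ≠ 0) ∧ ∑ i, (a i).1.2 * (z i).1.2 = 0 := by
  have := IntermediateField.adjoin.finiteDimensional h.isIntegral
  refine ⟨Module.finrank h.stage.graph.kap (IntermediateField.adjoin h.stage.graph.kap {l}),
    fun z => ?_⟩
  have h1 : ¬ LinearIndependent h.stage.graph.kap
      (fun i => (⟨(z i).1.2, h.snd_mem_adjoin (z i)⟩ :
        IntermediateField.adjoin h.stage.graph.kap {l})) := by
    intro hli
    have := hli.fintype_card_le_finrank
    rw [Fintype.card_fin] at this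
    omega
  obtain ⟨g, hg, i, hi⟩ := Fintype.not_linearIndependent_iff.1 h1
  choose a ha using fun i => h.stage.graph.res_surjective (g i)
  refine ⟨a, ⟨i, ?_⟩, ?_⟩
  · rw [← h.stage.graph.coe_res, ha]
    simpa using hi
  · have := congrArg (Subtype.val) hg
    rw [IntermediateField.coe_sum] at this
    rw [← ZeroMemClass.coe_zero (IntermediateField.adjoin h.stage.graph.kap {l}), ← this]
    refine Finset.sum_congr rfl fun i _ => ?_
    rw [← h.stage.graph.coe_res, ha]
    rfl

lemma isSeparable_snd (z : locGraph (_root_.evFst Γ s) (_root_.evSnd Γ l)) :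
    IsSeparable h.stage.graph.kap z.1.2 := by
  rw [← mem_separableClosure_iff]
  refine IntermediateField.adjoin_simple_le_iff.2 ?_ (h.snd_mem_adjoin z)
  exact mem_separableClosure_iff.2 (h.sep.of_dvd (minpoly.dvd _ _ h.aeval_map_res))

lemma exists_separable_lift (z : locGraph (_root_.evFst Γ s) (_root_.evSnd Γ l)) :
    ∃ P Q R : Γ[X], P.Monic ∧ _root_.evSnd Γ z.1.2 P = 0 ∧
      ∀ i, ((Q * P + R * derivative P - 1).coeff i).1.2 = 0 := by
  have hs := h.isSeparable_snd z
  have hm := minpoly.monic hs.isIntegral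
  obtain ⟨P, hP, -, hPm⟩ := lifts_and_natDegree_eq_and_monic
    ((mem_lifts _).2 (map_surjective _ h.stage.graph.res_surjective
      (minpoly h.stage.graph.kap z.1.2))) hm
  obtain ⟨Q', R', hQR⟩ := hs
  obtain ⟨Q, rfl⟩ := map_surjective _ h.stage.graph.res_surjective Q'
  obtain ⟨R, rfl⟩ := map_surjective _ h.stage.graph.res_surjective R'
  refine ⟨P, Q, R, hPm, ?_, fun i => ?_⟩
  · rw [h.stage.graph.evSnd_eq, hP, minpoly.aeval]
  · rw [← h.stage.graph.res_eq_zero_iff, ← coeff_map]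
    have : (Q * P + R * derivative P - 1).map h.stage.graph.res = 0 := by
      rw [Polynomial.map_sub, Polynomial.map_add, Polynomial.map_mul, Polynomial.map_mul,
        ← derivative_map, hP, hQR, Polynomial.map_one, sub_self]
    rw [this, coeff_zero]

end IsUnramExt

end Unramified

end

section

open Polynomial

section Dominated

variable {K F : Type*} [Field K] [Field F]

namespace IsResGraph

lemma inNonunits_iff {Γ : Subring (K × F)} (h : IsResGraph Γ) {S : Subring K}
    (hS : ∀ a, a ∈ S ↔ ∃ b, (a, b) ∈ Γ) (a : K) : S.inNonunits a ↔ (a, (0 : F)) ∈ Γ := by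
  constructor
  · rintro ⟨h1, h2⟩
    obtain ⟨b, hb⟩ := (hS a).1 h1
    by_cases hb0 : b = 0
    · rwa [hb0] at hb
    · refine absurd ⟨?_, (hS _).2 ⟨_, h.inv _ _ hb hb0⟩⟩ h2
      rintro rfl
      exact hb0 (h.single _ hb)
  · intro ha
    refine ⟨(hS a).2 ⟨_, ha⟩, ?_⟩
    rintro ⟨h0, h1⟩
    obtain ⟨b, hb⟩ := (hS _).1 h1
    have := mul_mem ha hb
    rw [Prod.mk_mul_mk, mul_inv_cancel₀ h0, zero_mul] at this
    exact one_ne_zero (h.snd_unique (one_mem Γ) this)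

/-- A local subring is isomorphic to the graph of its residue map. -/
def ringEquiv {Γ : Subring (K × F)} (h : IsResGraph Γ) {S : Subring K}
    (hS : ∀ a, a ∈ S ↔ ∃ b, (a, b) ∈ Γ) : Γ ≃+* S :=
  RingEquiv.ofBijective ((fstHom Γ).codRestrict S fun z => (hS _).2 ⟨z.1.2, z.2⟩)
    ⟨fun _ _ hz => h.ext_fst (congrArg Subtype.val hz), fun a => by
      obtain ⟨b, hb⟩ := (hS a).1 a.2
      exact ⟨⟨_, hb⟩, rfl⟩⟩

end IsResGraph

lemma IsRegularLocal.of_ringEquiv {R S : Type*} [CommRing R] [CommRing S] (hR : IsRegularLocal R)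
    (e : R ≃+* S) : IsRegularLocal S := by
  obtain ⟨h1, h2, s, hs, hc⟩ := hR
  refine ⟨isNoetherianRing_of_ringEquiv R e, e.isLocalRing,
    s.map ⟨e, e.injective⟩, ?_, ?_⟩
  · ext x
    obtain ⟨y, rfl⟩ := e.surjective x
    have h3 : (↑(s.map ⟨e, e.injective⟩) : Set S) = e '' s := by simp
    rw [h3, ← Ideal.map_span, SetLike.mem_coe, Ideal.mem_map_of_equiv]
    rw [Set.ext_iff] at hs
    simp only [SetLike.mem_coe, Set.mem_ofPred_eq] at hs
    simp [hs]
  · rw [Finset.card_map, hc, ringKrullDim_eq_of_ringEquiv e]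

/-- The valuation ring `W` dominates the subring generated by a root. -/
structure ValDominates (Γ : Subring (K × F)) {L : Type*} [Field L] [Algebra K L] (s : L) (l : F)
    (W : ValuationSubring L) : Prop where
  lt_one : ∀ G : Γ[X], evSnd Γ l G = 0 → W.valuation (evFst Γ s G) < 1
  eq_one : ∀ G : Γ[X], evSnd Γ l G ≠ 0 → W.valuation (evFst Γ s G) = 1

lemma evFst_mem {Γ : Subring (K × F)} {L : Type*} [Field L] [Algebra K L] {s : L} {B : Subring L}
    (h1 : ∀ z ∈ Γ, algebraMap K L z.1 ∈ B) (hs : s ∈ B) (P : Γ[X]) : evFst Γ s P ∈ B := by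
  rw [evFst, coe_eval₂RingHom, eval₂_eq_sum, Polynomial.sum]
  exact sum_mem fun i _ => mul_mem (h1 _ (P.coeff i).2) (pow_mem hs _)

lemma algebraMap_mem_locGraph {Γ : Subring (K × F)} {L : Type*} [Field L] [Algebra K L] {s : L}
    {l : F} {a : K} {b : F} (ha : (a, b) ∈ Γ) :
    (algebraMap K L a, b) ∈ locGraph (evFst Γ s) (evSnd Γ l) := by
  simpa using mk_mem_locGraph (evFst Γ s) (evSnd Γ l) (C ⟨_, ha⟩)

lemma evFst_mem_locGraph {Γ : Subring (K × F)} {L : Type*} [Field L] [Algebra K L] {s : L}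
    {l : F} {x : L} {b : F} (hx : (x, b) ∈ locGraph (evFst Γ s) (evSnd Γ l)) (P : Γ[X]) :
    (evFst Γ x P, evSnd Γ b P) ∈ locGraph (evFst Γ s) (evSnd Γ l) := by
  induction P using Polynomial.induction_on' with
  | add P Q hP hQ => simpa using add_mem hP hQ
  | monomial n a =>
    rw [← C_mul_X_pow_eq_monomial]
    simpa using mul_mem (algebraMap_mem_locGraph (s := s) (l := l) a.2) (pow_mem hx n)

lemma mem_closure_iff_exists_evFst {Γ : Subring (K × F)} {L : Type*} [Field L] [Algebra K L]
    {s : L} {A : Subring K} (hA : ∀ a, a ∈ A ↔ ∃ b, (a, b) ∈ Γ) (b : L) :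
    b ∈ Subring.closure ((A.map (algebraMap K L) : Set L) ∪ {s}) ↔ ∃ G, evFst Γ s G = b := by
  constructor
  · intro hb
    change b ∈ (evFst Γ s).range
    refine Subring.closure_le.2 ?_ hb
    rintro _ (⟨a, ha, rfl⟩ | rfl)
    · obtain ⟨b, hb⟩ := (hA a).1 ha
      exact ⟨C ⟨_, hb⟩, by simp⟩
    · exact ⟨X, by simp⟩
  · rintro ⟨G, rfl⟩
    refine evFst_mem (fun z hz => Subring.subset_closure (Set.mem_union_left _ ?_))
      (Subring.subset_closure (Set.mem_union_right _ (Set.mem_singleton s))) G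
    exact ⟨z.1, (hA _).2 ⟨z.2, hz⟩, rfl⟩

lemma ValDominates.mem_iff {Γ : Subring (K × F)} {L : Type*} [Field L] [Algebra K L] {s : L} {l : F}
    {W : ValuationSubring L} (hW : ValDominates Γ s l W) {A : Subring K}
    (hA : ∀ a, a ∈ A ↔ ∃ b, (a, b) ∈ Γ) {C : Subring L}
    (hC : ∀ z : L, z ∈ C ↔ ∃ b s' : L,
      b ∈ Subring.closure ((A.map (algebraMap K L) : Set L) ∪ {s}) ∧
      s' ∈ Subring.closure ((A.map (algebraMap K L) : Set L) ∪ {s}) ∧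
      ¬ W.valuation s' < 1 ∧ z * s' = b) (z : L) :
    z ∈ C ↔ ∃ b, (z, b) ∈ locGraph (evFst Γ s) (evSnd Γ l) := by
  rw [hC]
  simp only [mem_closure_iff_exists_evFst hA]
  constructor
  · rintro ⟨_, _, ⟨G, rfl⟩, ⟨H, rfl⟩, h1, h2⟩
    have h3 : evSnd Γ l H ≠ 0 := fun h => h1 (hW.lt_one H h)
    exact ⟨_, G, H, h3, h2, div_mul_cancel₀ _ h3⟩
  · rintro ⟨b, G, H, h1, h2, -⟩
    exact ⟨_, _, ⟨G, rfl⟩, ⟨H, rfl⟩, by rw [hW.eq_one H h1]; exact lt_irrefl _, h2⟩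

lemma ValDominates.valuation_le_one {Γ : Subring (K × F)} {L : Type*} [Field L] [Algebra K L]
    {s : L} {l : F} {W : ValuationSubring L} (hW : ValDominates Γ s l W) (G : Γ[X]) :
    W.valuation (evFst Γ s G) ≤ 1 := by
  by_cases h : evSnd Γ l G = 0
  · exact (hW.lt_one G h).le
  · exact (hW.eq_one G h).le

lemma ValDominates.valuation_of_mem {Γ : Subring (K × F)} {L : Type*} [Field L] [Algebra K L]
    {s : L} {l : F} {W : ValuationSubring L} (hW : ValDominates Γ s l W) {z : L} {b : F}
    (hz : (z, b) ∈ locGraph (evFst Γ s) (evSnd Γ l)) :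
    W.valuation z ≤ 1 ∧ (W.valuation z < 1 ↔ b = 0) := by
  obtain ⟨G, H, h1, h2, h3⟩ := hz
  have h4 := congrArg W.valuation h2
  rw [map_mul, hW.eq_one H h1, mul_one] at h4
  change W.valuation z = _ at h4
  change b * _ = _ at h3
  rw [h4]
  refine ⟨hW.valuation_le_one G, fun h => ?_, fun h => hW.lt_one G ?_⟩
  · by_contra hb
    exact absurd (hW.eq_one G (by rw [← h3]; exact mul_ne_zero hb h1)) h.ne
  · rw [← h3, h, zero_mul]

namespace IsUnramExt

variable {Γ : Subring (K × F)} {u w : K} {L : Type*} [Field L] [Algebra K L] {s : L} {l : F}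
  {Fp : Γ[X]} (h : IsUnramExt Γ u w s l Fp)

include h

lemma isRegularLocal : IsRegularLocal (locGraph (_root_.evFst Γ s) (_root_.evSnd Γ l)) := by
  classical
  refine ⟨h.isNoetherianRing, h.isResGraph.isLocalRing,
    {toLoc (_root_.evFst Γ s) (_root_.evSnd Γ l) (C ⟨(u, 0), h.stage.u_mem⟩),
        toLoc (_root_.evFst Γ s) (_root_.evSnd Γ l) (C ⟨(w, 0), h.stage.w_mem⟩)}, ?_, ?_⟩
  · ext z
    rw [Finset.coe_pair]
    exact (h.not_isUnit_iff z).symm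
  · rw [h.ringKrullDim_eq, Finset.card_pair]
    · rfl
    · intro heq
      exact h.not_dvd_pow 1 ⟨1, by rw [pow_one, mul_one, heq]⟩

lemma valDominates {W : ValuationSubring L}
    (hW1 : ∀ z ∈ Γ, algebraMap K L z.1 ∈ W)
    (hW2 : ∀ a, (a, (0 : F)) ∈ Γ → W.valuation (algebraMap K L a) < 1) (hs : s ∈ W) :
    ValDominates Γ s l W := by
  have h1 : ∀ G : Γ[X], W.valuation (_root_.evFst Γ s G) ≤ 1 := fun G =>
    (W.valuation_le_one_iff _).2 (evFst_mem (B := W.toSubring) hW1 hs G)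
  have h2 : ∀ G : Γ[X], _root_.evSnd Γ l G = 0 → W.valuation (_root_.evFst Γ s G) < 1 := by
    intro G hG
    obtain ⟨c, d, hcd⟩ := h.exists_evFst_eq G hG
    rw [hcd, map_add, map_mul, map_mul, evFst_C, evFst_C]
    refine (W.valuation.map_add _ _).trans_lt (max_lt ?_ ?_)
    · rw [map_mul]
      exact (mul_le_of_le_one_left' (h1 c)).trans_lt (hW2 u h.stage.u_mem)
    · rw [map_mul]
      exact (mul_le_of_le_one_left' (h1 d)).trans_lt (hW2 w h.stage.w_mem)
  refine ⟨h2, fun G hG => le_antisymm (h1 G) ?_⟩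
  obtain ⟨Q, hQ⟩ := h.exists_inv G hG
  by_contra hcon
  have h3 := h2 _ hQ
  rw [map_sub, map_mul, map_one] at h3
  have h4 : W.valuation (_root_.evFst Γ s Q * _root_.evFst Γ s G) < 1 := by
    rw [map_mul]
    exact (mul_le_of_le_one_left' (h1 Q)).trans_lt (not_le.1 hcon)
  have h5 := (W.valuation.map_sub _ _).trans_lt (max_lt h4 h3)
  rw [sub_sub_cancel, map_one] at h5
  exact lt_irrefl _ h5

variable {A : Subring K} (hA : ∀ a, a ∈ A ↔ ∃ b, (a, b) ∈ Γ) {D : Subring L}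
  (hD : ∀ z, z ∈ D ↔ ∃ b, (z, b) ∈ locGraph (_root_.evFst Γ s) (_root_.evSnd Γ l))

include hA hD

lemma exists_eq_sum (x : L) (hx : D.inNonunits x) :
    ∃ (n : ℕ) (a : Fin n → K) (c : Fin n → L), (∀ i, A.inNonunits (a i)) ∧ (∀ i, c i ∈ D) ∧
      x = ∑ i, c i * algebraMap K L (a i) := by
  have h1 := (h.isResGraph.inNonunits_iff hD x).1 hx
  have h2 : ¬ IsUnit (⟨_, h1⟩ : locGraph (_root_.evFst Γ s) (_root_.evSnd Γ l)) := by
    rw [h.isResGraph.isUnit_iff]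
    simp
  rw [h.not_isUnit_iff, Ideal.mem_span_pair] at h2
  obtain ⟨c, d, hcd⟩ := h2
  refine ⟨2, ![u, w], ![c.1.1, d.1.1], ?_, ?_, ?_⟩
  · rw [Fin.forall_fin_two]
    exact ⟨(h.stage.graph.inNonunits_iff hA u).2 h.stage.u_mem,
      (h.stage.graph.inNonunits_iff hA w).2 h.stage.w_mem⟩
  · rw [Fin.forall_fin_two]
    exact ⟨(hD _).2 ⟨_, c.2⟩, (hD _).2 ⟨_, d.2⟩⟩
  · have h3 : c.1.1 * _root_.evFst Γ s (C ⟨(u, 0), h.stage.u_mem⟩) +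
      d.1.1 * _root_.evFst Γ s (C ⟨(w, 0), h.stage.w_mem⟩) = x := congrArg (fun z => z.1.1) hcd
    rw [evFst_C, evFst_C] at h3
    simp [Fin.sum_univ_two, ← h3]

lemma inNonunits_sum (n : ℕ) (a : Fin n → K) (c : Fin n → L) (ha : ∀ i, A.inNonunits (a i))
    (hc : ∀ i, c i ∈ D) : D.inNonunits (∑ i, c i * algebraMap K L (a i)) := by
  rw [h.isResGraph.inNonunits_iff hD]
  choose b hb using fun i => (hD _).1 (hc i)
  have h1 := fun i => (h.stage.graph.inNonunits_iff hA _).1 (ha i)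
  have h2 := sum_mem (t := Finset.univ) fun i _ =>
    mul_mem (hb i) (algebraMap_mem_locGraph (L := L) (s := s) (l := l) (h1 i))
  simpa [← prod_mk_sum] using h2

lemma exists_inNonunits_sum : ∃ n : ℕ, ∀ z : Fin (n + 1) → L, (∀ i, z i ∈ D) →
    ∃ a : Fin (n + 1) → K, (∀ i, a i ∈ A) ∧ (∃ i, ¬ A.inNonunits (a i)) ∧
      D.inNonunits (∑ i, algebraMap K L (a i) * z i) := by
  obtain ⟨n, hn⟩ := h.exists_sum_snd_eq_zero
  refine ⟨n, fun z hz => ?_⟩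
  choose b hb using fun i => (hD _).1 (hz i)
  obtain ⟨a, ⟨i, hi⟩, ha⟩ := hn fun i => ⟨_, hb i⟩
  refine ⟨fun i => (a i).1.1, fun i => (hA _).2 ⟨_, (a i).2⟩, ⟨i, fun h0 => hi ?_⟩, ?_⟩
  · exact h.stage.graph.snd_unique (a i).2 ((h.stage.graph.inNonunits_iff hA _).1 h0)
  · rw [h.isResGraph.inNonunits_iff hD]
    have h2 := sum_mem (t := Finset.univ) fun i _ =>
      mul_mem (algebraMap_mem_locGraph (L := L) (s := s) (l := l) (a i).2) (hb i)
    have h3 : ∑ i, (a i).1.2 * b i = 0 := ha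
    simpa [← prod_mk_sum, h3] using h2

lemma exists_separable (z : L) (hz : z ∈ D) :
    ∃ P Q R : K[X], P.Monic ∧ (∀ i, P.coeff i ∈ A) ∧ D.inNonunits (aeval z P) ∧
      (∀ i, Q.coeff i ∈ A) ∧ (∀ i, R.coeff i ∈ A) ∧
      (∀ i : ℕ, A.inNonunits ((Q * P + R * derivative P - 1).coeff i)) := by
  obtain ⟨b, hb⟩ := (hD z).1 hz
  obtain ⟨P, Q, R, hP, hPb, hPQR⟩ := h.exists_separable_lift ⟨_, hb⟩
  have hcoeff : ∀ (G : Γ[X]) (i : ℕ), (G.map (IsResGraph.fstHom Γ)).coeff i ∈ A := by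
    intro G i
    rw [coeff_map]
    exact (hA _).2 ⟨_, (G.coeff i).2⟩
  refine ⟨P.map (IsResGraph.fstHom Γ), Q.map (IsResGraph.fstHom Γ), R.map (IsResGraph.fstHom Γ),
    hP.map _, hcoeff P, ?_, hcoeff Q, hcoeff R, fun i => ?_⟩
  · rw [h.isResGraph.inNonunits_iff hD]
    have h1 := evFst_mem_locGraph hb P
    have h2 : _root_.evSnd Γ b P = 0 := hPb
    rw [h2] at h1
    rw [aeval_def, eval₂_map]
    exact h1
  · rw [h.stage.graph.inNonunits_iff hA, derivative_map, ← Polynomial.map_mul,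
      ← Polynomial.map_mul, ← Polynomial.map_add,
      ← Polynomial.map_one (IsResGraph.fstHom Γ), ← Polynomial.map_sub, coeff_map]
    have h1 := (((Q * P + R * derivative P - 1).coeff i)).2
    rwa [← Prod.mk.eta (p := ((Q * P + R * derivative P - 1).coeff i).1), hPQR i] at h1

end IsUnramExt

end Dominated

end

section

open Polynomial

namespace Tower

section Values

variable {K F : Type*} [Field K] [Field F] (T : Tower K F)

lemma exists_eq_mul_add_mul {n : ℕ} {g : K} (hg : (g, (0 : F)) ∈ T.G n) :
    ∃ g₁ b₁ g₂ b₂, (g₁, b₁) ∈ T.G n ∧ (g₂, b₂) ∈ T.G n ∧ g = g₁ * T.z n + g₂ * T.z (n + 1) := by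
  have h1 := ((T.stage n).mem_span_iff ⟨_, hg⟩).2 rfl
  rw [Ideal.mem_span_pair] at h1
  obtain ⟨c, d, hcd⟩ := h1
  exact ⟨c.1.1, c.1.2, d.1.1, d.1.2, c.2, d.2, (congrArg (fun z => z.1.1) hcd).symm⟩

lemma exists_eq_z_succ_mul {n : ℕ} {g : K} (hg : (g, (0 : F)) ∈ T.G n) :
    ∃ g' b', (g', b') ∈ T.G (n + 1) ∧ g = T.z (n + 1) * g' := by
  obtain ⟨g₁, b₁, g₂, b₂, h1, h2, rfl⟩ := T.exists_eq_mul_add_mul hg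
  refine ⟨g₁ * (T.z n / T.z (n + 1)) + g₂, _,
    add_mem (mul_mem (T.G_le_succ n h1) (T.quot_mem n)) (T.G_le_succ n h2), ?_⟩
  have := T.z_ne_zero (n + 1)
  field_simp

lemma eq_zero_of_add_mul_lam {m : ℕ} {b b' : F} (hb : b ∈ T.E m) (hb' : b' ∈ T.E m)
    (h : b + b' * T.lam m = 0) : b = 0 ∧ b' = 0 := by
  by_cases h0 : b' = 0
  · rw [h0, zero_mul, add_zero] at h
    exact ⟨h, h0⟩
  · exfalso
    apply T.lam_notMem m
    have : T.lam m = -b / b' := by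
      rw [eq_div_iff h0]
      linear_combination h
    rw [this]
    exact div_mem (neg_mem hb) hb'

lemma quot_mem_of_not_even {n : ℕ} (hn : ¬ Even n) :
    (T.z n / T.z (n + 1), T.lam (n / 2)) ∈ T.G (n + 1) := by
  have := T.quot_mem n
  rwa [r, if_neg hn] at this

lemma quot_mem_of_even {n : ℕ} (hn : Even n) : (T.z n / T.z (n + 1), (0 : F)) ∈ T.G (n + 1) := by
  have := T.quot_mem n
  rwa [r, if_pos hn] at this

lemma exists_val_ne_of_not_even {n : ℕ} (hn : ¬ Even n) {f : K} {b : F} (hf : (f, b) ∈ T.G n)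
    (hf0 : f ≠ 0) : T.val f ≠ T.val (T.z (n + 1)) + T.val (T.z (n + 2)) := by
  intro heq
  obtain ⟨m, rfl⟩ := Nat.not_even_iff_odd.1 hn
  have hm : (2 * m + 1) / 2 = m := by omega
  have hv1 : T.val (T.z (2 * m + 1 + 1)) = 1 / 2 ^ m := by
    have := T.val_z_even (m + 1)
    rw [show 2 * (m + 1) = 2 * m + 1 + 1 by ring] at this
    rw [this, pow_succ]; field_simp
  have hv2 : T.val (T.z (2 * m + 1 + 2)) = 1 / 2 ^ m / 2 := by
    have := T.val_z_odd (m + 1)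
    rw [show 2 * (m + 1) + 1 = 2 * m + 1 + 2 by ring] at this
    rw [this, pow_succ]; field_simp
  have hpos : (0 : ℚ) < 1 / 2 ^ m := by positivity
  rw [hv1, hv2] at heq
  have hz := T.z_ne_zero (2 * m + 1 + 1)
  have hb : b = 0 := (T.snd_eq_zero_iff hf).2 (Or.inr (by rw [heq]; positivity))
  subst hb
  obtain ⟨g₁, b₁, g₂, b₂, h1, h2, hfe⟩ := T.exists_eq_mul_add_mul hf
  have hq := T.quot_mem_of_not_even hn
  rw [hm] at hq
  have hfe' : f = T.z (2 * m + 1 + 1) * (g₂ + g₁ * (T.z (2 * m + 1) / T.z (2 * m + 1 + 1))) := by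
    rw [hfe]; field_simp; ring
  have hmem := add_mem (T.G_le_succ _ h2) (mul_mem (T.G_le_succ _ h1) hq)
  rw [Prod.mk_mul_mk, Prod.mk_add_mk] at hmem
  have hne := right_ne_zero_of_mul (hfe' ▸ hf0)
  have h3 := (T.snd_eq_zero_iff hmem).2 (Or.inr (by
    have := congrArg T.val hfe'
    rw [T.val_mul hz hne, hv1, heq] at this
    linarith))
  have hE1 := T.snd_mem_G _ _ h1
  have hE2 := T.snd_mem_G _ _ h2
  rw [hm] at hE1 hE2
  obtain ⟨rfl, rfl⟩ := T.eq_zero_of_add_mul_lam hE2 hE1 h3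
  obtain ⟨g₁', b₁', h1', rfl⟩ := T.exists_eq_z_succ_mul h1
  obtain ⟨g₂', b₂', h2', rfl⟩ := T.exists_eq_z_succ_mul h2
  have hmem' := add_mem h2' (mul_mem h1' hq)
  have hfe'' : f = T.z (2 * m + 1 + 1) * (T.z (2 * m + 1 + 1) *
      (g₂' + g₁' * (T.z (2 * m + 1) / T.z (2 * m + 1 + 1)))) := by
    rw [hfe']; ring
  have hne1 := right_ne_zero_of_mul (hfe'' ▸ hf0)
  have hne2 := right_ne_zero_of_mul hne1
  have h4 := T.val_nonneg_of_mem hne2 hmem'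
  have := congrArg T.val hfe''
  rw [T.val_mul hz hne1, T.val_mul hz hne2, hv1, heq] at this
  linarith

lemma exists_val_ne_of_even {n : ℕ} (hn : Even n) {f : K} {b : F} (hf : (f, b) ∈ T.G n)
    (hf0 : f ≠ 0) : T.val f ≠ T.val (T.z n) + T.val (T.z (n + 3)) := by
  intro heq
  obtain ⟨m, rfl⟩ := even_iff_exists_two_mul.1 hn
  have hm : 2 * m / 2 = m := by omega
  have hm' : (2 * m + 1) / 2 = m := by omega
  have hodd : ¬ Even (2 * m + 1) := by simp
  have hv0 : T.val (T.z (2 * m)) = 2 * (1 / 2 ^ m) := by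
    rw [T.val_z_even m]; ring
  have hv1 : T.val (T.z (2 * m + 1)) = 1 / 2 ^ m := T.val_z_odd m
  have hv3 : T.val (T.z (2 * m + 3)) = 1 / 2 ^ m / 2 := by
    have := T.val_z_odd (m + 1)
    rw [show 2 * (m + 1) + 1 = 2 * m + 3 by ring] at this
    rw [this, pow_succ]; field_simp
  have hpos : (0 : ℚ) < 1 / 2 ^ m := by positivity
  rw [hv0, hv3] at heq
  have hz := T.z_ne_zero (2 * m)
  have hz1 := T.z_ne_zero (2 * m + 1)
  have hb : b = 0 := (T.snd_eq_zero_iff hf).2 (Or.inr (by rw [heq]; positivity))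
  subst hb
  obtain ⟨g₁, b₁, g₂, b₂, h1, h2, hfe⟩ := T.exists_eq_mul_add_mul hf
  have hfe' : f = T.z (2 * m + 1) * (g₂ + g₁ * (T.z (2 * m) / T.z (2 * m + 1))) := by
    rw [hfe]; field_simp; ring
  have hmem := add_mem (T.G_le_succ _ h2) (mul_mem (T.G_le_succ _ h1) (T.quot_mem_of_even hn))
  rw [Prod.mk_mul_mk, Prod.mk_add_mk, mul_zero, add_zero] at hmem
  have hne := right_ne_zero_of_mul (hfe' ▸ hf0)
  obtain rfl := (T.snd_eq_zero_iff hmem).2 (Or.inr (by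
    have := congrArg T.val hfe'
    rw [T.val_mul hz1 hne, hv1, heq] at this
    linarith))
  obtain ⟨g₃, b₃, g₄, b₄, h3, h4, rfl⟩ := T.exists_eq_mul_add_mul h2
  have hq := T.quot_mem_of_not_even hodd
  rw [hm', T.z_even hn] at hq
  have hle : T.G (2 * m) ≤ T.G (2 * m + 1 + 1) := T.G_mono (by omega)
  have hle' : T.G (2 * m + 1) ≤ T.G (2 * m + 1 + 1) := T.G_mono (by omega)
  have hfe2 : f = T.z (2 * m) * ((g₁ + g₃ * T.z (2 * m + 1)) +
      g₄ * (T.z (2 * m + 1) / (T.z (2 * m) / T.z (2 * m + 1)))) := by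
    rw [hfe]; field_simp; ring
  have hmem2 := add_mem (add_mem (hle h1) (mul_mem (hle h3) (hle (T.z_succ_mem _))))
    (mul_mem (hle h4) hq)
  simp only [Prod.mk_mul_mk, Prod.mk_add_mk, mul_zero, add_zero] at hmem2
  have hne2 := right_ne_zero_of_mul (hfe2 ▸ hf0)
  have h5 := (T.snd_eq_zero_iff hmem2).2 (Or.inr (by
    have := congrArg T.val hfe2
    rw [T.val_mul hz hne2, hv0, heq] at this
    linarith))
  have hE1 := T.snd_mem_G _ _ h1
  have hE4 := T.snd_mem_G _ _ h4
  rw [hm] at hE1 hE4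
  obtain ⟨rfl, rfl⟩ := T.eq_zero_of_add_mul_lam hE1 hE4 h5
  obtain ⟨g₁', b₁', h1', rfl⟩ := T.exists_eq_z_succ_mul h1
  obtain ⟨g₄', b₄', h4', rfl⟩ := T.exists_eq_z_succ_mul h4
  have hmem' := add_mem (add_mem (hle' h1') (hle h3)) (mul_mem (hle' h4') hq)
  have hfe3 : f = T.z (2 * m) * (T.z (2 * m + 1) * ((g₁' + g₃) +
      g₄' * (T.z (2 * m + 1) / (T.z (2 * m) / T.z (2 * m + 1))))) := by
    rw [hfe2]; ring
  have hne3 := right_ne_zero_of_mul (hfe3 ▸ hf0)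
  have hne4 := right_ne_zero_of_mul hne3
  have h6 := T.val_nonneg_of_mem hne4 hmem'
  have := congrArg T.val hfe3
  rw [T.val_mul hz hne3, T.val_mul hz1 hne4, hv0, hv1, heq] at this
  linarith

/-- There is a quotient `a = α / β` of elements of the `n`-th ring such that `a ^ p - c` has
positive value and the value of `β * (a ^ p - c)` is not attained on the `n`-th ring. -/
lemma exists_val_ne (n : ℕ) : ∃ α β : K, (∃ b, (α, b) ∈ T.G n) ∧ (∃ b, (β, b) ∈ T.G n) ∧ β ≠ 0 ∧
    T.val (α / β) = 0 ∧ α ≠ 0 ∧ (α / β) ^ T.p (n / 2) - T.cK ≠ 0 ∧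
    0 < T.val ((α / β) ^ T.p (n / 2) - T.cK) ∧
    ∀ f b, (f, b) ∈ T.G n → f ≠ 0 → T.val f ≠ T.val (β * ((α / β) ^ T.p (n / 2) - T.cK)) := by
  by_cases hn : Even n
  · have hodd : ¬ Even (n + 1) := by rw [Nat.even_add_one, not_not]; exact hn
    have hz := T.z_ne_zero n
    have hz1 := T.z_ne_zero (n + 1)
    have hz3 := T.z_ne_zero (n + 3)
    have hq := T.quot_mem_of_not_even hodd
    have hdiv : (n + 1) / 2 = n / 2 := by rw [Nat.even_iff] at hn; omega
    have ha : T.z (n + 1) ^ 2 / T.z n = T.z (n + 1) / T.z (n + 2) := by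
      rw [T.z_even hn]; field_simp
    have hξ : (T.z (n + 1) ^ 2 / T.z n) ^ T.p (n / 2) - T.cK = T.z (n + 3) := by
      have := T.z_odd hodd
      rw [hdiv] at this
      rw [ha]; exact this.symm
    refine ⟨T.z (n + 1) ^ 2, T.z n, ⟨_, pow_mem (T.z_succ_mem n) 2⟩, ⟨_, T.z_mem n⟩, hz, ?_,
      pow_ne_zero _ hz1, ?_, ?_, ?_⟩
    · rw [ha]
      exact T.val_eq_zero_of_mem (T.lam_ne_zero _) hq
    · rwa [hξ]
    · rw [hξ]
      exact T.val_pos_of_mem hz3 (T.z_mem _)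
    · intro f b hf hf0
      rw [hξ, T.val_mul hz hz3]
      exact T.exists_val_ne_of_even hn hf hf0
  · have hz1 := T.z_ne_zero (n + 1)
    have hz2 := T.z_ne_zero (n + 2)
    have hξ := (T.z_odd hn).symm
    refine ⟨T.z n, T.z (n + 1), ⟨_, T.z_mem n⟩, ⟨_, T.z_succ_mem n⟩, hz1, ?_, T.z_ne_zero n,
      ?_, ?_, ?_⟩
    · exact T.val_eq_zero_of_mem (T.lam_ne_zero _) (T.quot_mem_of_not_even hn)
    · rwa [hξ]
    · rw [hξ]
      exact T.val_pos_of_mem hz2 (T.z_mem _)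
    · intro f b hf hf0
      rw [hξ, T.val_mul hz1 hz2]
      exact T.exists_val_ne_of_not_even hn hf hf0

end Values

section Radical

variable {K F : Type*} [Field K] [Field F] (T : Tower K F)

lemma cF_ne_zero : T.cF ≠ 0 := by
  rw [← T.lam_pow 0]
  exact pow_ne_zero _ (T.lam_ne_zero 0)

lemma irreducible_cK (n : ℕ) : Irreducible (X ^ T.p (n / 2) - C T.cK : K[X]) := by
  rw [X_pow_sub_C_irreducible_iff_of_prime (T.p_prime _)]
  intro b hb
  have := (T.graph n).isDomain
  have := (T.stage n).reg.noeth
  have := (T.stage n).reg.ufm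
  obtain ⟨a, d, hd, hbd⟩ := T.frac b
  set a' : T.G n := ⟨a.1, T.G_mono (Nat.zero_le n) a.2⟩
  set d' : T.G n := ⟨d.1, T.G_mono (Nat.zero_le n) d.2⟩
  have h1 : a' ^ T.p (n / 2) = d' ^ T.p (n / 2) * ⟨_, T.c_mem_G n⟩ := by
    apply (T.graph n).ext_fst
    change a.1.1 ^ _ = d.1.1 ^ _ * T.cK
    rw [← hbd, mul_pow, hb, mul_comm]
  have h2 : d' ∣ a' := by
    rw [← UniqueFactorizationMonoid.pow_dvd_pow_iff_dvd (T.p_prime (n / 2)).ne_zero]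
    exact ⟨_, h1⟩
  obtain ⟨e, he⟩ := h2
  have h3 : e.1.1 = b := by
    have : a.1.1 = d.1.1 * e.1.1 := congrArg (fun z => z.1.1) he
    apply mul_left_cancel₀ hd
    rw [← this, ← hbd, mul_comm]
  have h4 : (b, e.1.2) ∈ T.G n := by rw [← h3]; exact e.2
  have h5 := pow_mem h4 (T.p (n / 2))
  rw [Prod.pow_mk, hb] at h5
  exact T.not_pow _ _ (T.snd_mem_G n _ h4) ((T.graph n).snd_unique h5 (T.c_mem_G n))

variable {L : Type*} [Field L] [Algebra K L] {s : L}

lemma isUnramExt (n : ℕ) (hp : (T.p (n / 2) : F) ≠ 0) (hs : s ^ T.p (n / 2) = algebraMap K L T.cK) :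
    IsUnramExt (T.G n) (T.z n) (T.z (n + 1)) s (T.lam (n / 2))
      (X ^ T.p (n / 2) - C ⟨(T.cK, T.cF), T.c_mem_G n⟩) := by
  have hp0 := (T.p_prime (n / 2)).ne_zero
  have hdom := (T.graph n).isDomain
  refine ⟨T.stage n, monic_X_pow_sub_C _ hp0,
    T.irreducible_X_pow_sub_C _ (T.snd_mem_G n), ?_, ?_, ?_, ?_⟩
  · rw [Polynomial.map_sub, Polynomial.map_pow, map_X, map_C]
    refine separable_X_pow_sub_C _ ?_ ?_
    · intro h
      apply hp
      have := congrArg Subtype.val h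
      simpa using this
    · rw [Ne, IsResGraph.res_eq_zero_iff]
      exact T.cF_ne_zero
  · simp [hs]
  · simp [T.lam_pow]
  · intro r hr hr0
    have h1 : minpoly K s = X ^ T.p (n / 2) - C T.cK :=
      (minpoly.eq_of_irreducible_of_monic (T.irreducible_cK n) (by simp [hs])
        (monic_X_pow_sub_C _ hp0)).symm
    have h2 : aeval s (r.map (IsResGraph.fstHom (T.G n))) = 0 := by
      rw [aeval_def, eval₂_map]
      exact hr0
    apply Polynomial.map_injective _ (T.graph n).fstHom_injective
    rw [Polynomial.map_zero]
    by_contra h3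
    have h4 := minpoly.degree_le_of_ne_zero K s h3 h2
    rw [h1, degree_X_pow_sub_C (Nat.pos_of_ne_zero hp0)] at h4
    rw [degree_X_pow_sub_C (Nat.pos_of_ne_zero hp0)] at hr
    exact absurd (h4.trans degree_map_le) (not_le.2 hr)

variable {W : ValuationSubring L}
  (hW : ∀ x : K, (algebraMap K L x ∈ W ↔ (x = 0 ∨ 0 ≤ T.val x)))

include hW

lemma valuation_lt_one {x : K} (h : x = 0 ∨ 0 < T.val x) : W.valuation (algebraMap K L x) < 1 := by
  by_cases hx : x = 0
  · simp [hx]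
  · have h := h.resolve_left hx
    by_contra hcon
    have h1 : W.valuation (algebraMap K L x⁻¹) ≤ 1 := by
      rw [map_inv₀, map_inv₀]
      exact inv_le_one_of_one_le₀ (not_lt.1 hcon)
    rw [W.valuation_le_one_iff, hW, T.val_inv hx] at h1
    have := h1.resolve_left (inv_ne_zero hx)
    linarith

lemma valuation_eq_one {x : K} (hx : x ≠ 0) (h : T.val x = 0) :
    W.valuation (algebraMap K L x) = 1 := by
  apply le_antisymm
  · rw [W.valuation_le_one_iff, hW]
    exact Or.inr h.ge
  · have h1 : W.valuation (algebraMap K L x⁻¹) ≤ 1 := by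
      rw [W.valuation_le_one_iff, hW, T.val_inv hx, h]
      simp
    rw [map_inv₀, map_inv₀] at h1
    exact (inv_le_one₀ (zero_lt_iff.2 (by simpa using hx))).1 h1

lemma val_eq_of_valuation_eq {x y : K} (hx : x ≠ 0) (hy : y ≠ 0)
    (h : W.valuation (algebraMap K L x) = W.valuation (algebraMap K L y)) : T.val x = T.val y := by
  have h0 : W.valuation (algebraMap K L y) ≠ 0 := by simpa using hy
  have h0' : W.valuation (algebraMap K L x) ≠ 0 := by simpa using hx
  have key : ∀ {x y : K}, x ≠ 0 → y ≠ 0 → W.valuation (algebraMap K L y) ≠ 0 →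
      W.valuation (algebraMap K L x) = W.valuation (algebraMap K L y) → T.val y ≤ T.val x := by
    intro x y hx hy h0 h
    have h1 : W.valuation (algebraMap K L (x * y⁻¹)) ≤ 1 := by
      rw [map_mul, map_mul, map_inv₀, map_inv₀, h, mul_inv_cancel₀ h0]
    rw [W.valuation_le_one_iff, hW, T.val_mul hx (inv_ne_zero hy), T.val_inv hy] at h1
    have := h1.resolve_left (mul_ne_zero hx (inv_ne_zero hy))
    linarith
  exact le_antisymm (key hy hx h0' h.symm) (key hx hy h0 h)

lemma mem_of_pow_eq {n : ℕ} (hs : s ^ T.p (n / 2) = algebraMap K L T.cK) : s ∈ W := by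
  have h1 : W.valuation s ^ T.p (n / 2) ≤ 1 := by
    rw [← map_pow, hs, W.valuation_le_one_iff, hW]
    exact Or.inr (T.val_eq_zero_of_mem T.cF_ne_zero (T.c_mem_G 0)).ge
  rw [← W.valuation_le_one_iff]
  exact (pow_le_one_iff (T.p_prime _).ne_zero).1 h1

lemma valDominates {n : ℕ} (hp : (T.p (n / 2) : F) ≠ 0)
    (hs : s ^ T.p (n / 2) = algebraMap K L T.cK) :
    ValDominates (T.G n) s (T.lam (n / 2)) W := by
  refine (T.isUnramExt n hp hs).valDominates (fun z hz => ?_) (fun a ha => ?_)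
    (T.mem_of_pow_eq hW hs)
  · rw [hW]
    by_cases h0 : z.1 = 0
    · exact Or.inl h0
    · exact Or.inr (T.val_nonneg_of_mem (b := z.2) h0 hz)
  · exact T.valuation_lt_one hW ((T.snd_eq_zero_iff ha).1 rfl)

/-- The extension of the valuation has new values on the extension ring. -/
lemma exists_valuation_ne {n : ℕ} (hp : (T.p (n / 2) : F) ≠ 0)
    (hs : s ^ T.p (n / 2) = algebraMap K L T.cK) {ζ : K} {ζ' : F} (hζ : (ζ, ζ') ∈ T.base)
    (hζ1 : IsPrimitiveRoot ζ (T.p (n / 2))) (hζ2 : IsPrimitiveRoot ζ' (T.p (n / 2))) :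
    ∃ h b, (h, b) ∈ locGraph (evFst (T.G n) s) (evSnd (T.G n) (T.lam (n / 2))) ∧ h ≠ 0 ∧
      ∀ f b, (f, b) ∈ T.G n → f ≠ 0 → W.valuation h ≠ W.valuation (algebraMap K L f) := by
  have hdom := T.valDominates hW hp hs
  obtain ⟨α, β, ⟨bα, hα⟩, ⟨bβ, hβ⟩, hβ0, hval, hα0, hξ0, hξ, hne⟩ := T.exists_val_ne n
  set a := α / β with ha
  set p := T.p (n / 2) with hpdef
  have hp0 : 0 < p := (T.p_prime (n / 2)).pos
  have ha0 : a ≠ 0 := div_ne_zero hα0 hβ0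
  have hζn : (ζ, ζ') ∈ T.G n := T.G_mono (Nat.zero_le n) hζ
  have hs1 : W.valuation s = 1 := by
    have := hdom.eq_one X (by rw [evSnd_X]; exact T.lam_ne_zero _)
    rwa [evFst_X] at this
  have ha1 := T.valuation_eq_one hW ha0 hval
  have hζ0 : ∀ i, W.valuation (algebraMap K L (ζ ^ i)) = 1 := by
    intro i
    refine T.valuation_eq_one hW (pow_ne_zero _ (hζ1.ne_zero hp0.ne')) ?_
    exact T.val_eq_zero_of_mem (pow_ne_zero _ (hζ2.ne_zero hp0.ne')) (pow_mem hζn i)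
  have hsub : ∀ i j, i < p → j < p → i ≠ j →
      W.valuation (algebraMap K L (ζ ^ i - ζ ^ j)) = 1 := by
    intro i j hi hj hij
    have h1 : ζ' ^ i - ζ' ^ j ≠ 0 := fun h => hij (hζ2.pow_inj hi hj (sub_eq_zero.1 h))
    have h2 : ζ ^ i - ζ ^ j ≠ 0 := fun h => hij (hζ1.pow_inj hi hj (sub_eq_zero.1 h))
    exact T.valuation_eq_one hW h2
      (T.val_eq_zero_of_mem h1 (sub_mem (pow_mem hζn i) (pow_mem hζn j)))
  set φ : ℕ → L := fun i => algebraMap K L a - algebraMap K L (ζ ^ i) * s with hφ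
  have hprod : ∏ i ∈ Finset.range p, φ i = algebraMap K L (a ^ p - T.cK) := by
    have h1 := X_pow_sub_C_eq_prod (hζ1.map_of_injective (algebraMap K L).injective) hp0 hs
    have h2 := congrArg (eval (algebraMap K L a)) h1
    rw [eval_sub, eval_pow, eval_X, eval_C, eval_prod] at h2
    rw [map_sub, map_pow, h2]
    refine Finset.prod_congr rfl fun i _ => ?_
    simp [hφ]
  have hle : ∀ i, W.valuation (φ i) ≤ 1 := by
    intro i
    refine (W.valuation.map_sub _ _).trans (max_le ha1.le ?_)
    rw [map_mul, hζ0, hs1, mul_one]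
  have hlt := T.valuation_lt_one hW (Or.inr hξ)
  rw [← hprod, map_prod] at hlt
  obtain ⟨i, hi, hilt⟩ : ∃ i ∈ Finset.range p, W.valuation (φ i) < 1 := by
    by_contra hcon
    push Not at hcon
    refine hlt.ne (Finset.prod_eq_one fun i hi => le_antisymm (hle i) (hcon i hi))
  have hφi : W.valuation (φ i) = W.valuation (algebraMap K L (a ^ p - T.cK)) := by
    rw [← hprod, map_prod]
    refine (Finset.prod_eq_single_of_mem i hi fun j hj hji => le_antisymm (hle j) ?_).symm
    by_contra hcon
    have h1 := (W.valuation.map_sub (φ j) (φ i)).trans_lt (max_lt (not_le.1 hcon) hilt)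
    have h2 : φ j - φ i = algebraMap K L (ζ ^ i - ζ ^ j) * s := by
      simp only [hφ, map_sub]
      ring
    rw [h2, map_mul, hsub i j (Finset.mem_range.1 hi) (Finset.mem_range.1 hj) (Ne.symm hji), hs1,
      mul_one] at h1
    exact lt_irrefl _ h1
  have hh : algebraMap K L β * φ i = evFst (T.G n) s
      (C ⟨_, hα⟩ - C ⟨_, pow_mem hζn i⟩ * X * C ⟨_, hβ⟩) := by
    have h1 : algebraMap K L α = algebraMap K L β * algebraMap K L a := by
      rw [← map_mul, ha, mul_div_cancel₀ _ hβ0]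
    simp only [map_sub, map_mul, evFst_C, evFst_X, h1, hφ]
    simp only [Prod.pow_fst]
    ring
  have hhv : W.valuation (algebraMap K L β * φ i) =
      W.valuation (algebraMap K L (β * (a ^ p - T.cK))) := by
    rw [map_mul, hφi, ← map_mul, ← map_mul]
  have hβξ : β * (a ^ p - T.cK) ≠ 0 := mul_ne_zero hβ0 hξ0
  have hmem := mk_mem_locGraph (evFst (T.G n) s) (evSnd (T.G n) (T.lam (n / 2)))
    (C ⟨_, hα⟩ - C ⟨_, pow_mem hζn i⟩ * X * C ⟨_, hβ⟩)
  rw [← hh] at hmem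
  refine ⟨algebraMap K L β * φ i, _, hmem, ?_, ?_⟩
  · intro h0
    rw [h0, map_zero] at hhv
    have h1 : W.valuation (algebraMap K L (β * (a ^ p - T.cK))) ≠ 0 := by
      rw [Ne, map_eq_zero, map_eq_zero]
      exact hβξ
    exact h1 hhv.symm
  · intro f b hf hf0 heq
    rw [hhv] at heq
    exact hne f b hf hf0 (T.val_eq_of_valuation_eq hW hβξ hf0 heq).symm

end Radical

end Tower

end

section Final

open Polynomial

lemma natCast_ne_zero_of_ringChar_ne {k : Type*} [Field k] {p : ℕ} (hp : p.Prime)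
    (h : ringChar k ≠ p) : (p : k) ≠ 0 := by
  rw [Ne, ringChar.spec]
  intro hd
  rcases (Nat.dvd_prime hp).1 hd with h1 | h1
  · exact CharP.ringChar_ne_one h1
  · exact h h1

lemma exists_isPrimitiveRoot {k : Type*} [Field k] [IsAlgClosed k] {p : ℕ} (hp : (p : k) ≠ 0) :
    ∃ ζ : k, IsPrimitiveRoot ζ p := by
  have : NeZero (p : k) := ⟨hp⟩
  exact HasEnoughRootsOfUnity.exists_primitiveRoot k p

lemma mem_baseGraph_C {k F : Type*} [Field k] [Field F] [Algebra (RatFunc k) F] (c : RatFunc k) :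
    (algebraMap (RP2 k) (K2 k) (MvPolynomial.C c), algebraMap (RatFunc k) F c) ∈
      baseGraph k F := by
  have := mk_mem_locGraph (algebraMap (RP2 k) (K2 k)) (evZero k F) (MvPolynomial.C c)
  have he : evZero k F (MvPolynomial.C c) = algebraMap (RatFunc k) F c := by
    rw [evZero, RingHom.comp_apply, MvPolynomial.eval_C]
  rwa [he] at this

lemma Tower.finrank_adjoin {K F : Type*} [Field K] [Field F] (T : Tower K F) (n : ℕ) {L : Type*}
    [Field L] [Algebra K L] {s : L} (hs : s ^ T.p (n / 2) = algebraMap K L T.cK) :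
    Module.finrank K (IntermediateField.adjoin K {s}) = T.p (n / 2) := by
  have h1 : minpoly K s = X ^ T.p (n / 2) - C T.cK :=
    (minpoly.eq_of_irreducible_of_monic (T.irreducible_cK n) (by simp [hs])
      (monic_X_pow_sub_C _ (T.p_prime _).ne_zero)).symm
  have h2 : IsIntegral K s := ⟨X ^ T.p (n / 2) - C T.cK,
    monic_X_pow_sub_C _ (T.p_prime _).ne_zero, by simp [hs]⟩
  rw [IntermediateField.adjoin.finrank h2, h1, natDegree_X_pow_sub_C]

end Final

theorem extensions_of_valuations_statement2 (k : Type*) [Field k] [IsAlgClosed k] :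
    ∃ v : K2 k → ℚ, IsQValuation v ∧ QDominates v (R0 k) ∧
      ∀ A : Subring (K2 k), IsRegularLocal A → IsFractionSubring A →
        SDominates A (R0 k) → QDominates v A →
        ∃ (pb : ℕ) (lam : AlgebraicClosure (K2 k)),
          pb.Prime ∧ ringChar k ≠ pb ∧
          lam ^ pb = algebraMap (K2 k) (AlgebraicClosure (K2 k)) (onePlusT k) ∧
          Module.finrank (K2 k) (Lext k lam) = pb ∧
          ∀ W : ValuationSubring (Lext k lam),
            (∀ x : K2 k,
              (algebraMap (K2 k) (Lext k lam) x ∈ W ↔ (x = 0 ∨ 0 ≤ v x))) →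
            ∀ C : Subring (Lext k lam),
              (∀ z : Lext k lam, z ∈ C ↔ ∃ b s : Lext k lam, b ∈ Bgen k A lam ∧
                s ∈ Bgen k A lam ∧ ¬ W.valuation s < 1 ∧ z * s = b) →
              (IsRegularLocal C ∧
                ((C : Set (Lext k lam)) ⊆ (W : Set (Lext k lam)) ∧
                  ∀ x ∈ C, (W.valuation x < 1 ↔ C.inNonunits x))) ∧
              ((∀ u : Lext k lam, C.inNonunits u →
                  ∃ (n : ℕ) (a : Fin n → K2 k) (c : Fin n → Lext k lam),
                    (∀ i, A.inNonunits (a i)) ∧ (∀ i, c i ∈ C) ∧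
                    u = ∑ i, c i * algebraMap (K2 k) (Lext k lam) (a i)) ∧
               (∀ (n : ℕ) (a : Fin n → K2 k) (c : Fin n → Lext k lam),
                  (∀ i, A.inNonunits (a i)) → (∀ i, c i ∈ C) →
                  C.inNonunits (∑ i, c i * algebraMap (K2 k) (Lext k lam) (a i))) ∧
               (∃ n : ℕ, ∀ z : Fin (n + 1) → Lext k lam, (∀ i, z i ∈ C) →
                  ∃ a : Fin (n + 1) → K2 k, (∀ i, a i ∈ A) ∧
                    (∃ i, ¬ A.inNonunits (a i)) ∧
                    C.inNonunits (∑ i, algebraMap (K2 k) (Lext k lam) (a i) * z i)) ∧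
               (∀ z : Lext k lam, z ∈ C →
                  ∃ P Q R : Polynomial (K2 k), P.Monic ∧ (∀ i, P.coeff i ∈ A) ∧
                    C.inNonunits (Polynomial.aeval z P) ∧
                    (∀ i, Q.coeff i ∈ A) ∧ (∀ i, R.coeff i ∈ A) ∧
                    (∀ i : ℕ, A.inNonunits
                      ((Q * P + R * Polynomial.derivative P - 1).coeff i)))) ∧
              (∃ h : Lext k lam, h ∈ C ∧ h ≠ 0 ∧ ∀ f : K2 k, f ∈ A → f ≠ 0 →
                W.valuation h ≠ W.valuation (algebraMap (K2 k) (Lext k lam) f)) := by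
  obtain ⟨T, hc, hbase, hchar⟩ := exists_tower k (AlgebraicClosure (RatFunc k))
  refine ⟨T.val, isQValuation_val T, qDominates_R0 T hbase, ?_⟩
  intro A hA _ hA0 hAv
  obtain ⟨n, hn⟩ := exists_eq_G_of_isRegularLocal T hbase hA hA0.1 hAv
  have hp := T.p_prime (n / 2)
  have hpk : ((T.p (n / 2) : ℕ) : k) ≠ 0 := natCast_ne_zero_of_ringChar_ne hp (hchar _)
  have hpF : ((T.p (n / 2) : ℕ) : AlgebraicClosure (RatFunc k)) ≠ 0 := by
    rw [← map_natCast (algebraMap (RatFunc k) (AlgebraicClosure (RatFunc k))),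
      ← map_natCast (algebraMap k (RatFunc k)), Ne, map_eq_zero, map_eq_zero]
    exact hpk
  obtain ⟨lam, hlam⟩ := IsAlgClosed.exists_pow_nat_eq
    (algebraMap (K2 k) (AlgebraicClosure (K2 k)) (onePlusT k)) hp.pos
  refine ⟨T.p (n / 2), lam, hp, hchar _, hlam, ?_, ?_⟩
  · exact T.finrank_adjoin n (by rw [hlam, hc])
  intro W hW D hD
  have hs : lamel k lam ^ T.p (n / 2) = algebraMap (K2 k) (Lext k lam) T.cK := by
    rw [hc]
    exact Subtype.ext hlam
  have hU := T.isUnramExt n hpF hs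
  have hdom := T.valDominates hW hpF hs
  have hmem := hdom.mem_iff hn hD
  refine ⟨⟨hU.isRegularLocal.of_ringEquiv (hU.isResGraph.ringEquiv hmem), fun z hz => ?_,
    fun x hx => ?_⟩, ⟨hU.exists_eq_sum hn hmem, hU.inNonunits_sum hn hmem,
    hU.exists_inNonunits_sum hn hmem, hU.exists_separable hn hmem⟩, ?_⟩
  · obtain ⟨b, hb⟩ := (hmem z).1 hz
    exact (W.valuation_le_one_iff z).1 (hdom.valuation_of_mem hb).1
  · obtain ⟨b, hb⟩ := (hmem x).1 hx
    rw [(hdom.valuation_of_mem hb).2, hU.isResGraph.inNonunits_iff hmem]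
    constructor
    · rintro rfl
      exact hb
    · exact fun h => hU.isResGraph.snd_unique hb h
  · obtain ⟨ζ, hζ⟩ := exists_isPrimitiveRoot hpk
    obtain ⟨x, b, hx, hx0, hne⟩ := T.exists_valuation_ne hW hpF hs
      (ζ := algebraMap (RP2 k) (K2 k) (MvPolynomial.C (algebraMap k (RatFunc k) ζ)))
      (ζ' := algebraMap (RatFunc k) _ (algebraMap k (RatFunc k) ζ))
      (by rw [hbase]; exact mem_baseGraph_C _)
      (hζ.map_of_injective (f := (algebraMap (RP2 k) (K2 k)).comp
        (MvPolynomial.C.comp (algebraMap k (RatFunc k)))) (RingHom.injective _))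
      (hζ.map_of_injective (f := (algebraMap (RatFunc k) (AlgebraicClosure (RatFunc k))).comp
        (algebraMap k (RatFunc k))) (RingHom.injective _))
    refine ⟨x, (hmem x).2 ⟨b, hx⟩, hx0, fun f hf hf0 => ?_⟩
    obtain ⟨b', hb'⟩ := (hn f).1 hf
    exact hne f b' hb' hf0
end
end

section
/- Let ν be a real-valued valuation (v : K* → ℝ, so ν has rank at most 1) of a field K which dominates a Noetherian local domain R with quotient field K, and let R̂ be the m_R-adic completion of R. Suppose h ∈ R̂ and (f_n), (g_n) are sequences in R which converge m_R-adically to h (i.e., for every m there is N with f_n − h ∈ m_R^m·R̂ for all n ≥ N, and likewise for g_n), and suppose the values ν(f_n) do not tend to +∞. Then there exist an index N and a value γ ∈ S^R(ν) such that ν(f_n) = γ and ν(g_n) = γ for all n ≥ N; in particular the eventual value γ depends only on h and not on the chosen sequence. -/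
noncomputable section

/-- `v` is (the additive form of) a real-valued valuation on the field `K`. -/
def IsRealValuation {K : Type*} [Field K] (v : K → ℝ) : Prop :=
  (∀ a b : K, a ≠ 0 → b ≠ 0 → v (a * b) = v a + v b) ∧
  (∀ a b : K, a ≠ 0 → b ≠ 0 → a + b ≠ 0 → min (v a) (v b) ≤ v (a + b))

/-- The valuation `v` on the quotient field of `R` dominates the local domain `R`:
`R ⊆ V_v` and `m_v ∩ R = m_R`. -/
def DominatesLocal (R : Type*) [CommRing R] [IsDomain R] [IsLocalRing R]
    (v : FractionRing R → ℝ) : Prop :=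
  (∀ r : R, r ≠ 0 → 0 ≤ v (algebraMap R (FractionRing R) r)) ∧
  (∀ r : R, r ≠ 0 →
    (0 < v (algebraMap R (FractionRing R) r) ↔ r ∈ IsLocalRing.maximalIdeal R))

/-- The sequence `f` in `R` converges `m_R`-adically to `h` in the completion `R̂`. -/
def ConvTo (R : Type*) [CommRing R] [IsLocalRing R] (f : ℕ → R)
    (h : AdicCompletion (IsLocalRing.maximalIdeal R) R) : Prop :=
  ∀ m : ℕ, ∃ N : ℕ, ∀ n ≥ N,
    algebraMap R (AdicCompletion (IsLocalRing.maximalIdeal R) R) (f n) - h ∈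
      (IsLocalRing.maximalIdeal R ^ m).map
        (algebraMap R (AdicCompletion (IsLocalRing.maximalIdeal R) R))

/-- `v (f n) → +∞`, with the convention `v 0 = +∞`. -/
def ValTendstoTop (R : Type*) [CommRing R] [IsDomain R]
    (v : FractionRing R → ℝ) (f : ℕ → R) : Prop :=
  ∀ B : ℝ, ∃ N : ℕ, ∀ n ≥ N, f n = 0 ∨ B < v (algebraMap R (FractionRing R) (f n))

/-- The prime ideal `P(R̂)_∞` of elements of the completion of value `∞`. -/
def PInf (R : Type*) [CommRing R] [IsDomain R] [IsLocalRing R]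
    (v : FractionRing R → ℝ) : Set (AdicCompletion (IsLocalRing.maximalIdeal R) R) :=
  {h | ∃ f : ℕ → R, ConvTo R f h ∧ ValTendstoTop R v f}

theorem IsRealValuation.map_neg {K : Type*} [Field K] {v : K → ℝ} (hv : IsRealValuation v)
    {a : K} (ha : a ≠ 0) : v (-a) = v a := by
  have h1 : v 1 = 0 := by simpa using hv.1 1 1 one_ne_zero one_ne_zero
  have h2 := hv.1 (-1) (-1) (neg_ne_zero.2 one_ne_zero) (neg_ne_zero.2 one_ne_zero)
  rw [neg_mul_neg, mul_one, h1] at h2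
  have h3 := hv.1 (-1) a (neg_ne_zero.2 one_ne_zero) ha
  rw [neg_one_mul] at h3
  linarith

theorem IsRealValuation.map_eq_of_sub_lt {K : Type*} [Field K] {v : K → ℝ}
    (hv : IsRealValuation v) {a b : K} (hb : b ≠ 0) (hab : a - b ≠ 0 → v b < v (a - b)) :
    a ≠ 0 ∧ v a = v b := by
  rcases eq_or_ne a b with rfl | hne
  · exact ⟨hb, rfl⟩
  have hd := sub_ne_zero.2 hne
  have hlt := hab hd
  have ha : a ≠ 0 := by
    rintro rfl
    rw [zero_sub, hv.map_neg hb] at hlt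
    exact lt_irrefl _ hlt
  refine ⟨ha, le_antisymm ?_ ?_⟩
  · have h := hv.2 a (-(a - b)) ha (neg_ne_zero.2 hd) (by simpa using hb)
    rw [hv.map_neg hd, show a + -(a - b) = b by ring] at h
    exact (min_le_iff.1 h).resolve_right hlt.not_ge
  · have h := hv.2 b (a - b) hb hd (by simpa using ha)
    rwa [add_sub_cancel, min_eq_left hlt.le] at h

/-- The ideal of elements of `R` of value at least `c`. -/
def valueIdeal (R : Type*) [CommRing R] [IsDomain R] (v : FractionRing R → ℝ)
    (hv : IsRealValuation v)
    (hnonneg : ∀ r : R, r ≠ 0 → 0 ≤ v (algebraMap R (FractionRing R) r)) (c : ℝ) : Ideal R where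
  carrier := {r | r ≠ 0 → c ≤ v (algebraMap R (FractionRing R) r)}
  zero_mem' := fun h => absurd rfl h
  add_mem' := by
    intro a b ha hb hab
    rcases eq_or_ne a 0 with rfl | ha0
    · rw [zero_add] at hab ⊢
      exact hb hab
    rcases eq_or_ne b 0 with rfl | hb0
    · rw [add_zero]
      exact ha ha0
    have h := hv.2 (algebraMap R (FractionRing R) a) (algebraMap R (FractionRing R) b)
      (by simpa using ha0) (by simpa using hb0) (by
        rw [← map_add]
        exact (map_ne_zero_iff _ (IsFractionRing.injective R (FractionRing R))).2 hab)
    rw [← map_add] at h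
    exact (le_min (ha ha0) (hb hb0)).trans h
  smul_mem' := by
    intro r a ha hra
    obtain ⟨hr0, ha0⟩ := mul_ne_zero_iff.1 hra
    rw [smul_eq_mul, map_mul, hv.1 _ _ (by simpa using hr0) (by simpa using ha0)]
    linarith [ha ha0, hnonneg r hr0]

theorem pow_le_valueIdeal {R : Type*} [CommRing R] [IsDomain R] {v : FractionRing R → ℝ}
    (hv : IsRealValuation v)
    (hnonneg : ∀ r : R, r ≠ 0 → 0 ≤ v (algebraMap R (FractionRing R) r))
    {I : Ideal R} {c : ℝ} (hI : I ≤ valueIdeal R v hv hnonneg c) (k : ℕ) :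
    I ^ k ≤ valueIdeal R v hv hnonneg (k * c) := by
  induction k with
  | zero =>
    intro r _ hr0
    simpa using hnonneg r hr0
  | succ k ih =>
    rw [pow_succ, Ideal.mul_le]
    intro a ha b hb hab
    obtain ⟨ha0, hb0⟩ := mul_ne_zero_iff.1 hab
    have h1 := ih ha ha0
    have h2 := hI hb hb0
    rw [map_mul, hv.1 _ _ (by simpa using ha0) (by simpa using hb0)]
    push_cast
    linarith

theorem exists_pos_le_valueIdeal {R : Type*} [CommRing R] [IsDomain R] {v : FractionRing R → ℝ}
    (hv : IsRealValuation v)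
    (hnonneg : ∀ r : R, r ≠ 0 → 0 ≤ v (algebraMap R (FractionRing R) r))
    {I : Ideal R} (hfg : I.FG)
    (hpos : ∀ r ∈ I, r ≠ 0 → 0 < v (algebraMap R (FractionRing R) r)) :
    ∃ c : ℝ, 0 < c ∧ I ≤ valueIdeal R v hv hnonneg c := by
  classical
  obtain ⟨s, rfl⟩ := hfg
  have key : ∀ t ⊆ s, ∃ c : ℝ, 0 < c ∧
      ∀ x ∈ t, x ≠ 0 → c ≤ v (algebraMap R (FractionRing R) x) := by
    intro t
    induction t using Finset.induction_on with
    | empty => exact fun _ => ⟨1, one_pos, by simp⟩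
    | insert a t _ ih =>
      intro hts
      obtain ⟨c, hc, hct⟩ := ih fun x hx => hts (Finset.mem_insert_of_mem hx)
      by_cases ha : a = 0
      · refine ⟨c, hc, fun x hx hx0 => ?_⟩
        exact hct x ((Finset.mem_insert.1 hx).resolve_left fun h => hx0 (h.trans ha)) hx0
      · have hva := hpos a (Ideal.subset_span (hts (Finset.mem_insert_self a t))) ha
        refine ⟨min c (v (algebraMap R (FractionRing R) a)), lt_min hc hva, fun x hx hx0 => ?_⟩
        rcases Finset.mem_insert.1 hx with rfl | hx
        · exact min_le_right _ _
        · exact (min_le_left _ _).trans (hct x hx hx0)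
  obtain ⟨c, hc, hcs⟩ := key s subset_rfl
  exact ⟨c, hc, Ideal.span_le.2 fun x hx hx0 => hcs x hx hx0⟩

theorem AdicCompletion.mem_pow_of_algebraMap_mem_map {R : Type*} [CommRing R] {I : Ideal R}
    {k : ℕ} {r : R}
    (hr : algebraMap R (AdicCompletion I R) r ∈ (I ^ k).map (algebraMap R (AdicCompletion I R))) :
    r ∈ I ^ k := by
  have hle : (I ^ k).map (algebraMap R (AdicCompletion I R)) ≤
      RingHom.ker (AdicCompletion.evalₐ I k) := by
    rw [Ideal.map_le_iff_le_comap]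
    intro x hx
    rw [Ideal.mem_comap, RingHom.mem_ker, AlgHom.commutes]
    exact Ideal.Quotient.eq_zero_iff_mem.2 hx
  have h := hle hr
  rw [RingHom.mem_ker, AlgHom.commutes] at h
  exact Ideal.Quotient.eq_zero_iff_mem.1 h

theorem extensions_of_valuations_statement3 (R : Type*) [CommRing R] [IsDomain R]
    [IsLocalRing R] [IsNoetherianRing R]
    (v : FractionRing R → ℝ) (hv : IsRealValuation v) (hdom : DominatesLocal R v)
    (h : AdicCompletion (IsLocalRing.maximalIdeal R) R)
    (f g : ℕ → R) (hf : ConvTo R f h) (hg : ConvTo R g h)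
    (hnot : ¬ ValTendstoTop R v f) :
    ∃ (N : ℕ) (γ : ℝ), (∃ r : R, r ≠ 0 ∧ γ = v (algebraMap R (FractionRing R) r)) ∧
      ∀ n ≥ N, f n ≠ 0 ∧ v (algebraMap R (FractionRing R) (f n)) = γ ∧
        g n ≠ 0 ∧ v (algebraMap R (FractionRing R) (g n)) = γ := by
  obtain ⟨c, hc, hle⟩ := exists_pos_le_valueIdeal hv hdom.1
    (IsNoetherian.noetherian (IsLocalRing.maximalIdeal R)) fun r hr hr0 => (hdom.2 r hr0).2 hr
  simp only [ValTendstoTop, not_forall, not_exists, not_or, not_lt] at hnot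
  obtain ⟨B, hB⟩ := hnot
  obtain ⟨k, hk⟩ := exists_nat_gt (B / c)
  rw [div_lt_iff₀ hc] at hk
  obtain ⟨Nf, hNf⟩ := hf k
  obtain ⟨Ng, hNg⟩ := hg k
  obtain ⟨p, hp, hp0, hpB⟩ := hB (max Nf Ng)
  have key : ∀ a : R, algebraMap R (AdicCompletion (IsLocalRing.maximalIdeal R) R) a - h ∈
      (IsLocalRing.maximalIdeal R ^ k).map
        (algebraMap R (AdicCompletion (IsLocalRing.maximalIdeal R) R)) →
      a ≠ 0 ∧ v (algebraMap R (FractionRing R) a) = v (algebraMap R (FractionRing R) (f p)) := by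
    intro a ha
    have hsub := sub_mem ha (hNf p ((le_max_left _ _).trans hp))
    rw [sub_sub_sub_cancel_right, ← map_sub] at hsub
    have hmem := pow_le_valueIdeal hv hdom.1 hle k
      (AdicCompletion.mem_pow_of_algebraMap_mem_map hsub)
    have hval := hv.map_eq_of_sub_lt (a := algebraMap R (FractionRing R) a)
      (b := algebraMap R (FractionRing R) (f p)) (by simpa using hp0) (by
        rw [← map_sub]
        intro hne
        exact (hpB.trans_lt hk).trans_le
          (hmem ((map_ne_zero_iff _ (IsFractionRing.injective R (FractionRing R))).1 hne)))
    exact ⟨by simpa using hval.1, hval.2⟩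
  refine ⟨max Nf Ng, _, ⟨f p, hp0, rfl⟩, fun n hn => ?_⟩
  obtain ⟨hf0, hfv⟩ := key (f n) (hNf n ((le_max_left _ _).trans hn))
  obtain ⟨hg0, hgv⟩ := key (g n) (hNg n ((le_max_right _ _).trans hn))
  exact ⟨hf0, hfv, hg0, hgv⟩
end
end

section
/- Let ν be a real-valued valuation (v : K* → ℝ, so ν has rank at most 1) of a field K which dominates a Noetherian local domain R, not a field, with quotient field K, and let R̂ be the m_R-adic completion of R. Let ν(m_R) := min{ν(x) : x ∈ m_R \ {0}} (this minimum exists and is positive since R is Noetherian and ν dominates R). Define P(R̂)_∞ := {h ∈ R̂ : there exists a sequence (f_n) in R converging m_R-adically to h with ν(f_n) → +∞}. Then for every h ∈ R̂ \ P(R̂)_∞ there exist f ∈ R \ {0} and a positive integer m such that h − f ∈ m_R^m·R̂ and ν(f) < m·ν(m_R). (Consequently h and f have the same initial form, which yields the isomorphism gr_ν(R) ≅ gr_ν̂(R̂/P(R̂)_∞) of Lemma 1.2.) -/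
/-- For a finitely generated ideal `I`, every element of the `I`-adic completion is congruent
modulo `I ^ n` to an element of `R`. -/
theorem AdicCompletion.exists_algebraMap_sub_mem_map_pow {R : Type*} [CommRing R] {I : Ideal R}
    (hI : I.FG) (h : AdicCompletion I R) (n : ℕ) :
    ∃ r : R, algebraMap R (AdicCompletion I R) r - h ∈
      (I ^ n).map (algebraMap R (AdicCompletion I R)) := by
  obtain ⟨r, hr⟩ := Submodule.Quotient.mk_surjective _ (AdicCompletion.eval I R n h)
  refine ⟨r, ?_⟩
  rw [← Submodule.restrictScalars_mem R, ← Ideal.smul_top_eq_map,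
    AdicCompletion.pow_smul_top_eq_ker_eval hI, LinearMap.mem_ker, map_sub, sub_eq_zero, ← hr]
  rfl


noncomputable section

theorem extensions_of_valuations_statement4 (R : Type*) [CommRing R] [IsDomain R]
    [IsLocalRing R] [IsNoetherianRing R] (hnf : ¬ IsField R)
    (v : FractionRing R → ℝ) (hv : IsRealValuation v) (hdom : DominatesLocal R v)
    (c : ℝ)
    (hc : IsLeast {r : ℝ | ∃ x : R, x ∈ IsLocalRing.maximalIdeal R ∧ x ≠ 0 ∧
      r = v (algebraMap R (FractionRing R) x)} c)
    (h : AdicCompletion (IsLocalRing.maximalIdeal R) R) (hh : h ∉ PInf R v) :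
    ∃ (f : R) (m : ℕ), f ≠ 0 ∧ 0 < m ∧
      algebraMap R (AdicCompletion (IsLocalRing.maximalIdeal R) R) f - h ∈
        (IsLocalRing.maximalIdeal R ^ m).map
          (algebraMap R (AdicCompletion (IsLocalRing.maximalIdeal R) R)) ∧
      v (algebraMap R (FractionRing R) f) < (m : ℝ) * c := by
  have c_pos : 0 < c := by
    obtain ⟨x, hxm, hx0, rfl⟩ := hc.1
    exact (hdom.2 x hx0).2 hxm
  choose f hf using AdicCompletion.exists_algebraMap_sub_mem_map_pow
    (IsLocalRing.maximalIdeal R).fg_of_isNoetherianRing h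
  by_contra! H
  refine hh ⟨f, fun m ↦ ⟨m, fun n hn ↦ Ideal.map_mono (Ideal.pow_le_pow_right hn) (hf n)⟩,
    fun B ↦ ?_⟩
  obtain ⟨N, hN⟩ := exists_nat_gt (B / c)
  refine ⟨N + 1, fun n hn ↦ or_iff_not_imp_left.2 fun hn0 ↦ ?_⟩
  have hNn : (N : ℝ) ≤ n := by exact_mod_cast (by lia : N ≤ n)
  calc
    B < N * c := (div_lt_iff₀ c_pos).1 hN
    _ ≤ n * c := by gcongr
    _ ≤ v (algebraMap R (FractionRing R) (f n)) := H (f n) n hn0 (by lia) (hf n)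
end
end
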